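/- arXiv:1703.05318 — 2 statements merged into one kernel-verified Lean document; each statement's English description precedes it below -/
import Mathlib

section
/- Let u₁, u₂, u₃ ∈ ℝ³ be affinely independent, and for each k ∈ {1, 2, 3} let S_k be an embedded, immersed simplicial vertex star at u_k whose cycle of neighbor points contains the other two points u_l (l ≠ k) consecutively, so that the triangle T = conv{u₁, u₂, u₃} is a face of each of the three stars; assume moreover that for each edge of T the two stars at its endpoints have a common face adjacent to T along that edge. If for each k the Gauss image of S_k has no self-intersections and the discrete Gaussian curvature K(u_k) is positive, then there exists a nonzero vector ν orthogonal to both u₂ − u₁ and u₃ − u₁ such that every neighbor point w of each of the three stars satisfies ⟨w − u₁, ν⟩ ≤ 0; that is, a neighborhood of the face T lies in a closed half-space bounded by the plane of T and thus forms part of the boundary of a convex body. (Proposition 3.1, simplicial case.) -/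
open RealInnerProductSpace

noncomputable section

/-- Euclidean 3-space. -/
abbrev E3 : Type := EuclideanSpace ℝ (Fin 3)

/-- The cross product on `E3`. -/
noncomputable def cross3 (a b : E3) : E3 :=
  (WithLp.equiv 2 (Fin 3 → ℝ)).symm
    ![a 1 * b 2 - a 2 * b 1, a 2 * b 0 - a 0 * b 2, a 0 * b 1 - a 1 * b 0]

/-- The face `Tᵢ = conv {v, wᵢ, wᵢ₊₁}` of a simplicial vertex star `(v; w)`;
indices are taken modulo `n`. -/
def starFace {n : ℕ} (v : E3) (w : ZMod n → E3) (i : ZMod n) : Set E3 :=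
  convexHull ℝ {v, w i, w (i + 1)}

/-- The unnormalized face normal `mᵢ = (wᵢ − v) × (wᵢ₊₁ − v)`. -/
noncomputable def starFN {n : ℕ} (v : E3) (w : ZMod n → E3) (i : ZMod n) : E3 :=
  cross3 (w i - v) (w (i + 1) - v)

/-- The unit face normal `nᵢ = mᵢ / ‖mᵢ‖`. -/
noncomputable def starUN {n : ℕ} (v : E3) (w : ZMod n → E3) (i : ZMod n) : E3 :=
  ‖starFN v w i‖⁻¹ • starFN v w i

/-- `(v; w₀, …, w_{n−1})` is an embedded, immersed simplicial vertex star: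
`n ≥ 3`; consecutive edge vectors are linearly independent; distinct faces meet
exactly in their common edge (adjacent case) or in `{v}` (non-adjacent case);
and consecutive unit normals satisfy `nᵢ₊₁ ≠ ±nᵢ`. -/
def IsStar {n : ℕ} (v : E3) (w : ZMod n → E3) : Prop :=
  3 ≤ n ∧
  (∀ i : ZMod n, LinearIndependent ℝ ![w i - v, w (i + 1) - v]) ∧
  (∀ i : ZMod n, starUN v w (i + 1) ≠ starUN v w i ∧ starUN v w (i + 1) ≠ -starUN v w i) ∧
  (∀ i j : ZMod n, i ≠ j →
    (j = i + 1 → starFace v w i ∩ starFace v w j = segment ℝ v (w j)) ∧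
    (i = j + 1 → starFace v w i ∩ starFace v w j = segment ℝ v (w i)) ∧
    (j ≠ i + 1 → i ≠ j + 1 → starFace v w i ∩ starFace v w j = {v}))

/-- The shorter great-circle arc `Arc(p, q)` joining two unit vectors `p ≠ ±q`. -/
def sArc (p q : E3) : Set E3 :=
  {x | ∃ s t : ℝ, 0 ≤ s ∧ 0 ≤ t ∧ 0 < s + t ∧ x = ‖s • p + t • q‖⁻¹ • (s • p + t • q)}

/-- The Gauss image of the vertex star (the spherical polygon with vertices `nᵢ` and
edges `Arc(nᵢ, nᵢ₊₁)`) has no self-intersections. -/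
def GaussEmb {n : ℕ} (v : E3) (w : ZMod n → E3) : Prop :=
  Function.Injective (starUN v w) ∧
  ∀ i j : ZMod n, i ≠ j →
    (j = i + 1 →
      sArc (starUN v w i) (starUN v w (i + 1)) ∩ sArc (starUN v w j) (starUN v w (j + 1)) =
        {starUN v w j}) ∧
    (i = j + 1 →
      sArc (starUN v w i) (starUN v w (i + 1)) ∩ sArc (starUN v w j) (starUN v w (j + 1)) =
        {starUN v w i}) ∧
    (j ≠ i + 1 → i ≠ j + 1 →
      sArc (starUN v w i) (starUN v w (i + 1)) ∩ sArc (starUN v w j) (starUN v w (j + 1)) = ∅)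

/-- The discrete Gaussian curvature (angle defect)
`K(v) = 2π − Σᵢ ∠(wᵢ − v, wᵢ₊₁ − v)`. -/
noncomputable def curv {n : ℕ} [NeZero n] (v : E3) (w : ZMod n → E3) : ℝ :=
  2 * Real.pi - ∑ i : ZMod n, InnerProductGeometry.angle (w i - v) (w (i + 1) - v)

/-- The face `Tᵢ` is an inflection face: its two neighboring faces lie strictly on
opposite sides of its plane. -/
def IsInflectionFace {n : ℕ} (v : E3) (w : ZMod n → E3) (i : ZMod n) : Prop :=
  ⟪w (i - 1) - v, starFN v w i⟫ * ⟪w (i + 2) - v, starFN v w i⟫ < 0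

/-- The carrier `Star = ⋃ᵢ Tᵢ` of the vertex star. -/
def starCarrier {n : ℕ} (v : E3) (w : ZMod n → E3) : Set E3 :=
  ⋃ i : ZMod n, starFace v w i


lemma slit_of_seg (a b : ℂ) (h : ∀ t : ℝ, 0 ≤ t → t ≤ 1 → (1 - t : ℂ) * a + t * b ≠ 0) :
    b / a ∈ Complex.slitPlane := by
  have ha : a ≠ 0 := by
    intro ha; apply h 0 le_rfl zero_le_one; simp [ha]
  by_contra hn
  rw [Complex.mem_slitPlane_iff_not_le_zero, not_not, Complex.le_def] at hn
  obtain ⟨h1, h2⟩ := hn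
  simp only [Complex.zero_re, Complex.zero_im] at h1 h2
  set r : ℝ := -(b / a).re with hr
  have hr0 : 0 ≤ r := by linarith
  have hba : b / a = ((-r : ℝ) : ℂ) := by
    apply Complex.ext
    · simp [hr]
    · simp [h2]
  have hb : b = ((-r : ℝ) : ℂ) * a := by rw [← hba]; field_simp
  have h1r : (1 + r) ≠ 0 := by positivity
  have h1rc : (1 + r : ℂ) ≠ 0 := by exact_mod_cast h1r
  apply h (1 / (1 + r)) (by positivity) (by rw [div_le_one (by positivity)]; linarith)
  rw [hb]; push_cast
  field_simp
  ring

lemma slit_of_cross (a b : ℂ) (h : (b * (starRingEnd ℂ) a).im ≠ 0) :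
    b / a ∈ Complex.slitPlane := by
  apply slit_of_seg
  intro t h0 h1 he
  apply h
  have e1 := congrArg Complex.re he
  have e2 := congrArg Complex.im he
  simp at e1 e2 ⊢
  by_cases ht : t = 0
  · subst ht; simp at e1 e2; rw [e1, e2]; ring
  · apply mul_left_cancel₀ ht
    linear_combination a.re * e2 - a.im * e1

/-- sum around a cycle of the arguments of successive quotients -/
noncomputable def wind {n : ℕ} [NeZero n] (y : ZMod n → ℂ) : ℝ :=
  ∑ i : ZMod n, Complex.arg (y (i + 1) / y i)

lemma wind_coe {n : ℕ} [NeZero n] (y : ZMod n → ℂ) (hy : ∀ i, y i ≠ 0) :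
    ((wind y : ℝ) : Real.Angle) = 0 := by
  have : ((wind y : ℝ) : Real.Angle) = ∑ i : ZMod n, ((Complex.arg (y (i + 1) / y i) : ℝ) : Real.Angle) := by
    unfold wind
    exact map_sum Real.Angle.coeHom _ _
  rw [this, Finset.sum_congr rfl (fun i _ => Complex.arg_div_coe_angle (hy (i+1)) (hy i)),
    Finset.sum_sub_distrib, sub_eq_zero]
  exact Equiv.sum_comp (Equiv.addRight (1 : ZMod n)) (fun i => ((Complex.arg (y i) : ℝ) : Real.Angle))

lemma const_of_angle_zero (f : ℝ → ℝ) (hf : ContinuousOn f (Set.Icc 0 1))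
    (h : ∀ s ∈ Set.Icc (0:ℝ) 1, ((f s : ℝ) : Real.Angle) = 0) : f 0 = f 1 := by
  have hp : IsPreconnected (Set.Icc (0:ℝ) 1) := isPreconnected_Icc
  have key : ∀ s ∈ Set.Icc (0:ℝ) 1, ∃ m : ℤ, f s = m * (2 * Real.pi) := by
    intro s hs
    obtain ⟨m, hm⟩ := (Real.Angle.coe_eq_zero_iff).1 (h s hs)
    exact ⟨m, by rw [← hm]; simp⟩
  -- IVT
  by_contra hne
  have himg := hp.image f hf
  obtain ⟨m0, hm0⟩ := key 0 (by simp)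
  obtain ⟨m1, hm1⟩ := key 1 (by simp)
  have hpi := Real.pi_pos
  have hord := himg.ordConnected
  have mem0 : f 0 ∈ f '' Set.Icc 0 1 := ⟨0, by simp, rfl⟩
  have mem1 : f 1 ∈ f '' Set.Icc 0 1 := ⟨1, by simp, rfl⟩
  have gen : ∀ a b : ℤ, a < b → (a * (2 * Real.pi) : ℝ) ∈ f '' Set.Icc 0 1 →
      (b * (2 * Real.pi) : ℝ) ∈ f '' Set.Icc 0 1 → False := by
    intro a b hab ha hb
    have hab' : (a + 1 : ℝ) ≤ b := by exact_mod_cast hab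
    have : (a * (2 * Real.pi) + Real.pi : ℝ) ∈ f '' Set.Icc 0 1 := by
      apply hord.out ha hb
      constructor <;> nlinarith
    obtain ⟨s, hs, hfs⟩ := this
    obtain ⟨m, hm⟩ := key s hs
    have : (2 * m : ℝ) = 2 * a + 1 := by
      have : Real.pi * (2 * m) = Real.pi * (2 * a + 1) := by linarith
      exact mul_left_cancel₀ hpi.ne' this
    have : (2 * m : ℤ) = 2 * a + 1 := by exact_mod_cast this
    omega
  rcases lt_trichotomy m0 m1 with hl | hl | hl
  · exact gen _ _ hl (hm0 ▸ mem0) (hm1 ▸ mem1)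
  · apply hne; rw [hm0, hm1, hl]
  · exact gen _ _ hl (hm1 ▸ mem1) (hm0 ▸ mem0)

/-- planar embedded polygon -/
structure PlanarPoly {n : ℕ} (z : ZMod n → ℂ) : Prop where
  hn : 3 ≤ n
  turn : ∀ j, ((z (j + 1) - z j) * (starRingEnd ℂ) (z (j - 1) - z j)).im ≠ 0
  edge : ∀ i j, i ≠ j → i + 1 ≠ j → i ≠ j + 1 → ∀ s t : ℝ, 0 ≤ s → s ≤ 1 → 0 ≤ t → t ≤ 1 →
    (1 - s : ℂ) * z j + s * z (j + 1) ≠ (1 - t : ℂ) * z i + t * z (i + 1)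
  vert : ∀ i j, i ≠ j → i + 1 ≠ j → ∀ t : ℝ, 0 ≤ t → t ≤ 1 →
    z j ≠ (1 - t : ℂ) * z i + t * z (i + 1)

noncomputable def yfun {n : ℕ} (z : ZMod n → ℂ) (j : ZMod n) (s : ℝ) (i : ZMod n) : ℂ :=
  if i = j then z j - z (j + 1) else if i = j + 1 then z (j + 1) - z j
    else z i - ((1 - s : ℂ) * z j + s * z (j + 1))

lemma PlanarPoly.one_ne {n : ℕ} {z : ZMod n → ℂ} (h : PlanarPoly z) :
    (1 : ZMod n) ≠ 0 ∧ (2 : ZMod n) ≠ 0 := by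
  have := h.hn
  constructor
  · intro h1
    have : ((1 : ℕ) : ZMod n) = 0 := by simpa using h1
    rw [ZMod.natCast_eq_zero_iff] at this
    have := Nat.le_of_dvd (by norm_num) this; omega
  · intro h1
    have : ((2 : ℕ) : ZMod n) = 0 := by exact_mod_cast h1
    rw [ZMod.natCast_eq_zero_iff] at this
    have := Nat.le_of_dvd (by norm_num) this; omega

lemma yfun_slit {n : ℕ} {z : ZMod n → ℂ} (h : PlanarPoly z) (j : ZMod n) (s : ℝ)
    (h0 : 0 ≤ s) (h1 : s ≤ 1) (i : ZMod n) (hi : i ≠ j) :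
    yfun z j s (i + 1) / yfun z j s i ∈ Complex.slitPlane := by
  obtain ⟨h1n, h2n⟩ := h.one_ne
  have hj1 : j + 1 ≠ j := by intro h'; apply h1n; linear_combination h'
  by_cases hA : i + 1 = j
  · have e1 : yfun z j s (i + 1) = z j - z (j + 1) := by simp [yfun, hA]
    have hij : i ≠ j + 1 := by intro h'; apply h2n; linear_combination hA - h'
    have e2 : yfun z j s i = z i - ((1 - s : ℂ) * z j + s * z (j + 1)) := by
      simp [yfun, hi, hij]
    rw [e1, e2]
    apply slit_of_cross
    have ht := h.turn j
    have : j - 1 = i := by linear_combination -hA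
    rw [this] at ht
    intro hc; apply ht
    simp at hc ⊢
    linear_combination -hc
  by_cases hB : i = j + 1
  · have e2 : yfun z j s i = z (j + 1) - z j := by simp [yfun, hB, hj1]
    have hij : i + 1 ≠ j := hA
    have hij' : i + 1 ≠ j + 1 := by simpa using hi
    have e1 : yfun z j s (i + 1) = z (i + 1) - ((1 - s : ℂ) * z j + s * z (j + 1)) := by
      simp only [yfun, if_neg hij, if_neg hij']
    rw [e1, e2]
    apply slit_of_cross
    have ht := h.turn (j + 1)
    rw [show j + 1 - 1 = j by ring, ← hB] at ht
    rw [← hB]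
    intro hc; apply ht
    simp at hc ⊢
    linear_combination -hc
  · have hij' : i + 1 ≠ j + 1 := by simpa using hi
    have e1 : yfun z j s (i + 1) = z (i + 1) - ((1 - s : ℂ) * z j + s * z (j + 1)) := by
      simp only [yfun, if_neg hA, if_neg hij']
    have e2 : yfun z j s i = z i - ((1 - s : ℂ) * z j + s * z (j + 1)) := by
      simp only [yfun, if_neg hi, if_neg hB]
    rw [e1, e2]
    apply slit_of_seg
    intro t ht0 ht1 he
    apply h.edge i j hi hA hB s t h0 h1 ht0 ht1
    linear_combination -he

lemma PlanarPoly.ne_succ {n : ℕ} {z : ZMod n → ℂ} (h : PlanarPoly z) (j) : z (j+1) - z j ≠ 0 := by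
  intro hc
  apply h.turn j; simp [hc]

lemma yfun_ne {n : ℕ} {z : ZMod n → ℂ} (h : PlanarPoly z) (j : ZMod n) (s : ℝ)
    (h0 : 0 ≤ s) (h1 : s ≤ 1) (i : ZMod n) : yfun z j s i ≠ 0 := by
  by_cases hi : i = j
  · simp only [yfun, if_pos hi]
    rw [← neg_sub]; exact neg_ne_zero.2 (h.ne_succ j)
  · intro h'
    have := yfun_slit h j s h0 h1 i hi
    rw [h'] at this; simp at this

lemma wind_edge {n : ℕ} [NeZero n] {z : ZMod n → ℂ} (h : PlanarPoly z) (j : ZMod n) :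
    wind (yfun z j 0) = wind (yfun z j 1) := by
  apply const_of_angle_zero (fun s => wind (yfun z j s))
  · unfold wind
    apply continuousOn_finsetSum
    intro i _
    by_cases hi : i = j
    · have : ∀ s, yfun z j s (i + 1) / yfun z j s i =  yfun z j 0 (i + 1) / yfun z j 0 i := by
        intro s
        subst hi
        simp [yfun]
      simp only [this]
      exact continuousOn_const
    · have hc : ∀ k, Continuous (fun s : ℝ => yfun z j s k) := by
        intro k
        unfold yfun
        split_ifs <;> fun_prop
      intro s hs
      apply ContinuousAt.continuousWithinAt
      have : ContinuousAt (fun s : ℝ => yfun z j s (i+1) / yfun z j s i) s :=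
        (hc _).continuousAt.div (hc _).continuousAt (yfun_ne h j s hs.1 hs.2 i)
      exact ContinuousAt.comp (f := fun s : ℝ => yfun z j s (i+1) / yfun z j s i)
        (Complex.continuousAt_arg (yfun_slit h j s hs.1 hs.2 i hi)) this
  · intro s hs
    exact wind_coe _ (yfun_ne h j s hs.1 hs.2)

lemma wind_vert {n : ℕ} [NeZero n] {z : ZMod n → ℂ} (h : PlanarPoly z) (j : ZMod n) :
    wind (yfun z j 1) = wind (yfun z (j + 1) 0) := by
  obtain ⟨h1n, h2n⟩ := h.one_ne
  have hj1 : j + 1 ≠ j := by intro h'; apply h1n; linear_combination h'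
  have hj2 : j + 1 + 1 ≠ j := by intro h'; apply h2n; linear_combination h'
  have hj3 : j + 1 + 1 ≠ j + 1 := by simpa using h1n
  have hjj : j ≠ j + 1 := hj1.symm
  have eq : ∀ i, i ≠ j + 1 → yfun z j 1 i = z i - z (j + 1) ∧
      yfun z (j + 1) 0 i = z i - z (j + 1) := by
    intro i hi
    constructor
    · unfold yfun
      by_cases h' : i = j
      · simp [h']
      · simp [h', hi]
    · unfold yfun
      by_cases h' : i = j + 1 + 1
      · simp [h', h1n]
      · simp [h', hi]
  have v1 : yfun z j 1 (j + 1) = z (j + 1) - z j := by simp [yfun, h1n]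
  have v2 : yfun z (j + 1) 0 (j + 1) = z (j + 1) - z (j + 1 + 1) := by simp [yfun]
  unfold wind
  rw [← Finset.sum_erase_add _ _ (Finset.mem_univ j),
    ← Finset.sum_erase_add _ _ (Finset.mem_univ j),
    ← Finset.sum_erase_add (Finset.univ.erase j) _ (Finset.mem_erase.2 ⟨hj1, Finset.mem_univ (j+1)⟩),
    ← Finset.sum_erase_add (Finset.univ.erase j) _ (Finset.mem_erase.2 ⟨hj1, Finset.mem_univ (j+1)⟩)]
  rw [v1, v2, (eq _ hj3).1, (eq _ hj3).2, (eq _ hjj).1, (eq _ hjj).2]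
  have hs : ∑ x ∈ (Finset.univ.erase j).erase (j + 1), Complex.arg (yfun z j 1 (x + 1) / yfun z j 1 x)
    = ∑ x ∈ (Finset.univ.erase j).erase (j + 1),
      Complex.arg (yfun z (j + 1) 0 (x + 1) / yfun z (j + 1) 0 x) := by
    apply Finset.sum_congr rfl
    intro i hi
    simp only [Finset.mem_erase, Finset.mem_univ, and_true] at hi
    rw [(eq i hi.1).1, (eq i hi.1).2, (eq (i + 1) (by simpa using hi.2)).1,
      (eq (i + 1) (by simpa using hi.2)).2]
  rw [hs]
  have d1 := h.ne_succ j
  have d2 := h.ne_succ (j + 1)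
  have r1 : (z (j + 1) - z j) / (z j - z (j + 1)) = -1 := by
    rw [← neg_sub (z (j+1)) (z j), div_neg, div_self d1]
  have r2 : (z (j + 1 + 1) - z (j + 1)) / (z (j + 1) - z (j + 1 + 1)) = -1 := by
    rw [← neg_sub (z (j+1+1)) (z (j+1)), div_neg, div_self d2]
  have r3 : (z (j + 1) - z (j + 1 + 1)) / (z j - z (j + 1)) =
      (z (j + 1 + 1) - z (j + 1)) / (z (j + 1) - z j) := by
    rw [← neg_sub (z (j+1+1)) (z (j+1)), ← neg_sub (z (j+1)) (z j), neg_div_neg_eq]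
  rw [r1, r2, r3]; ring

lemma wind_const {n : ℕ} [NeZero n] {z : ZMod n → ℂ} (h : PlanarPoly z) (j k : ZMod n) :
    wind (yfun z j 0) = wind (yfun z k 0) := by
  have : ∀ m : ℕ, wind (yfun z (j + m) 0) = wind (yfun z j 0) := by
    intro m
    induction m with
    | zero => simp
    | succ m ih =>
      rw [← ih, wind_edge h (j + m), wind_vert h (j + m)]
      congr 2; push_cast; ring
  have h2 := this (k - j).val
  rw [ZMod.natCast_zmod_val] at h2
  rw [← h2]; congr 2; ring

/-- value of `wind` at an exposed vertex -/
lemma wind_exposed {n : ℕ} [NeZero n] {z : ZMod n → ℂ} (h : PlanarPoly z) (j : ZMod n)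
    (ω : ℂ) (hω : ω ≠ 0) (hex : ∀ i, 0 ≤ (ω * (z i - z j)).im) :
    wind (yfun z j 0) = Real.pi + Complex.arg ((z j - z (j + 1)) / (z (j - 1) - z j))
      - Complex.arg (ω * (z (j + 1) - z j)) + Complex.arg (ω * (z (j - 1) - z j)) := by
  obtain ⟨h1n, h2n⟩ := h.one_ne
  have hj1 : j + 1 ≠ j := by intro h'; apply h1n; linear_combination h'
  have hj0 : j - 1 ≠ j := by intro h'; apply h1n; linear_combination -h'
  have hjm : j - 1 + 1 = j := by ring
  have y1 : ∀ i, i ≠ j → yfun z j 0 i = z i - z j := by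
    intro i hi
    unfold yfun
    by_cases h' : i = j + 1
    · simp [h', h1n]
    · simp [h', hi]
  have y0 : yfun z j 0 j = z j - z (j + 1) := by simp [yfun]
  have tel : ∑ i : ZMod n, (Complex.arg (ω * (z (i + 1) - z j)) - Complex.arg (ω * (z i - z j))) = 0 := by
    rw [Finset.sum_sub_distrib, sub_eq_zero]
    exact Equiv.sum_comp (Equiv.addRight (1 : ZMod n)) (fun i => Complex.arg (ω * (z i - z j)))
  unfold wind
  rw [← Finset.sum_erase_add _ _ (Finset.mem_univ j),
    ← Finset.sum_erase_add (Finset.univ.erase j) _ (Finset.mem_erase.2 ⟨hj0, Finset.mem_univ (j-1)⟩)]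
    at tel ⊢
  have hs : ∑ x ∈ (Finset.univ.erase j).erase (j - 1), Complex.arg (yfun z j 0 (x + 1) / yfun z j 0 x)
    = ∑ x ∈ (Finset.univ.erase j).erase (j - 1),
      (Complex.arg (ω * (z (x + 1) - z j)) - Complex.arg (ω * (z x - z j))) := by
    apply Finset.sum_congr rfl
    intro i hi
    simp only [Finset.mem_erase, Finset.mem_univ, and_true] at hi
    have hi1 : i + 1 ≠ j := by intro h'; apply hi.1; linear_combination h'
    rw [y1 i hi.2, y1 _ hi1]
    have hsl : (z (i + 1) - z j) / (z i - z j) ∈ Complex.slitPlane := by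
      apply slit_of_seg
      intro t ht0 ht1 he
      apply h.vert i j hi.2 hi1 t ht0 ht1
      linear_combination -he
    have hne : z i - z j ≠ 0 := by
      intro h'; rw [h'] at hsl; simp at hsl
    have hne1 : z (i + 1) - z j ≠ 0 := by
      intro h'; rw [h'] at hsl; simp at hsl
    set a := z i - z j
    set b := z (i + 1) - z j
    have hang : ((Complex.arg (b / a) : ℝ) : Real.Angle) =
        ((Complex.arg (ω * b) - Complex.arg (ω * a) : ℝ) : Real.Angle) := by
      rw [show b / a = (ω * b) / (ω * a) by field_simp, Complex.arg_div_coe_angle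
        (mul_ne_zero hω hne1) (mul_ne_zero hω hne)]
      simp
    have b1 := Complex.arg_nonneg_iff.2 (hex i)
    have b2 := Complex.arg_le_pi (ω * a)
    have b3 := Complex.arg_nonneg_iff.2 (hex (i + 1))
    have b4 := Complex.arg_le_pi (ω * b)
    have b5 := Complex.neg_pi_lt_arg (b / a)
    have b6 := Complex.arg_le_pi (b / a)
    have b7 := Complex.slitPlane_arg_ne_pi hsl
    have b8 : Complex.arg (b / a) < Real.pi := lt_of_le_of_ne b6 b7
    rw [Real.Angle.angle_eq_iff_two_pi_dvd_sub] at hang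
    obtain ⟨k, hk⟩ := hang
    have hpi := Real.pi_pos
    have : k = 0 := by
      have k1 : (k : ℝ) < 1 := by
        by_contra hc; push Not at hc; nlinarith
      have k2 : (-1 : ℝ) < k := by
        by_contra hc; push Not at hc; nlinarith
      have k1' : k < 1 := by exact_mod_cast k1
      have k2' : -1 < k := by exact_mod_cast k2
      omega
    subst this
    simp at hk
    linarith
  rw [hs, hjm, y0, y1 _ hj1, y1 _ hj0]
  rw [hjm] at tel
  have d1 := h.ne_succ j
  have r1 : (z (j + 1) - z j) / (z j - z (j + 1)) = -1 := by
    rw [← neg_sub (z (j+1)) (z j), div_neg, div_self d1]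
  rw [r1, Complex.arg_neg_one]
  linarith

lemma wind_sign {n : ℕ} [NeZero n] {z : ZMod n → ℂ} (h : PlanarPoly z) (j : ZMod n)
    (ω : ℂ) (hω : ω ≠ 0) (hex : ∀ i, 0 ≤ (ω * (z i - z j)).im) :
    (((z (j + 1) - z j) * (starRingEnd ℂ) (z (j - 1) - z j)).im < 0 → wind (yfun z j 0) = 2 * Real.pi) ∧
    (0 < ((z (j + 1) - z j) * (starRingEnd ℂ) (z (j - 1) - z j)).im → wind (yfun z j 0) = 0) := by
  rw [wind_exposed h j ω hω hex]
  have d1 := h.ne_succ j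
  have d2 : z (j - 1) - z j ≠ 0 := by
    have := h.ne_succ (j - 1)
    rw [show j - 1 + 1 = j by ring] at this
    rw [← neg_sub]; exact neg_ne_zero.2 this
  rw [← neg_sub (z (j+1)) (z j)]
  have hB := hex (j + 1)
  have hA := hex (j - 1)
  set B := z (j + 1) - z j
  set A := z (j - 1) - z j
  rw [neg_div]
  have b1 := Complex.arg_nonneg_iff.2 hA
  have b2 := Complex.arg_le_pi (ω * A)
  have b3 := Complex.arg_nonneg_iff.2 hB
  have b4 := Complex.arg_le_pi (ω * B)
  have b5 := Complex.neg_pi_lt_arg (B / A)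
  have b6 := Complex.arg_le_pi (B / A)
  have hpi := Real.pi_pos
  have him : (B / A).im * Complex.normSq A = (B * (starRingEnd ℂ) A).im := by
    have : Complex.normSq A ≠ 0 := by simpa using d2
    rw [Complex.div_im]; simp; field_simp
    ring
  have hA0 : 0 < Complex.normSq A := Complex.normSq_pos.2 d2
  have hang : ((Complex.arg (B / A) : ℝ) : Real.Angle) =
        ((Complex.arg (ω * B) - Complex.arg (ω * A) : ℝ) : Real.Angle) := by
      rw [show B / A = (ω * B) / (ω * A) by field_simp, Complex.arg_div_coe_angle
        (mul_ne_zero hω d1) (mul_ne_zero hω d2)]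
      simp
  have key : Complex.arg (B / A) ≠ Real.pi →
      Complex.arg (B / A) = Complex.arg (ω * B) - Complex.arg (ω * A) := by
    intro b7
    have b8 : Complex.arg (B / A) < Real.pi := lt_of_le_of_ne b6 b7
    rw [Real.Angle.angle_eq_iff_two_pi_dvd_sub] at hang
    obtain ⟨k, hk⟩ := hang
    have : k = 0 := by
      have k1 : (k : ℝ) < 1 := by
        by_contra hc; push Not at hc; nlinarith
      have k2 : (-1 : ℝ) < k := by
        by_contra hc; push Not at hc; nlinarith
      have k1' : k < 1 := by exact_mod_cast k1
      have k2' : -1 < k := by exact_mod_cast k2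
      omega
    subst this
    simp at hk
    linarith
  constructor
  · intro hneg
    have hi : (B / A).im < 0 := by
      by_contra hc; push Not at hc
      have := mul_nonneg hc hA0.le
      linarith
    have := key (by intro hc; rw [Complex.arg_eq_pi_iff] at hc; linarith [hc.2])
    rw [Complex.arg_neg_eq_arg_add_pi_of_im_neg hi]
    linarith
  · intro hpos
    have hi : 0 < (B / A).im := by
      by_contra hc; push Not at hc
      have := mul_nonneg (neg_nonneg.2 hc) hA0.le
      linarith
    have := key (by intro hc; rw [Complex.arg_eq_pi_iff] at hc; linarith [hc.2])
    rw [Complex.arg_neg_eq_arg_sub_pi_of_im_pos hi]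
    linarith

/-- two exposed vertices of an embedded polygon turn in the same direction -/
lemma exposed_same_sign {n : ℕ} [NeZero n] {z : ZMod n → ℂ} (h : PlanarPoly z) (j k : ZMod n)
    (ω ω' : ℂ) (hω : ω ≠ 0) (hex : ∀ i, 0 ≤ (ω * (z i - z j)).im)
    (hω' : ω' ≠ 0) (hex' : ∀ i, 0 ≤ (ω' * (z i - z k)).im) :
    0 < ((z (j + 1) - z j) * (starRingEnd ℂ) (z (j - 1) - z j)).im *
      ((z (k + 1) - z k) * (starRingEnd ℂ) (z (k - 1) - z k)).im := by
  have h1 := wind_sign h j ω hω hex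
  have h2 := wind_sign h k ω' hω' hex'
  rw [wind_const h j k] at h1
  have hpi := Real.pi_pos
  rcases lt_or_gt_of_ne (h.turn j) with a | a <;> rcases lt_or_gt_of_ne (h.turn k) with b | b
  · exact mul_pos_of_neg_of_neg a b
  · have := h1.1 a; have := h2.2 b; linarith
  · have := h1.2 a; have := h2.1 b; linarith
  · exact mul_pos a b

section hemi
open InnerProductGeometry

variable {V : Type*} [NormedAddCommGroup V] [InnerProductSpace ℝ V]

lemma inner_pos_of_angle_lt {p q x : V} (hp : p ≠ 0) (hq : q ≠ 0) (hx : x ≠ 0)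
    (h : angle p x + angle q x < Real.pi) :
    0 < ⟪‖p‖⁻¹ • p + ‖q‖⁻¹ • q, x⟫ := by
  have hp' := norm_pos_iff.2 hp
  have hq' := norm_pos_iff.2 hq
  have hx' := norm_pos_iff.2 hx
  have h1 : Real.cos (Real.pi - angle q x) < Real.cos (angle p x) := by
    apply Real.strictAntiOn_cos
    · exact ⟨angle_nonneg _ _, angle_le_pi _ _⟩
    · exact ⟨by linarith [angle_le_pi q x], by linarith [angle_nonneg q x]⟩
    · linarith
  rw [Real.cos_pi_sub] at h1
  rw [inner_add_left, real_inner_smul_left, real_inner_smul_left,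
    ← cos_angle_mul_norm_mul_norm, ← cos_angle_mul_norm_mul_norm]
  have : ‖p‖⁻¹ * (Real.cos (angle p x) * (‖p‖ * ‖x‖)) + ‖q‖⁻¹ * (Real.cos (angle q x) * (‖q‖ * ‖x‖))
    = ‖x‖ * (Real.cos (angle p x) + Real.cos (angle q x)) := by field_simp
  rw [this]
  apply mul_pos hx'; linarith

lemma angle_le_sum (f : ℕ → V) (hf : ∀ k, f k ≠ 0) (a b : ℕ) (hab : a ≤ b) :
    angle (f a) (f b) ≤ ∑ k ∈ Finset.range b, angle (f k) (f (k + 1)) -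
      ∑ k ∈ Finset.range a, angle (f k) (f (k + 1)) := by
  induction b, hab using Nat.le_induction with
  | base => simp [angle_self (hf a)]
  | succ b hb ih =>
    rw [Finset.sum_range_succ]
    have := angle_le_angle_add_angle (f a) (f b) (f (b + 1))
    linarith

lemma exists_on_edge {x y : V} (h : LinearIndependent ℝ ![x, y]) (θ : ℝ) (h0 : 0 ≤ θ)
    (h1 : θ ≤ angle x y) : ∃ q : V, q ≠ 0 ∧ angle x q = θ ∧ angle q y = angle x y - θ := by
  have hne : ∀ t : ℝ, (1 - t) • x + t • y ≠ 0 := by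
    intro t ht
    rw [LinearIndependent.pair_iff] at h
    have := h _ _ ht
    linarith [this.1, this.2]
  have hx : x ≠ 0 := by simpa using hne 0
  have hc : ContinuousOn (fun t : ℝ => angle x ((1 - t) • x + t • y)) (Set.Icc 0 1) := by
    intro t _
    apply ContinuousAt.continuousWithinAt
    have h2 : ContinuousAt (fun t : ℝ => (x, (1 - t) • x + t • y)) t := by fun_prop
    exact ContinuousAt.comp (f := fun t : ℝ => (x, (1 - t) • x + t • y))
      (g := fun y : V × V => angle y.1 y.2) (continuousAt_angle hx (hne t)) h2
  have := intermediate_value_Icc (zero_le_one' ℝ) hc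
  have hm : θ ∈ Set.Icc (angle x ((1 - (0:ℝ)) • x + (0:ℝ) • y)) (angle x ((1 - (1:ℝ)) • x + (1:ℝ) • y)) := by
    simp [angle_self hx, h0, h1]
  obtain ⟨t, ht, hθ⟩ := this hm
  refine ⟨_, hne t, hθ, ?_⟩
  have hs := angle_eq_angle_add_add_angle_add_of_mem_span (x := x) (z := y) (hne t) (by
    rw [Submodule.mem_span_pair]
    refine ⟨(1 - t).toNNReal, t.toNNReal, ?_⟩
    rw [NNReal.smul_def, NNReal.smul_def, Real.coe_toNNReal _ (by linarith [ht.2]),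
      Real.coe_toNNReal _ ht.1])
  have hθ' : angle x ((1 - t) • x + t • y) = θ := hθ
  linarith

lemma hemisphere_nat (f : ℕ → V) (n : ℕ) (hn : 0 < n) (hper : f n = f 0)
    (hf : ∀ k, LinearIndependent ℝ ![f k, f (k + 1)])
    (hL : ∑ k ∈ Finset.range n, angle (f k) (f (k + 1)) < 2 * Real.pi) :
    ∃ c : V, ∀ k ≤ n, 0 < ⟪c, f k⟫ := by
  have hf0 : ∀ k, f k ≠ 0 := fun k => by simpa using (hf k).ne_zero 0
  have hpi := Real.pi_pos
  set S : ℕ → ℝ := fun m => ∑ k ∈ Finset.range m, angle (f k) (f (k + 1)) with hS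
  have hS0 : S 0 = 0 := by simp [hS]
  have hSs : ∀ m, S (m + 1) = S m + angle (f m) (f (m + 1)) := fun m => by
    simp [hS, Finset.sum_range_succ]
  have hLn : S n < 2 * Real.pi := hL
  have tri : ∀ a b, a ≤ b → angle (f a) (f b) ≤ S b - S a := fun a b => angle_le_sum f hf0 a b
  obtain ⟨j, hjn, hj, hj'⟩ : ∃ j < n, S j < Real.pi ∧ (Real.pi ≤ S (j + 1) ∨ j + 1 = n) := by
    by_contra hc
    push Not at hc
    have : ∀ m, m < n → S m < Real.pi := by
      intro m
      induction m with
      | zero => intro _; rw [hS0]; exact hpi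
      | succ m ih =>
        intro hm
        exact (hc m (by omega) (ih (by omega))).1
    have h2 := (hc (n - 1) (by omega) (this _ (by omega))).2
    omega
  have hα := angle_nonneg (f j) (f (j + 1))
  have hSj := hSs j
  obtain ⟨θ, hθ0, hθ1, hθ2, hθ3⟩ : ∃ θ : ℝ, 0 ≤ θ ∧ θ ≤ angle (f j) (f (j + 1)) ∧
      S j + θ < Real.pi ∧ S n - S j - θ < Real.pi := by
    have hlo : S n - Real.pi - S j < min (angle (f j) (f (j + 1))) (Real.pi - S j) := by
      apply lt_min
      · rcases hj' with h | h
        · linarith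
        · have h2 : S (j + 1) = S n := by rw [h]
          linarith
      · linarith
    have m1 := min_le_left (angle (f j) (f (j + 1))) (Real.pi - S j)
    have m2 := min_le_right (angle (f j) (f (j + 1))) (Real.pi - S j)
    by_cases h : S n - Real.pi - S j < 0
    · exact ⟨0, le_rfl, hα, by linarith, by linarith⟩
    · push Not at h
      exact ⟨(S n - Real.pi - S j + min (angle (f j) (f (j + 1))) (Real.pi - S j)) / 2,
        by linarith, by linarith, by linarith, by linarith⟩
  obtain ⟨q, hq0, hq1, hq2⟩ := exists_on_edge (hf j) θ hθ0 hθ1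
  refine ⟨‖f 0‖⁻¹ • f 0 + ‖q‖⁻¹ • q, fun k hk => inner_pos_of_angle_lt (hf0 0) hq0 (hf0 k) ?_⟩
  by_cases hkj : k ≤ j
  · have t1 := tri 0 k (Nat.zero_le _)
    have t2 := tri k j hkj
    have t3 := angle_le_angle_add_angle (f k) (f j) q
    rw [angle_comm q]
    linarith
  · have t1 := tri (j + 1) k (by omega)
    have t2 := tri k n hk
    rw [hper, angle_comm] at t2
    have t3 := angle_le_angle_add_angle q (f (j + 1)) (f k)
    linarith

lemma hemisphere {n : ℕ} [NeZero n] (e : ZMod n → V)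
    (he : ∀ i, LinearIndependent ℝ ![e i, e (i + 1)])
    (hL : ∑ i, angle (e i) (e (i + 1)) < 2 * Real.pi) : ∃ c : V, ∀ i, 0 < ⟪c, e i⟫ := by
  obtain ⟨c, hc⟩ := hemisphere_nat (fun k : ℕ => e (k : ZMod n)) n (NeZero.pos n) (by simp)
    (fun k => by simpa using he k) (by
      refine lt_of_eq_of_lt ?_ hL
      refine Finset.sum_bij' (fun k _ => (k : ZMod n)) (fun i _ => i.val) ?_ ?_ ?_ ?_ ?_
      · simp
      · intro i _; simp [ZMod.val_lt]
      · intro k hk; exact ZMod.val_cast_of_lt (Finset.mem_range.1 hk)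
      · intro i _; simp
      · intro k _; simp)
  refine ⟨c, fun i => ?_⟩
  have := hc i.val (ZMod.val_lt i).le
  simpa using this
end hemi

lemma inner_coord (a b : E3) : ⟪a, b⟫ = a 0 * b 0 + a 1 * b 1 + a 2 * b 2 := by
  simp [PiLp.inner_apply, Fin.sum_univ_three]; ring

lemma cross3_0 (a b : E3) : cross3 a b 0 = a 1 * b 2 - a 2 * b 1 := rfl
lemma cross3_1 (a b : E3) : cross3 a b 1 = a 2 * b 0 - a 0 * b 2 := rfl
lemma cross3_2 (a b : E3) : cross3 a b 2 = a 0 * b 1 - a 1 * b 0 := rfl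

/-- triple product -/
def dt (a b c : E3) : ℝ := ⟪a, cross3 b c⟫

lemma dt_coord (a b c : E3) : dt a b c = a 0 * (b 1 * c 2 - b 2 * c 1) +
    a 1 * (b 2 * c 0 - b 0 * c 2) + a 2 * (b 0 * c 1 - b 1 * c 0) := by
  rw [dt, inner_coord, cross3_0, cross3_1, cross3_2]

lemma E3ext {a b : E3} (h0 : a 0 = b 0) (h1 : a 1 = b 1) (h2 : a 2 = b 2) : a = b := by
  ext i; fin_cases i <;> assumption

lemma dt_cyc (a b c : E3) : dt b c a = dt a b c := by
  rw [dt_coord, dt_coord]; ring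

lemma dt_swap (a b c : E3) : dt a c b = - dt a b c := by
  rw [dt_coord, dt_coord]; ring

lemma recip1 (N a b c : E3) : dt a b c • N =
    ⟪N, a⟫ • cross3 b c + ⟪N, b⟫ • cross3 c a + ⟪N, c⟫ • cross3 a b := by
  apply E3ext <;> simp only [PiLp.add_apply, PiLp.smul_apply, smul_eq_mul, inner_coord, dt_coord,
    cross3_0, cross3_1, cross3_2] <;> ring

lemma recip2 (N a b c : E3) : dt a b c • N =
    ⟪N, cross3 b c⟫ • a + ⟪N, cross3 c a⟫ • b + ⟪N, cross3 a b⟫ • c := by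
  apply E3ext <;> simp only [PiLp.add_apply, PiLp.smul_apply, smul_eq_mul, inner_coord, dt_coord,
    cross3_0, cross3_1, cross3_2] <;> ring

lemma dt_mul (a b c x y z : E3) : dt a b c * dt x y z =
    ⟪a, x⟫ * (⟪b, y⟫ * ⟪c, z⟫ - ⟪b, z⟫ * ⟪c, y⟫) - ⟪a, y⟫ * (⟪b, x⟫ * ⟪c, z⟫ - ⟪b, z⟫ * ⟪c, x⟫)
     + ⟪a, z⟫ * (⟪b, x⟫ * ⟪c, y⟫ - ⟪b, y⟫ * ⟪c, x⟫) := by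
  simp only [inner_coord, dt_coord]; ring

lemma zero_of_inner {a b c x : E3} (h : dt a b c ≠ 0) (ha : ⟪a, x⟫ = 0) (hb : ⟪b, x⟫ = 0)
    (hc : ⟪c, x⟫ = 0) : x = 0 := by
  have := recip1 x a b c
  rw [real_inner_comm, ha, real_inner_comm, hb, real_inner_comm, hc] at this
  simpa [h] using this

lemma exists_basis (c : E3) (hc : c ≠ 0) : ∃ a b : E3, dt a b c ≠ 0 := by
  by_contra hn
  push Not at hn
  apply hc
  have h0 := hn !₂[0,1,0] !₂[0,0,1]
  have h1 := hn !₂[0,0,1] !₂[1,0,0]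
  have h2 := hn !₂[1,0,0] !₂[0,1,0]
  simp [dt_coord] at h0 h1 h2
  exact E3ext (by simpa using h0) (by simpa using h1) (by simpa using h2)

structure ConeStar {n : ℕ} (e : ZMod n → E3) : Prop where
  hn : 3 ≤ n
  hemi : ∃ c : E3, ∀ i, 0 < ⟪c, e i⟫
  imm : ∀ i, dt (e (i - 1)) (e i) (e (i + 1)) ≠ 0
  emb : ∀ i j, i ≠ j → i + 1 ≠ j → i ≠ j + 1 → ∀ s t s' t' : ℝ, 0 ≤ s → 0 ≤ t → 0 ≤ s' → 0 ≤ t' →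
    s • e i + t • e (i + 1) = s' • e j + t' • e (j + 1) → s • e i + t • e (i + 1) = 0
  embv : ∀ i j, i ≠ j → i + 1 ≠ j → ∀ s t : ℝ, 0 ≤ s → 0 ≤ t → e j ≠ s • e i + t • e (i + 1)
  gauss : ∀ i j, i ≠ j → i + 1 ≠ j → i ≠ j + 1 → ∀ s t s' t' : ℝ, 0 ≤ s → 0 ≤ t → 0 ≤ s' → 0 ≤ t' →
    s • cross3 (e (i - 1)) (e i) + t • cross3 (e i) (e (i + 1)) =
      s' • cross3 (e (j - 1)) (e j) + t' • cross3 (e j) (e (j + 1)) →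
    s • cross3 (e (i - 1)) (e i) + t • cross3 (e i) (e (i + 1)) = 0

/-- central projection to the complex plane -/
def proj (a b c x : E3) : ℂ := ⟨⟪a, x⟫ / ⟪c, x⟫, ⟪b, x⟫ / ⟪c, x⟫⟩

lemma proj_turn (a b c x y z : E3) (hx : 0 < ⟪c, x⟫) (hy : 0 < ⟪c, y⟫) (hz : 0 < ⟪c, z⟫) :
    ((proj a b c z - proj a b c y) * (starRingEnd ℂ) (proj a b c x - proj a b c y)).im =
      - (dt a b c * dt x y z) / (⟪c, x⟫ * ⟪c, y⟫ * ⟪c, z⟫) := by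
  rw [dt_mul]
  simp only [proj, Complex.mul_im, Complex.sub_re, Complex.sub_im, Complex.conj_re, Complex.conj_im]
  field_simp
  ring

lemma proj_comb (a b c x y p q : E3) (h : dt a b c ≠ 0) (hx : 0 < ⟪c, x⟫) (hy : 0 < ⟪c, y⟫)
    (hp : 0 < ⟪c, p⟫) (hq : 0 < ⟪c, q⟫) (s t : ℝ)
    (he : (1 - s : ℂ) * proj a b c x + s * proj a b c y =
      (1 - t : ℂ) * proj a b c p + t * proj a b c q) :
    ((1 - s) / ⟪c, x⟫) • x + (s / ⟪c, y⟫) • y = ((1 - t) / ⟪c, p⟫) • p + (t / ⟪c, q⟫) • q := by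
  have e1 := congrArg Complex.re he
  have e2 := congrArg Complex.im he
  simp [proj] at e1 e2
  rw [← sub_eq_zero]
  apply zero_of_inner h
  · simp only [inner_sub_right, inner_add_right, real_inner_smul_right]
    linear_combination e1
  · simp only [inner_sub_right, inner_add_right, real_inner_smul_right]
    linear_combination e2
  · simp only [inner_sub_right, inner_add_right, real_inner_smul_right]
    field_simp
    ring

lemma ConeStar.planar {n : ℕ} {e : ZMod n → E3} (h : ConeStar e) (a b c : E3)
    (hc : ∀ i, 0 < ⟪c, e i⟫) (hK : dt a b c ≠ 0) : PlanarPoly (fun i => proj a b c (e i)) where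
  hn := h.hn
  turn j := by
    rw [proj_turn _ _ _ _ _ _ (hc _) (hc _) (hc _)]
    have := h.imm j
    have h1 := hc (j - 1)
    have h2 := hc j
    have h3 := hc (j + 1)
    apply div_ne_zero
    · exact neg_ne_zero.2 (mul_ne_zero hK this)
    · positivity
  edge i j h1 h2 h3 s t hs0 hs1 ht0 ht1 he := by
    have := proj_comb a b c _ _ _ _ hK (hc _) (hc _) (hc _) (hc _) s t he
    have h4 := h.emb i j h1 h2 h3 _ _ _ _ (div_nonneg (by linarith) (hc _).le)
      (div_nonneg ht0 (hc _).le) (div_nonneg (by linarith) (hc _).le)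
      (div_nonneg hs0 (hc _).le) this.symm
    have h5 := congrArg (fun x => ⟪c, x⟫) h4
    simp only [inner_add_right, real_inner_smul_right, inner_zero_right] at h5
    have a1 := hc i
    have a2 := hc (i + 1)
    field_simp at h5
    linarith
  vert i j h1 h2 t ht0 ht1 he := by
    have := proj_comb a b c (e j) (e j) (e i) (e (i + 1)) hK (hc _) (hc _) (hc _) (hc _) 0 t
      (by simpa using he)
    have hcj := hc j
    apply h.embv i j h1 h2 (⟪c, e j⟫ * ((1 - t) / ⟪c, e i⟫)) (⟪c, e j⟫ * (t / ⟪c, e (i+1)⟫))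
      (mul_nonneg hcj.le (div_nonneg (by linarith) (hc _).le))
      (mul_nonneg hcj.le (div_nonneg ht0 (hc _).le))
    rw [mul_smul, mul_smul, ← smul_add, ← this]
    simp [smul_smul, hcj.ne']

lemma ConeStar.exposed_planar {n : ℕ} {e : ZMod n → E3} (a b c : E3)
    (hc : ∀ i, 0 < ⟪c, e i⟫) (hK : dt a b c ≠ 0) (N : E3) (hN : N ≠ 0) (k : ZMod n)
    (hk : ⟪N, e k⟫ = 0) (hex : ∀ i, 0 ≤ ⟪N, e i⟫) :
    ∃ ω : ℂ, ω ≠ 0 ∧ ∀ i, 0 ≤ (ω * (proj a b c (e i) - proj a b c (e k))).im := by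
  obtain ⟨p, q, r, hpqr⟩ : ∃ p q r : ℝ, N = p • a + q • b + r • c := by
    have := recip2 N a b c
    refine ⟨(dt a b c)⁻¹ * ⟪N, cross3 b c⟫, (dt a b c)⁻¹ * ⟪N, cross3 c a⟫,
      (dt a b c)⁻¹ * ⟪N, cross3 a b⟫, ?_⟩
    rw [mul_smul, mul_smul, mul_smul, ← smul_add, ← smul_add, ← this, smul_smul,
      inv_mul_cancel₀ hK, one_smul]
  have hi : ∀ i, ⟪N, e i⟫ = p * ⟪a, e i⟫ + q * ⟪b, e i⟫ + r * ⟪c, e i⟫ := by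
    intro i
    rw [hpqr]; simp only [inner_add_left, real_inner_smul_left]
  refine ⟨⟨q, p⟩, ?_, fun i => ?_⟩
  · intro h0
    have hq : q = 0 := congrArg Complex.re h0
    have hp : p = 0 := congrArg Complex.im h0
    have := hi k
    rw [hk, hq, hp] at this
    have hr : r = 0 := by
      have h2 := hc k
      have : r * ⟪c, e k⟫ = 0 := by linarith
      rcases mul_eq_zero.1 this with h | h
      · exact h
      · linarith
    apply hN; rw [hpqr, hq, hp, hr]; simp
  · have h1 := hi k
    have h2 := hi i
    have h3 := hex i
    have c1 := hc k
    have c2 := hc i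
    rw [hk] at h1
    rw [h2] at h3
    have : (((⟨q, p⟩ : ℂ)) * (proj a b c (e i) - proj a b c (e k))).im =
        (p * ⟪a, e i⟫ + q * ⟪b, e i⟫ + r * ⟪c, e i⟫) / ⟪c, e i⟫ -
        (p * ⟪a, e k⟫ + q * ⟪b, e k⟫ + r * ⟪c, e k⟫) / ⟪c, e k⟫ := by
      simp only [proj, Complex.mul_im, Complex.sub_re, Complex.sub_im]
      field_simp
      ring
    rw [this, ← h1, zero_div, sub_zero]
    positivity

lemma ConeStar.same_sign {n : ℕ} [NeZero n] {e : ZMod n → E3} (h : ConeStar e)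
    (N N' : E3) (hN : N ≠ 0) (hN' : N' ≠ 0) (k l : ZMod n)
    (hk : ⟪N, e k⟫ = 0) (hex : ∀ i, 0 ≤ ⟪N, e i⟫)
    (hl : ⟪N', e l⟫ = 0) (hex' : ∀ i, 0 ≤ ⟪N', e i⟫) :
    0 < dt (e (k - 1)) (e k) (e (k + 1)) * dt (e (l - 1)) (e l) (e (l + 1)) := by
  obtain ⟨c, hc⟩ := h.hemi
  have hc0 : c ≠ 0 := by
    intro h0; have := hc 0; rw [h0] at this; simp at this
  obtain ⟨a, b, hK⟩ := exists_basis c hc0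
  obtain ⟨ω, hω, hw⟩ := exposed_planar a b c hc hK N hN k hk hex
  obtain ⟨ω', hω', hw'⟩ := exposed_planar a b c hc hK N' hN' l hl hex'
  have := exposed_same_sign (h.planar a b c hc hK) k l ω ω' hω hw hω' hw'
  rw [proj_turn _ _ _ _ _ _ (hc _) (hc _) (hc _), proj_turn _ _ _ _ _ _ (hc _) (hc _) (hc _)] at this
  have h1 := hc (k - 1)
  have h2 := hc k
  have h3 := hc (k + 1)
  have h4 := hc (l - 1)
  have h5 := hc l
  have h6 := hc (l + 1)
  rw [div_mul_div_comm, div_pos_iff_of_pos_right (by positivity)] at this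
  have hKK : 0 < dt a b c * dt a b c := mul_self_pos.2 hK
  refine pos_of_mul_pos_right (a := dt a b c * dt a b c) ?_ hKK.le
  linarith

lemma combo_at {x y z N : E3} (hN : ⟪N, y⟫ = 0) :
    dt x y z • N = ⟪N, z⟫ • cross3 x y + ⟪N, x⟫ • cross3 y z := by
  rw [recip1, hN]; simp; abel

lemma ConeStar.pair {n : ℕ} [NeZero n] {e : ZMod n → E3} (h : ConeStar e)
    (N : E3) (hN : N ≠ 0) (hex : ∀ i, 0 ≤ ⟪N, e i⟫) (b d : ZMod n)
    (hb : ⟪N, e b⟫ = 0) (hd : ⟪N, e d⟫ = 0) (hbd : b ≠ d) : b + 1 = d ∨ b = d + 1 := by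
  by_contra hc
  push Not at hc
  have hs := h.same_sign N N hN hN b d hb hex hd hex
  have cb := combo_at (x := e (b - 1)) (z := e (b + 1)) hb
  have cd := combo_at (x := e (d - 1)) (z := e (d + 1)) hd
  set Δ := dt (e (b - 1)) (e b) (e (b + 1))
  set Δ' := dt (e (d - 1)) (e d) (e (d + 1))
  have hΔ : Δ ≠ 0 := h.imm b
  have hΔ' : Δ' ≠ 0 := h.imm d
  have := h.gauss b d hbd hc.1 hc.2 ((Δ' * Δ') * ⟪N, e (b + 1)⟫) ((Δ' * Δ') * ⟪N, e (b - 1)⟫)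
    ((Δ * Δ') * ⟪N, e (d + 1)⟫) ((Δ * Δ') * ⟪N, e (d - 1)⟫)
    (mul_nonneg (mul_self_nonneg _) (hex _)) (mul_nonneg (mul_self_nonneg _) (hex _))
    (mul_nonneg hs.le (hex _)) (mul_nonneg hs.le (hex _)) (by
      simp only [mul_smul, ← smul_add]
      rw [← cb, ← cd]
      simp only [smul_smul]; congr 1; ring)
  simp only [mul_smul, ← smul_add] at this
  rw [← cb] at this
  simp [hΔ, hΔ', hN] at this

lemma ConeStar.one_ne {n : ℕ} {e : ZMod n → E3} (h : ConeStar e) :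
    (1 : ZMod n) ≠ 0 ∧ (2 : ZMod n) ≠ 0 := by
  have := h.hn
  constructor
  · intro h1
    have : ((1 : ℕ) : ZMod n) = 0 := by simpa using h1
    rw [ZMod.natCast_eq_zero_iff] at this
    have := Nat.le_of_dvd (by norm_num) this; omega
  · intro h1
    have : ((2 : ℕ) : ZMod n) = 0 := by exact_mod_cast h1
    rw [ZMod.natCast_eq_zero_iff] at this
    have := Nat.le_of_dvd (by norm_num) this; omega

/-- strictly exposed vertex -/
def Expo {n : ℕ} (e : ZMod n → E3) (b : ZMod n) : Prop :=
  ∃ ν : E3, ⟪ν, e b⟫ = 0 ∧ ∀ k, k ≠ b → 0 < ⟪ν, e k⟫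

lemma slope_id (y ν x x' : E3) (hy : ⟪ν, y⟫ = 0) :
    ⟪cross3 y ν, x⟫ * ⟪ν, x'⟫ - ⟪ν, x⟫ * ⟪cross3 y ν, x'⟫ = - (⟪ν, ν⟫ * dt y x x') := by
  have : ⟪cross3 y ν, x⟫ * ⟪ν, x'⟫ - ⟪ν, x⟫ * ⟪cross3 y ν, x'⟫ =
     ⟪ν, y⟫ * dt ν x x' - (⟪ν, ν⟫ * dt y x x') := by
    simp only [inner_coord, dt_coord, cross3_0, cross3_1, cross3_2]; ring
  rw [this, hy]; ring

lemma ConeStar.cross_ne {n : ℕ} {e : ZMod n → E3} (h : ConeStar e) (i j : ZMod n) (hij : i ≠ j) :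
    cross3 (e i) (e j) ≠ 0 := by
  obtain ⟨c, hc⟩ := h.hemi
  intro h0
  obtain ⟨h1n, h2n⟩ := h.one_ne
  have hv : ⟪c, e i⟫ • e j = ⟪c, e j⟫ • e i := by
    have e0 := congrArg (fun x : E3 => x 0) h0
    have e1 := congrArg (fun x : E3 => x 1) h0
    have e2 := congrArg (fun x : E3 => x 2) h0
    simp only [cross3_0, cross3_1, cross3_2, PiLp.zero_apply] at e0 e1 e2
    apply E3ext <;> simp only [PiLp.smul_apply, smul_eq_mul, inner_coord]
    · linear_combination - c 1 * e2 + c 2 * e1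
    · linear_combination  c 0 * e2 - c 2 * e0
    · linear_combination - c 0 * e1 + c 1 * e0
  have ci := hc i
  have cj := hc j
  have hv2 : e j = (⟪c, e i⟫⁻¹ * ⟪c, e j⟫) • e i := by
    rw [mul_smul, ← hv, smul_smul, inv_mul_cancel₀ ci.ne', one_smul]
  by_cases h1 : i + 1 = j
  · apply h.imm i
    rw [h1, hv2, dt_coord]; simp; ring
  · exact h.embv i j hij h1 (⟪c, e i⟫⁻¹ * ⟪c, e j⟫) 0 (by positivity) le_rfl (by simpa using hv2)

lemma ConeStar.exists_expo {n : ℕ} [NeZero n] {e : ZMod n → E3} (h : ConeStar e) :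
    ∃ b, Expo e b := by
  obtain ⟨c, hc⟩ := h.hemi
  obtain ⟨b, hb⟩ := Finite.exists_max (fun i : ZMod n => ⟪e i, e i⟫ / ⟪c, e i⟫ ^ 2)
  refine ⟨b, (⟪e b, e b⟫) • c - (⟪c, e b⟫) • e b, ?_, fun k hk => ?_⟩
  · rw [inner_sub_left, real_inner_smul_left, real_inner_smul_left]; ring
  · have hbk := hb k
    have cb := hc b
    have ck := hc k
    have hne := h.cross_ne k b hk
    rw [inner_sub_left, real_inner_smul_left, real_inner_smul_left]
    rw [div_le_div_iff₀ (by positivity) (by positivity)] at hbk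
    set B := ⟪c, e b⟫
    set C := ⟪c, e k⟫
    have hne2 : C • e b - B • e k ≠ 0 := by
      intro h0
      apply hne
      have : e b = (C⁻¹ * B) • e k := by
        rw [mul_smul, ← sub_eq_zero.1 h0, smul_smul, inv_mul_cancel₀ ck.ne', one_smul]
      rw [this]
      apply E3ext <;> simp [cross3_0, cross3_1, cross3_2] <;> ring
    have hpos : 0 < ⟪C • e b - B • e k, C • e b - B • e k⟫ := real_inner_self_pos.2 hne2
    simp only [inner_sub_left, inner_sub_right, real_inner_smul_left, real_inner_smul_right] at hpos
    rw [real_inner_comm (e k) (e b)] at hpos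
    have : 0 < C * (⟪e b, e b⟫ * C - B * ⟪e b, e k⟫) := by
      rw [real_inner_comm (e k) (e b)] at *
      nlinarith
    exact pos_of_mul_pos_right this ck.le

lemma ConeStar.step {n : ℕ} [NeZero n] {e : ZMod n → E3} (h : ConeStar e) (b : ZMod n)
    (hb : Expo e b) (σ : ℝ) (hσ : σ = 1 ∨ σ = -1)
    (hσb : 0 < σ * dt (e (b - 1)) (e b) (e (b + 1))) :
    ∀ k, k ≠ b → k ≠ b + 1 → 0 < σ * dt (e b) (e (b + 1)) (e k) := by
  obtain ⟨h1n, h2n⟩ := h.one_ne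
  obtain ⟨ν, hν, hpos⟩ := hb
  have hσ0 : σ ≠ 0 := by rcases hσ with h | h <;> rw [h] <;> norm_num
  have hb1 : b + 1 ≠ b := by simpa using h1n
  have hνν : 0 < ⟪ν, ν⟫ := by
    apply real_inner_self_pos.2
    intro h0; have := hpos (b + 1) hb1; rw [h0] at this; simp at this
  obtain ⟨d, hd, hmin⟩ := Finset.exists_min_image (Finset.univ.erase b)
    (fun k => σ * (⟪cross3 (e b) ν, e k⟫ / ⟪ν, e k⟫)) ⟨b + 1, by simp [h1n]⟩
  have hdb : d ≠ b := by simpa using hd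
  have hge : ∀ k, 0 ≤ σ * dt (e b) (e d) (e k) := by
    intro k
    by_cases hk : k = b
    · rw [hk, dt_coord]; apply le_of_eq; ring
    · have h1 := hmin k (by simpa using hk)
      have p1 := hpos k hk
      have p2 := hpos d hdb
      have h2 := slope_id (e b) ν (e k) (e d) hν
      rw [dt_swap] at h2
      have h3 : 0 ≤ σ * (⟪cross3 (e b) ν, e k⟫ * ⟪ν, e d⟫ - ⟪ν, e k⟫ * ⟪cross3 (e b) ν, e d⟫) := by
        have : σ * (⟪cross3 (e b) ν, e k⟫ * ⟪ν, e d⟫ - ⟪ν, e k⟫ * ⟪cross3 (e b) ν, e d⟫) =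
          (⟪ν, e k⟫ * ⟪ν, e d⟫) * (σ * (⟪cross3 (e b) ν, e k⟫ / ⟪ν, e k⟫) -
            σ * (⟪cross3 (e b) ν, e d⟫ / ⟪ν, e d⟫)) := by field_simp
        rw [this]
        exact mul_nonneg (by positivity) (by linarith)
      rw [h2] at h3
      refine nonneg_of_mul_nonneg_right (a := ⟪ν, ν⟫) ?_ hνν
      linarith
  have hNi : ∀ d x, ⟪σ • cross3 (e b) (e d), x⟫ = σ * dt (e b) (e d) x := by
    intro d x
    rw [real_inner_smul_left, dt_coord, inner_coord, cross3_0, cross3_1, cross3_2]; ring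
  have hN : σ • cross3 (e b) (e d) ≠ 0 := smul_ne_zero hσ0 (h.cross_ne b d hdb.symm)
  have hpair : ∀ k, k ≠ b → σ * dt (e b) (e d) (e k) = 0 → b + 1 = k ∨ b = k + 1 := by
    intro k hk h0
    refine h.pair _ hN (fun i => by rw [hNi]; exact hge i) b k ?_ ?_ hk.symm
    · rw [hNi, dt_coord]; ring
    · rw [hNi, h0]
  have hcyc : dt (e b) (e (b + 1)) (e (b - 1)) = dt (e (b - 1)) (e b) (e (b + 1)) := dt_cyc _ _ _
  have hd1 : b + 1 = d := by
    rcases hpair d hdb (by rw [dt_coord]; ring) with h1 | h1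
    · exact h1
    · exfalso
      have hd' : d = b - 1 := by rw [h1]; ring
      have h2 := hge (b + 1)
      rw [hd', dt_swap, hcyc] at h2
      linarith
  intro k hk hk1
  rw [hd1]
  refine lt_of_le_of_ne (hge k) (fun h0 => ?_)
  rcases hpair k hk h0.symm with h1 | h1
  · exact hk1 h1.symm
  · have hk' : k = b - 1 := by rw [h1]; ring
    rw [hk', ← hd1, hcyc] at h0
    linarith

lemma perturb {n : ℕ} [NeZero n] (e : ZMod n → E3) (N H : E3) (d : ZMod n)
    (h : ∀ k, k ≠ d → 0 < ⟪N, e k⟫ ∨ (⟪N, e k⟫ = 0 ∧ 0 < ⟪H, e k⟫)) :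
    ∃ ε : ℝ, ∀ k, k ≠ d → 0 < ⟪N + ε • H, e k⟫ := by
  have : ∀ k, ∀ᶠ ε in nhdsWithin (0:ℝ) (Set.Ioi 0), k ≠ d → 0 < ⟪N + ε • H, e k⟫ := by
    intro k
    by_cases hk : k = d
    · simp [hk]
    rcases h k hk with h1 | ⟨h1, h2⟩
    · have hc : Continuous (fun ε : ℝ => ⟪N + ε • H, e k⟫) := by fun_prop
      have ht : Filter.Tendsto (fun ε : ℝ => ⟪N + ε • H, e k⟫) (nhdsWithin (0:ℝ) (Set.Ioi 0))
          (nhds ⟪N, e k⟫) := by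
        have := (hc.tendsto 0).mono_left (nhdsWithin_le_nhds (s := Set.Ioi 0))
        simpa using this
      filter_upwards [ht.eventually (lt_mem_nhds h1)] with ε hε _ using hε
    · filter_upwards [self_mem_nhdsWithin] with ε hε _
      rw [inner_add_left, real_inner_smul_left, h1, zero_add]
      exact mul_pos hε h2
  obtain ⟨ε, hε⟩ := (Filter.eventually_all.2 this).exists
  exact ⟨ε, hε⟩

lemma cauchy_strict (a b : E3) (h : cross3 a b ≠ 0) : 0 < ⟪b, b⟫ * ⟪a, a⟫ - ⟪a, b⟫ * ⟪a, b⟫ := by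
  have h1 : 0 < ⟪cross3 a b, cross3 a b⟫ := real_inner_self_pos.2 h
  have : ⟪cross3 a b, cross3 a b⟫ = ⟪b, b⟫ * ⟪a, a⟫ - ⟪a, b⟫ * ⟪a, b⟫ := by
    simp only [inner_coord, cross3_0, cross3_1, cross3_2]; ring
  linarith

lemma ConeStar.expo_succ {n : ℕ} [NeZero n] {e : ZMod n → E3} (h : ConeStar e) (b : ZMod n)
    (hb : Expo e b) : Expo e (b + 1) := by
  obtain ⟨h1n, h2n⟩ := h.one_ne
  have hb1 : b + 1 ≠ b := by simpa using h1n
  obtain ⟨σ, hσ, hσb⟩ : ∃ σ : ℝ, (σ = 1 ∨ σ = -1) ∧ 0 < σ * dt (e (b - 1)) (e b) (e (b + 1)) := by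
    rcases lt_or_gt_of_ne (h.imm b) with h1 | h1
    · exact ⟨-1, Or.inr rfl, by linarith⟩
    · exact ⟨1, Or.inl rfl, by linarith⟩
  have hs := h.step b hb σ hσ hσb
  have hNi : ∀ x, ⟪σ • cross3 (e b) (e (b + 1)), x⟫ = σ * dt (e b) (e (b + 1)) x := by
    intro x
    rw [real_inner_smul_left, dt_coord, inner_coord, cross3_0, cross3_1, cross3_2]; ring
  set H : E3 := ⟪e (b + 1), e (b + 1)⟫ • e b - ⟪e b, e (b + 1)⟫ • e (b + 1) with hH
  have hH0 : ⟪H, e (b + 1)⟫ = 0 := by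
    rw [hH, inner_sub_left, real_inner_smul_left, real_inner_smul_left]; ring
  have hH1 : 0 < ⟪H, e b⟫ := by
    rw [hH, inner_sub_left, real_inner_smul_left, real_inner_smul_left,
      real_inner_comm (e b) (e (b + 1))]
    have := cauchy_strict _ _ (h.cross_ne b (b + 1) hb1.symm)
    exact this
  obtain ⟨ε, hε⟩ := perturb e (σ • cross3 (e b) (e (b + 1))) H (b + 1) (by
    intro k hk
    rw [hNi]
    by_cases hkb : k = b
    · right; subst hkb
      exact ⟨by rw [dt_coord]; ring, hH1⟩
    · left; exact hs k hkb hk)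
  refine ⟨_, ?_, hε⟩
  rw [inner_add_left, hNi, real_inner_smul_left, hH0, dt_coord]; ring

lemma ConeStar.expo_all {n : ℕ} [NeZero n] {e : ZMod n → E3} (h : ConeStar e) (k : ZMod n) :
    Expo e k := by
  obtain ⟨b, hb⟩ := h.exists_expo
  have : ∀ m : ℕ, Expo e (b + m) := by
    intro m
    induction m with
    | zero => simpa using hb
    | succ m ih =>
      have := h.expo_succ _ ih
      rw [add_assoc] at this
      simpa using this
  have h2 := this (k - b).val
  rw [ZMod.natCast_zmod_val] at h2
  simpa using h2

theorem ConeStar.convex {n : ℕ} [NeZero n] {e : ZMod n → E3} (h : ConeStar e) :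
    ∃ σ : ℝ, (σ = 1 ∨ σ = -1) ∧
      ∀ b k, k ≠ b → k ≠ b + 1 → 0 < σ * dt (e b) (e (b + 1)) (e k) := by
  obtain ⟨h1n, h2n⟩ := h.one_ne
  obtain ⟨σ, hσ, hσb⟩ : ∃ σ : ℝ, (σ = 1 ∨ σ = -1) ∧ 0 < σ * dt (e (0 - 1)) (e 0) (e (0 + 1)) := by
    rcases lt_or_gt_of_ne (h.imm 0) with h1 | h1
    · exact ⟨-1, Or.inr rfl, by linarith⟩
    · exact ⟨1, Or.inl rfl, by linarith⟩
  refine ⟨σ, hσ, fun b => h.step b (h.expo_all b) σ hσ ?_⟩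
  have hne : ∀ (j : ZMod n) (N : E3), (∀ k, k ≠ j → 0 < ⟪N, e k⟫) → N ≠ 0 := by
    intro j N hN h0
    have := hN (j + 1) (by simpa using h1n)
    rw [h0] at this; simp at this
  have hnn : ∀ (j : ZMod n) (N : E3), ⟪N, e j⟫ = 0 → (∀ k, k ≠ j → 0 < ⟪N, e k⟫) →
      ∀ i, 0 ≤ ⟪N, e i⟫ := by
    intro j N h0 hN i
    by_cases hi : i = j
    · rw [hi, h0]
    · exact (hN i hi).le
  obtain ⟨N, hN0, hN⟩ := h.expo_all 0
  obtain ⟨N', hN0', hN'⟩ := h.expo_all b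
  have := h.same_sign N N' (hne _ _ hN) (hne _ _ hN') 0 b hN0 (hnn _ _ hN0 hN) hN0' (hnn _ _ hN0' hN')
  rcases hσ with rfl | rfl
  · rw [one_mul] at hσb ⊢
    exact pos_of_mul_pos_right this hσb.le
  · have h3 : dt (e (0 - 1)) (e 0) (e (0 + 1)) < 0 := by linarith
    have := neg_of_mul_pos_right this h3.le
    linarith

lemma mem_face (v p q : E3) (s t : ℝ) (hs : 0 ≤ s) (ht : 0 ≤ t) (hst : s + t ≤ 1) :
    v + (s • (p - v) + t • (q - v)) ∈ convexHull ℝ ({v, p, q} : Set E3) := by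
  have hc := convex_convexHull ℝ ({v, p, q} : Set E3)
  have h1 : v ∈ convexHull ℝ ({v, p, q} : Set E3) := subset_convexHull ℝ _ (by simp)
  have h2 : p ∈ convexHull ℝ ({v, p, q} : Set E3) := subset_convexHull ℝ _ (by simp)
  have h3 : q ∈ convexHull ℝ ({v, p, q} : Set E3) := subset_convexHull ℝ _ (by simp)
  have := hc.sum_mem (t := Finset.univ) (w := ![1 - s - t, s, t]) (z := ![v, p, q])
    (by intro i _; fin_cases i <;> simp <;> linarith)
    (by simp [Fin.sum_univ_three]; ring)
    (by intro i _; fin_cases i <;> simpa)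
  simp only [Fin.sum_univ_three] at this
  simp at this
  convert this using 1
  module

lemma cross3_ne_zero {a b : E3} (h : LinearIndependent ℝ ![a, b]) : cross3 a b ≠ 0 := by
  intro h0
  rw [LinearIndependent.pair_iff] at h
  have key : ⟪a, b⟫ • a + (- ⟪a, a⟫) • b = cross3 a (cross3 a b) := by
    apply E3ext <;> simp only [PiLp.add_apply, PiLp.smul_apply, smul_eq_mul, inner_coord,
      cross3_0, cross3_1, cross3_2] <;> ring
  have hz : cross3 a (0 : E3) = 0 := by
    apply E3ext <;> simp [cross3_0, cross3_1, cross3_2]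
  rw [h0, hz] at key
  have h1 := (h _ _ key).2
  have h2 : a = 0 := by simpa using h1
  have := (h 1 0 (by simp [h2])).1
  norm_num at this

lemma unit_dep {p q : E3} (hp : ‖p‖ = 1) (hq : ‖q‖ = 1) (h : cross3 p q = 0) :
    q = p ∨ q = -p := by
  have key : ⟪p, q⟫ ^ 2 + ⟪cross3 p q, cross3 p q⟫ = ⟪p, p⟫ * ⟪q, q⟫ := by
    simp only [inner_coord, cross3_0, cross3_1, cross3_2]; ring
  rw [h, inner_zero_left, real_inner_self_eq_norm_sq, real_inner_self_eq_norm_sq, hp, hq] at key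
  have : ⟪p, q⟫ = 1 ∨ ⟪p, q⟫ = -1 := by
    apply sq_eq_sq_iff_eq_or_eq_neg.1
    linarith
  rcases this with h1 | h1
  · left; exact ((inner_eq_one_iff_of_norm_eq_one hp hq).1 h1).symm
  · right
    have := (inner_eq_neg_one_iff_of_norm_eq_one hp hq).1 h1
    rw [this]; simp

lemma cross3_cross3 (a b c : E3) : cross3 (cross3 a b) (cross3 b c) = dt a b c • b := by
  apply E3ext <;> simp only [PiLp.smul_apply, smul_eq_mul, dt_coord,
      cross3_0, cross3_1, cross3_2] <;> ring

lemma cross3_smul (s t : ℝ) (a b : E3) : cross3 (s • a) (t • b) = (s * t) • cross3 a b := by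
  apply E3ext <;> simp only [PiLp.smul_apply, smul_eq_mul,
      cross3_0, cross3_1, cross3_2] <;> ring

lemma mem_sArc_aux {m m' : E3} (hm : m ≠ 0) (hm' : m' ≠ 0) (s t : ℝ) (hs : 0 ≤ s) (ht : 0 ≤ t)
    (hx : s • m + t • m' ≠ 0) :
    ‖s • m + t • m'‖⁻¹ • (s • m + t • m') ∈ sArc (‖m‖⁻¹ • m) (‖m'‖⁻¹ • m') := by
  have h1 : 0 < ‖m‖ := norm_pos_iff.2 hm
  have h2 : 0 < ‖m'‖ := norm_pos_iff.2 hm'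
  refine ⟨s * ‖m‖, t * ‖m'‖, by positivity, by positivity, ?_, ?_⟩
  · rcases hs.lt_or_eq with h | h
    · have : 0 ≤ t * ‖m'‖ := by positivity
      have : 0 < s * ‖m‖ := by positivity
      linarith
    · rcases ht.lt_or_eq with h' | h'
      · have : 0 < t * ‖m'‖ := by positivity
        have : 0 ≤ s * ‖m‖ := by positivity
        linarith
      · exfalso; apply hx; simp [← h, ← h']
  · simp only [smul_smul, mul_assoc, mul_inv_cancel₀ h1.ne', mul_inv_cancel₀ h2.ne', mul_one]

lemma star_cone {n : ℕ} [NeZero n] {v : E3} {w : ZMod n → E3} (hS : IsStar v w)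
    (hG : GaussEmb v w) (hK : 0 < curv v w) : ConeStar (fun i => w i - v) := by
  obtain ⟨hn, hli, himm, hemb⟩ := hS
  have hmem : ∀ i (s t : ℝ), 0 ≤ s → 0 ≤ t → s + t ≤ 1 →
      v + (s • (w i - v) + t • (w (i + 1) - v)) ∈ starFace v w i :=
    fun i s t hs ht hst => mem_face _ _ _ s t hs ht hst
  have hm : ∀ i, starFN v w i ≠ 0 := fun i => cross3_ne_zero (hli i)
  have hnu : ∀ i, ‖starUN v w i‖ = 1 := by
    intro i
    rw [starUN, norm_smul, norm_inv, norm_norm, inv_mul_cancel₀ (norm_ne_zero_iff.2 (hm i))]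
  have he0 : ∀ i, w i - v ≠ 0 := fun i h => by
    have := (LinearIndependent.pair_iff.1 (hli i)) 1 0 (by simp [h])
    simp at this
  have hembx : ∀ i j, i ≠ j → i + 1 ≠ j → i ≠ j + 1 → ∀ s t s' t' : ℝ, 0 ≤ s → 0 ≤ t →
      0 ≤ s' → 0 ≤ t' →
      s • (w i - v) + t • (w (i + 1) - v) = s' • (w j - v) + t' • (w (j + 1) - v) →
      s • (w i - v) + t • (w (i + 1) - v) = 0 := by
    intro i j h1 h2 h3 s t s' t' hs ht hs' ht' he
    have hD : 0 < 1 + s + t + s' + t' := by positivity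
    set δ := (1 + s + t + s' + t')⁻¹ with hδ
    have hδ0 : 0 < δ := inv_pos.2 hD
    have hδ1 : δ * (1 + s + t + s' + t') = 1 := inv_mul_cancel₀ hD.ne'
    have n1 : 0 ≤ δ * s := by positivity
    have n2 : 0 ≤ δ * t := by positivity
    have n3 : 0 ≤ δ * s' := by positivity
    have n4 : 0 ≤ δ * t' := by positivity
    have a1 := hmem i (δ * s) (δ * t) n1 n2 (by nlinarith)
    have a2 := hmem j (δ * s') (δ * t') n3 n4 (by nlinarith)
    rw [mul_smul, mul_smul, ← smul_add] at a1 a2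
    rw [← he] at a2
    have h4 := (hemb i j h1).2.2 (Ne.symm h2) h3
    have h5 : v + δ • (s • (w i - v) + t • (w (i + 1) - v)) ∈ ({v} : Set E3) := by
      rw [← h4]; exact ⟨a1, a2⟩
    have h6 : δ • (s • (w i - v) + t • (w (i + 1) - v)) = 0 := by simpa using h5
    exact (smul_eq_zero.1 h6).resolve_left hδ0.ne'
  refine ⟨hn, ?_, ?_, hembx, ?_, ?_⟩
  · apply hemisphere _ hli
    rw [curv] at hK
    linarith
  · intro i h0
    have hi := himm (i - 1)
    rw [sub_add_cancel] at hi
    have hc : cross3 (starUN v w (i - 1)) (starUN v w i) = 0 := by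
      rw [starUN, starUN, cross3_smul, starFN, starFN, sub_add_cancel, cross3_cross3]
      rw [h0]; simp
    rcases unit_dep (hnu _) (hnu _) hc with h | h
    · exact hi.1 h
    · exact hi.2 h
  · intro i j h1 h2 s t hs ht he
    by_cases h3 : i = j + 1
    · subst h3
      have hD : 0 < 1 + s + t := by positivity
      set δ := (1 + s + t)⁻¹ with hδ
      have hδ0 : 0 < δ := inv_pos.2 hD
      have hδ1 : δ * (1 + s + t) = 1 := inv_mul_cancel₀ hD.ne'
      have n1 : 0 ≤ δ * s := by positivity
      have n2 : 0 ≤ δ * t := by positivity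
      have a1 := hmem (j + 1) (δ * s) (δ * t) n1 n2 (by nlinarith)
      have a2 := hmem j δ 0 hδ0.le le_rfl (by nlinarith)
      rw [mul_smul, mul_smul, ← smul_add, ← he] at a1
      rw [zero_smul, add_zero] at a2
      have h4 := (hemb _ _ h1).2.1 rfl
      have h5 : v + δ • (w j - v) ∈ segment ℝ v (w (j + 1)) := by
        rw [← h4]; exact ⟨a1, a2⟩
      rw [segment_eq_image'] at h5
      obtain ⟨r, -, hr⟩ := h5
      have h6 : r • (w (j + 1) - v) = δ • (w j - v) := add_left_cancel hr
      have := (LinearIndependent.pair_iff.1 (hli j)) δ (-r) (by rw [neg_smul, h6]; simp)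
      exact hδ0.ne' this.1
    · have := hembx i j h1 h2 h3 s t 1 0 hs ht zero_le_one le_rfl (by rw [← he]; simp)
      rw [this] at he
      exact he0 _ he
  · intro i j h1 h2 h3 s t s' t' hs ht hs' ht' he
    by_contra hx
    have e1 : ∀ i, cross3 (w (i - 1) - v) (w i - v) = starFN v w (i - 1) := by
      intro i; rw [starFN, sub_add_cancel]
    have e2 : ∀ i, cross3 (w i - v) (w (i + 1) - v) = starFN v w i := fun i => rfl
    simp only [e1, e2] at he hx
    have a1 := mem_sArc_aux (hm (i - 1)) (hm i) s t hs ht hx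
    have a2 := mem_sArc_aux (hm (j - 1)) (hm j) s' t' hs' ht' (by rw [← he]; exact hx)
    rw [← he] at a2
    have h4 := (hG.2 (i - 1) (j - 1) (fun h => h1 (sub_left_injective h))).2.2
      (fun h => h2 (by rw [sub_add_cancel] at h; rw [← h]; ring))
      (fun h => h3 (by rw [sub_add_cancel] at h; rw [← h]; ring))
    simp only [sub_add_cancel] at h4
    have : ‖s • starFN v w (i - 1) + t • starFN v w i‖⁻¹ •
      (s • starFN v w (i - 1) + t • starFN v w i) ∈ (∅ : Set E3) := by
      rw [← h4]; exact ⟨a1, a2⟩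
    exact this

/-- Oriented volume form relative to the plane through three points. -/
def pl (a b c x : E3) : ℝ := ⟪x - a, cross3 (b - a) (c - a)⟫

lemma pl_cyc (a b c x : E3) : pl b c a x = pl a b c x := by
  simp only [pl, inner_coord, cross3_0, cross3_1, cross3_2, PiLp.sub_apply]; ring

lemma pl_swap (a b c x : E3) : pl a c b x = - pl a b c x := by
  simp only [pl, inner_coord, cross3_0, cross3_1, cross3_2, PiLp.sub_apply]; ring

lemma set_cases {v p q a b c : E3} (hvp : v ≠ p) (hvq : v ≠ q) (hpq : p ≠ q)
    (h : ({v, p, q} : Set E3) = {a, b, c}) :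
    (∀ x, pl v p q x = pl a b c x) ∨ (∀ x, pl v p q x = - pl a b c x) := by
  have h1 : v ∈ ({a, b, c} : Set E3) := by rw [← h]; simp
  have h2 : p ∈ ({a, b, c} : Set E3) := by rw [← h]; simp
  have h3 : q ∈ ({a, b, c} : Set E3) := by rw [← h]; simp
  simp only [Set.mem_insert_iff, Set.mem_singleton_iff] at h1 h2 h3
  clear h
  rcases h1 with rfl | rfl | rfl <;> rcases h2 with rfl | rfl | rfl <;>
    rcases h3 with rfl | rfl | rfl <;> first
    | exact absurd rfl hvp
    | exact absurd rfl hvq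
    | exact absurd rfl hpq
    | exact Or.inl fun _ => rfl
    | (left; intro x; simp only [pl, inner_coord, cross3_0, cross3_1, cross3_2, PiLp.sub_apply]
       ring1)
    | (right; intro x; simp only [pl, inner_coord, cross3_0, cross3_1, cross3_2, PiLp.sub_apply]
       ring1)

lemma star_side {n : ℕ} [NeZero n] {v : E3} {w : ZMod n → E3} (hS : IsStar v w)
    (hG : GaussEmb v w) (hK : 0 < curv v w) (a b c : E3)
    (hf : ∃ i, ({v, w i, w (i + 1)} : Set E3) = {a, b, c}) :
    ∃ ρ : ℝ, (ρ = 1 ∨ ρ = -1) ∧ (∀ k, 0 ≤ ρ * pl a b c (w k)) ∧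
      ∀ k, w k ≠ a → w k ≠ b → w k ≠ c → 0 < ρ * pl a b c (w k) := by
  obtain ⟨i, hi⟩ := hf
  have hli := LinearIndependent.pair_iff.1 (hS.2.1 i)
  have h1 : v ≠ w i := by
    intro h
    have := hli 1 0 (by simp [← h])
    simp at this
  have h2 : v ≠ w (i + 1) := by
    intro h
    have := hli 0 1 (by simp [← h])
    simp at this
  have h3 : w i ≠ w (i + 1) := by
    intro h
    have := hli 1 (-1) (by simp [← h])
    simp at this
  obtain ⟨σ, hσ, hc⟩ := (star_cone hS hG hK).convex
  have key : ∀ k, k ≠ i → k ≠ i + 1 → 0 < σ * pl v (w i) (w (i + 1)) (w k) := by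
    intro k hk1 hk2
    have := hc i k hk1 hk2
    rw [← dt_cyc, ← dt_cyc, ← dt_cyc] at this
    have h : dt (w k - v) (w i - v) (w (i + 1) - v) = pl v (w i) (w (i + 1)) (w k) := rfl
    have h' := dt_cyc (w k - v) (w i - v) (w (i + 1) - v)
    rw [← h, ← h']
    rw [dt_cyc, dt_cyc, dt_cyc] at this
    exact this
  have key0 : ∀ k, 0 ≤ σ * pl v (w i) (w (i + 1)) (w k) := by
    intro k
    by_cases hk1 : k = i
    · subst hk1
      apply le_of_eq
      simp only [pl, inner_coord, cross3_0, cross3_1, cross3_2, PiLp.sub_apply]; ring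
    by_cases hk2 : k = i + 1
    · subst hk2
      apply le_of_eq
      simp only [pl, inner_coord, cross3_0, cross3_1, cross3_2, PiLp.sub_apply]; ring
    exact (key k hk1 hk2).le
  have keyx : ∀ k, w k ≠ a → w k ≠ b → w k ≠ c → 0 < σ * pl v (w i) (w (i + 1)) (w k) := by
    intro k ha hb hc'
    apply key
    · rintro rfl
      have : w k ∈ ({a, b, c} : Set E3) := by rw [← hi]; simp
      simp [ha, hb, hc'] at this
    · rintro rfl
      have : w (i + 1) ∈ ({a, b, c} : Set E3) := by rw [← hi]; simp
      simp [ha, hb, hc'] at this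
  rcases set_cases h1 h2 h3 hi with h | h
  · refine ⟨σ, hσ, fun k => ?_, fun k ha hb hc' => ?_⟩
    · rw [← h]; exact key0 k
    · rw [← h]; exact keyx k ha hb hc'
  · refine ⟨-σ, ?_, fun k => ?_, fun k ha hb hc' => ?_⟩
    · rcases hσ with rfl | rfl <;> simp
    · have := key0 k
      rw [h] at this; linarith
    · have := keyx k ha hb hc'
      rw [h] at this; linarith

lemma nbr_of_face {n : ℕ} {v : E3} {w : ZMod n → E3} {a b x : E3} (hx : x ≠ v)
    (h : ∃ i, ({v, w i, w (i + 1)} : Set E3) = {a, b, x}) : ∃ k, w k = x := by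
  obtain ⟨i, hi⟩ := h
  have : x ∈ ({v, w i, w (i + 1)} : Set E3) := by rw [hi]; simp
  simp only [Set.mem_insert_iff, Set.mem_singleton_iff] at this
  rcases this with h | h | h
  · exact absurd h hx
  · exact ⟨i, h.symm⟩
  · exact ⟨i + 1, h.symm⟩

lemma sign_eq {ρ ρ' t : ℝ} (h : ρ = 1 ∨ ρ = -1) (h' : ρ' = 1 ∨ ρ' = -1) (ht : 0 < ρ * t)
    (ht' : 0 < ρ' * t) : ρ' = ρ := by
  rcases h with rfl | rfl <;> rcases h' with rfl | rfl <;> first | rfl | (exfalso; linarith)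

/-- Proposition 3.1, simplicial case: let `u₀, u₁, u₂` be affinely independent and let
three embedded, immersed simplicial vertex stars be given, one centered at each `uₖ`,
such that the triangle `T = conv {u₀, u₁, u₂}` is a face of each star and such that for
each edge of `T` the two stars at its endpoints have a common face, different from `T`,
adjacent to `T` along that edge. If all three Gauss images have no self-intersections
and all three discrete Gaussian curvatures are positive, then there is a nonzero vector
`ν` orthogonal to the plane of `T` such that every neighbor point of each of the three
stars satisfies `⟨w − u₀, ν⟩ ≤ 0`: a neighborhood of `T` lies in a closed half-space
bounded by the plane of `T`. -/
theorem stmt10 {n₀ n₁ n₂ : ℕ} [NeZero n₀] [NeZero n₁] [NeZero n₂]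
    (u₀ u₁ u₂ : E3) (hu : AffineIndependent ℝ ![u₀, u₁, u₂])
    (w₀ : ZMod n₀ → E3) (w₁ : ZMod n₁ → E3) (w₂ : ZMod n₂ → E3)
    (hS₀ : IsStar u₀ w₀) (hS₁ : IsStar u₁ w₁) (hS₂ : IsStar u₂ w₂)
    (hface₀ : ∃ i : ZMod n₀, ({u₀, w₀ i, w₀ (i + 1)} : Set E3) = {u₀, u₁, u₂})
    (hface₁ : ∃ i : ZMod n₁, ({u₁, w₁ i, w₁ (i + 1)} : Set E3) = {u₀, u₁, u₂})
    (hface₂ : ∃ i : ZMod n₂, ({u₂, w₂ i, w₂ (i + 1)} : Set E3) = {u₀, u₁, u₂})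
    (hedge₀₁ : ∃ x : E3, x ≠ u₀ ∧ x ≠ u₁ ∧ x ≠ u₂ ∧
      (∃ i : ZMod n₀, ({u₀, w₀ i, w₀ (i + 1)} : Set E3) = {u₀, u₁, x}) ∧
      (∃ j : ZMod n₁, ({u₁, w₁ j, w₁ (j + 1)} : Set E3) = {u₀, u₁, x}))
    (hedge₀₂ : ∃ x : E3, x ≠ u₀ ∧ x ≠ u₁ ∧ x ≠ u₂ ∧
      (∃ i : ZMod n₀, ({u₀, w₀ i, w₀ (i + 1)} : Set E3) = {u₀, u₂, x}) ∧
      (∃ j : ZMod n₂, ({u₂, w₂ j, w₂ (j + 1)} : Set E3) = {u₀, u₂, x}))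
    (hedge₁₂ : ∃ x : E3, x ≠ u₀ ∧ x ≠ u₁ ∧ x ≠ u₂ ∧
      (∃ i : ZMod n₁, ({u₁, w₁ i, w₁ (i + 1)} : Set E3) = {u₁, u₂, x}) ∧
      (∃ j : ZMod n₂, ({u₂, w₂ j, w₂ (j + 1)} : Set E3) = {u₁, u₂, x}))
    (hG₀ : GaussEmb u₀ w₀) (hG₁ : GaussEmb u₁ w₁) (hG₂ : GaussEmb u₂ w₂)
    (hK₀ : 0 < curv u₀ w₀) (hK₁ : 0 < curv u₁ w₁) (hK₂ : 0 < curv u₂ w₂) :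
    ∃ ν : E3, ν ≠ 0 ∧ ⟪ν, u₁ - u₀⟫ = 0 ∧ ⟪ν, u₂ - u₀⟫ = 0 ∧
      (∀ i : ZMod n₀, ⟪w₀ i - u₀, ν⟫ ≤ 0) ∧
      (∀ i : ZMod n₁, ⟪w₁ i - u₀, ν⟫ ≤ 0) ∧
      (∀ i : ZMod n₂, ⟪w₂ i - u₀, ν⟫ ≤ 0) := by
  obtain ⟨ρ, hρ, p0, q0⟩ := star_side hS₀ hG₀ hK₀ u₀ u₁ u₂ hface₀
  obtain ⟨ρ₁, hρ₁, p1, q1⟩ := star_side hS₁ hG₁ hK₁ u₀ u₁ u₂ hface₁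
  obtain ⟨ρ₂, hρ₂, p2, q2⟩ := star_side hS₂ hG₂ hK₂ u₀ u₁ u₂ hface₂
  obtain ⟨x, x0, x1, x2, hx, hx'⟩ := hedge₀₁
  obtain ⟨y, y0, y1, y2, hy, hy'⟩ := hedge₀₂
  obtain ⟨k, rfl⟩ := nbr_of_face x0 hx
  obtain ⟨l, hl⟩ := nbr_of_face x1 hx'
  obtain ⟨k', rfl⟩ := nbr_of_face y0 hy
  obtain ⟨l', hl'⟩ := nbr_of_face y2 hy'
  have b0 := q0 k x0 x1 x2
  have b1 := q1 l (by rwa [hl]) (by rwa [hl]) (by rwa [hl])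
  rw [hl] at b1
  have b2 := q0 k' y0 y1 y2
  have b3 := q2 l' (by rwa [hl']) (by rwa [hl']) (by rwa [hl'])
  rw [hl'] at b3
  have s1 := sign_eq hρ hρ₁ b0 b1
  have s2 := sign_eq hρ hρ₂ b2 b3
  subst s1 s2
  have hval : ∀ z, ⟪z - u₀, (-ρ₂) • cross3 (u₁ - u₀) (u₂ - u₀)⟫ = - (ρ₂ * pl u₀ u₁ u₂ z) := by
    intro z; rw [real_inner_smul_right, pl]; ring
  refine ⟨(-ρ₂) • cross3 (u₁ - u₀) (u₂ - u₀), ?_, ?_, ?_, ?_, ?_, ?_⟩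
  · intro h
    have := hval (w₀ k)
    rw [h, inner_zero_right] at this
    linarith
  · simp only [inner_coord, cross3_0, cross3_1, cross3_2, PiLp.sub_apply, PiLp.smul_apply,
      smul_eq_mul]; ring
  · simp only [inner_coord, cross3_0, cross3_1, cross3_2, PiLp.sub_apply, PiLp.smul_apply,
      smul_eq_mul]; ring
  · intro i; rw [hval]; linarith [p0 i]
  · intro i; rw [hval]; linarith [p1 i]
  · intro i; rw [hval]; linarith [p2 i]
end
end

section
/- Let (v; w₀, …, w_{n−1}) be an embedded, immersed simplicial vertex star in ℝ³ whose Gauss image has no self-intersections, and let ρ(x) = L x + t be an invertible affine transformation of ℝ³ (L an invertible linear map, t ∈ ℝ³). Then (ρ(v); ρ(w₀), …, ρ(w_{n−1})) is again an embedded, immersed simplicial vertex star, its Gauss image has no self-intersections, and its discrete Gaussian curvature has the same sign as that of the original star: K(ρ(v)) > 0 if and only if K(v) > 0, and K(ρ(v)) < 0 if and only if K(v) < 0. (Part of Theorem 4.1: invariance of non-self-intersection of the Gauss image and of the sign of discrete Gaussian curvature under the derivative of a projective transformation.) -/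
open RealInnerProductSpace

noncomputable section

namespace Stmt11

lemma cross3_zero (a b : E3) : cross3 a b 0 = a 1 * b 2 - a 2 * b 1 := rfl
lemma cross3_one (a b : E3) : cross3 a b 1 = a 2 * b 0 - a 0 * b 2 := rfl
lemma cross3_two (a b : E3) : cross3 a b 2 = a 0 * b 1 - a 1 * b 0 := rfl

/-- The determinant of three vectors. -/
def det3 (a b c : E3) : ℝ :=
  a 0 * (b 1 * c 2 - b 2 * c 1) + a 1 * (b 2 * c 0 - b 0 * c 2) + a 2 * (b 0 * c 1 - b 1 * c 0)

lemma ext3 {a b : E3} (h0 : a 0 = b 0) (h1 : a 1 = b 1) (h2 : a 2 = b 2) : a = b := by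
  ext i; fin_cases i <;> assumption

lemma inner3 (a b : E3) : ⟪a, b⟫ = a 0 * b 0 + a 1 * b 1 + a 2 * b 2 := by
  simp [PiLp.inner_apply, Fin.sum_univ_three]; ring

lemma inner_cross3 (a b c : E3) : ⟪cross3 a b, c⟫ = det3 a b c := by
  rw [inner3, cross3_zero, cross3_one, cross3_two, det3]; ring

/-- Double cross product. -/
lemma cross3_cross3 (a b c : E3) : cross3 (cross3 a b) (cross3 b c) = det3 a b c • b := by
  apply ext3 <;> simp only [cross3_zero, cross3_one, cross3_two, det3, PiLp.smul_apply, smul_eq_mul]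
    <;> ring

lemma cross3_smul_smul (a b : E3) (s t : ℝ) : cross3 (s • a) (t • b) = (s * t) • cross3 a b := by
  apply ext3 <;> simp only [cross3_zero, cross3_one, cross3_two, PiLp.smul_apply, smul_eq_mul]
    <;> ring

lemma cross3_self (a : E3) : cross3 a a = 0 := by
  apply ext3 <;> simp [cross3_zero, cross3_one, cross3_two] <;> ring

/-- Lagrange / Grassmann: `(a × b) × c`. -/
lemma cross3_cross3_left (a b c : E3) : cross3 (cross3 a b) c = ⟪a, c⟫ • b - ⟪b, c⟫ • a := by
  apply ext3 <;> simp only [cross3_zero, cross3_one, cross3_two, inner3, PiLp.smul_apply,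
    PiLp.sub_apply, smul_eq_mul] <;> ring

lemma cross3_ne_zero {a b : E3} (h : LinearIndependent ℝ ![a, b]) : cross3 a b ≠ 0 := by
  intro h0
  rw [LinearIndependent.pair_iff] at h
  have key : ∀ c : E3, ⟪b, c⟫ = 0 ∧ ⟪a, c⟫ = 0 := by
    intro c
    have := cross3_cross3_left a b c
    rw [h0] at this
    have h1 : cross3 (0 : E3) c = 0 := by
      apply ext3 <;> simp [cross3_zero, cross3_one, cross3_two]
    rw [h1] at this
    have := h (-⟪b, c⟫) ⟪a, c⟫ (by rw [this]; module)
    constructor <;> linarith [this.1, this.2]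
  have ha : a = 0 := by
    have := (key a).2
    exact inner_self_eq_zero.1 this
  have := h 1 0 (by simp [ha])
  simp at this

lemma linInd_of_cross3_ne_zero {a b : E3} (h : cross3 a b ≠ 0) : LinearIndependent ℝ ![a, b] := by
  rw [LinearIndependent.pair_iff]
  intro s t hst
  have h1 : t • cross3 a b = 0 := by
    have : cross3 a (s • a + t • b) = t • cross3 a b := by
      apply ext3 <;> simp [cross3_zero, cross3_one, cross3_two] <;> ring
    rw [← this, hst]
    apply ext3 <;> simp [cross3_zero, cross3_one, cross3_two]
  have h2 : s • cross3 a b = 0 := by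
    have : cross3 (s • a + t • b) b = s • cross3 a b := by
      apply ext3 <;> simp [cross3_zero, cross3_one, cross3_two] <;> ring
    rw [← this, hst]
    apply ext3 <;> simp [cross3_zero, cross3_one, cross3_two]
  exact ⟨(smul_eq_zero.1 h2).resolve_right h, (smul_eq_zero.1 h1).resolve_right h⟩

/-- The standard basis. -/
def e3 (i : Fin 3) : E3 := EuclideanSpace.single i 1

lemma decomp3 (a : E3) : a = a 0 • e3 0 + a 1 • e3 1 + a 2 • e3 2 := by
  apply ext3 <;> simp [e3]

/-- The cofactor map of a linear map. -/
def cof (L : E3 →ₗ[ℝ] E3) (x : E3) : E3 :=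
  x 0 • cross3 (L (e3 1)) (L (e3 2)) + x 1 • cross3 (L (e3 2)) (L (e3 0))
    + x 2 • cross3 (L (e3 0)) (L (e3 1))

lemma cof_add (L : E3 →ₗ[ℝ] E3) (x y : E3) : cof L (x + y) = cof L x + cof L y := by
  simp only [cof, PiLp.add_apply]; module

lemma cof_smul (L : E3 →ₗ[ℝ] E3) (c : ℝ) (x : E3) : cof L (c • x) = c • cof L x := by
  simp only [cof, PiLp.smul_apply, smul_eq_mul]; module

lemma map_decomp (L : E3 →ₗ[ℝ] E3) (a : E3) :
    L a = a 0 • L (e3 0) + a 1 • L (e3 1) + a 2 • L (e3 2) := by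
  conv_lhs => rw [decomp3 a]
  simp

lemma cross3_map (L : E3 →ₗ[ℝ] E3) (a b : E3) : cross3 (L a) (L b) = cof L (cross3 a b) := by
  rw [map_decomp L a, map_decomp L b]
  apply ext3 <;> simp only [cof, cross3_zero, cross3_one, cross3_two, PiLp.smul_apply,
    PiLp.add_apply, smul_eq_mul] <;> ring

lemma inner_cof (L : E3 →ₗ[ℝ] E3) (x c : E3) :
    ⟪cof L x, L c⟫ = det3 (L (e3 0)) (L (e3 1)) (L (e3 2)) * ⟪x, c⟫ := by
  rw [map_decomp L c]
  simp only [cof, inner3, det3, cross3_zero, cross3_one, cross3_two, PiLp.smul_apply,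
    PiLp.add_apply, smul_eq_mul]
  ring

lemma det_map_ne_zero (L : E3 →ₗ[ℝ] E3) (hL : Function.Bijective L) :
    det3 (L (e3 0)) (L (e3 1)) (L (e3 2)) ≠ 0 := by
  intro h0
  obtain ⟨a, ha⟩ := hL.2 (e3 0)
  obtain ⟨b, hb⟩ := hL.2 (e3 1)
  obtain ⟨c, hc⟩ := hL.2 (e3 2)
  have := inner_cof L (cross3 a b) c
  rw [h0, ← cross3_map, ha, hb, hc, inner_cross3] at this
  simp [det3, e3] at this

lemma cof_injective (L : E3 →ₗ[ℝ] E3) (hL : Function.Bijective L) :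
    Function.Injective (cof L) := by
  intro x y hxy
  have key : ∀ c, ⟪x, c⟫ = ⟪y, c⟫ := by
    intro c
    have h1 := inner_cof L x c
    rw [hxy, inner_cof] at h1
    exact (mul_left_cancel₀ (det_map_ne_zero L hL) h1).symm
  exact ext_inner_right ℝ key

lemma det3_map (L : E3 →ₗ[ℝ] E3) (a b c : E3) :
    det3 (L a) (L b) (L c) = det3 (L (e3 0)) (L (e3 1)) (L (e3 2)) * det3 a b c := by
  rw [← inner_cross3, cross3_map, inner_cof, inner_cross3]

/-- normalisation -/
def nrm (x : E3) : E3 := ‖x‖⁻¹ • x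

lemma nrm_pos_smul {c : ℝ} (hc : 0 < c) (x : E3) : nrm (c • x) = nrm x := by
  unfold nrm
  rw [norm_smul, smul_smul, Real.norm_of_nonneg hc.le]
  congr 1
  field_simp

lemma starUN_eq {n : ℕ} (v : E3) (w : ZMod n → E3) (i : ZMod n) :
    starUN v w i = nrm (starFN v w i) := rfl

lemma nrm_norm {x : E3} (hx : x ≠ 0) : ‖nrm x‖ = 1 := by
  unfold nrm
  rw [norm_smul, norm_inv, norm_norm, inv_mul_cancel₀ (norm_ne_zero_iff.2 hx)]

lemma nrm_nrm (x : E3) : nrm (nrm x) = nrm x := by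
  by_cases hx : x = 0
  · simp [nrm, hx]
  · exact nrm_pos_smul (inv_pos.2 (norm_pos_iff.2 hx)) x

/-- the induced map on the sphere -/
def phi (L : E3 →ₗ[ℝ] E3) (x : E3) : E3 := nrm (cof L x)

lemma cof_zero (L : E3 →ₗ[ℝ] E3) : cof L 0 = 0 := by simp [cof]

lemma cof_ne_zero (L : E3 →ₗ[ℝ] E3) (hL : Function.Bijective L) {x : E3} (hx : x ≠ 0) :
    cof L x ≠ 0 := fun h => hx (cof_injective L hL (h.trans (cof_zero L).symm))

lemma phi_injOn (L : E3 →ₗ[ℝ] E3) (hL : Function.Bijective L) :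
    Set.InjOn (phi L) {x | nrm x = x} := by
  intro x hx y hy hxy
  simp only [Set.mem_ofPred_eq] at hx hy
  by_cases h0 : x = 0
  · by_cases h1 : y = 0
    · rw [h0, h1]
    · exfalso
      have := nrm_norm (cof_ne_zero L hL h1)
      rw [show nrm (cof L y) = phi L y from rfl, ← hxy, h0] at this
      simp [phi, cof_zero, nrm] at this
  by_cases h1 : y = 0
  · exfalso
    have := nrm_norm (cof_ne_zero L hL h0)
    rw [show nrm (cof L x) = phi L x from rfl, hxy, h1] at this
    simp [phi, cof_zero, nrm] at this
  have hx' := norm_pos_iff.2 (cof_ne_zero L hL h0)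
  have hy' := norm_pos_iff.2 (cof_ne_zero L hL h1)
  unfold phi nrm at hxy
  rw [← cof_smul, ← cof_smul] at hxy
  have h2 := cof_injective L hL hxy
  have h3 : nrm (‖cof L x‖⁻¹ • x) = nrm (‖cof L y‖⁻¹ • y) := by rw [h2]
  rwa [nrm_pos_smul (inv_pos.2 hx'), nrm_pos_smul (inv_pos.2 hy'), hx, hy] at h3

lemma phi_nrm (L : E3 →ₗ[ℝ] E3) (x : E3) : phi L (nrm x) = phi L x := by
  by_cases hx : x = 0
  · simp [nrm, hx]
  · unfold phi
    have h1 : cof L (nrm x) = ‖x‖⁻¹ • cof L x := cof_smul L _ x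
    rw [h1]
    exact nrm_pos_smul (inv_pos.2 (norm_pos_iff.2 hx)) _

lemma sArc_eq (p q : E3) : sArc p q =
    {x | ∃ s t : ℝ, 0 ≤ s ∧ 0 ≤ t ∧ 0 < s + t ∧ x = nrm (s • p + t • q)} := rfl

lemma sArc_subset (p q : E3) : sArc p q ⊆ {x | nrm x = x} := by
  rintro x ⟨s, t, _, _, _, rfl⟩
  exact nrm_nrm _

/-- Arcs only depend on the rays of the end points. -/
lemma sArc_pos_smul (p q : E3) {c d : ℝ} (hc : 0 < c) (hd : 0 < d) :
    sArc (c • p) (d • q) = sArc p q := by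
  have key : ∀ (p q : E3) {c d : ℝ} (_ : 0 < c) (_ : 0 < d),
      sArc (c • p) (d • q) ⊆ sArc p q := by
    rintro p q c d hc hd x ⟨s, t, hs, ht, hst, rfl⟩
    refine ⟨s * c, t * d, by positivity, by positivity, ?_, ?_⟩
    · rcases hs.lt_or_eq with h | h
      · have := mul_pos h hc
        have := mul_nonneg ht hd.le
        linarith
      · have : 0 < t := by linarith
        have := mul_pos this hd
        rw [← h]; linarith
    · simp only [smul_smul]
  apply Set.Subset.antisymm (key p q hc hd)
  have := key (c • p) (d • q) (inv_pos.2 hc) (inv_pos.2 hd)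
  rwa [smul_smul, smul_smul, inv_mul_cancel₀ hc.ne', inv_mul_cancel₀ hd.ne', one_smul,
    one_smul] at this

lemma sArc_nrm {p q : E3} (hp : p ≠ 0) (hq : q ≠ 0) : sArc (nrm p) (nrm q) = sArc p q :=
  sArc_pos_smul p q (inv_pos.2 (norm_pos_iff.2 hp)) (inv_pos.2 (norm_pos_iff.2 hq))

lemma phi_sArc (L : E3 →ₗ[ℝ] E3) (p q : E3) :
    phi L '' sArc p q = sArc (cof L p) (cof L q) := by
  ext x
  constructor
  · rintro ⟨y, ⟨s, t, hs, ht, hst, rfl⟩, rfl⟩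
    refine ⟨s, t, hs, ht, hst, ?_⟩
    change phi L (nrm (s • p + t • q)) = nrm _
    rw [phi_nrm, phi, cof_add, cof_smul, cof_smul]
  · rintro ⟨s, t, hs, ht, hst, rfl⟩
    refine ⟨_, ⟨s, t, hs, ht, hst, rfl⟩, ?_⟩
    change phi L (nrm (s • p + t • q)) = nrm _
    rw [phi_nrm, phi, cof_add, cof_smul, cof_smul]

section transfer
variable {n : ℕ} (v : E3) (w : ZMod n → E3) (L : E3 →ₗ[ℝ] E3) (t : E3)

lemma starFN_map (i : ZMod n) :
    starFN (L v + t) (fun i => L (w i) + t) i = cof L (starFN v w i) := by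
  unfold starFN
  rw [← cross3_map]
  simp

lemma starUN_map (i : ZMod n) :
    starUN (L v + t) (fun i => L (w i) + t) i = phi L (starUN v w i) := by
  rw [starUN_eq, starFN_map, starUN_eq, phi_nrm]; rfl

lemma starFace_map (i : ZMod n) :
    starFace (L v + t) (fun i => L (w i) + t) i = (fun x => L x + t) '' starFace v w i := by
  unfold starFace
  have h1 : (fun x => L x + t) = ⇑(L.toAffineMap + AffineMap.const ℝ E3 t) := by
    ext; simp
  rw [h1, AffineMap.image_convexHull, ← h1]
  congr 1
  simp [Set.image_insert_eq]

lemma segment_map (x y : E3) :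
    segment ℝ (L x + t) (L y + t) = (fun x => L x + t) '' segment ℝ x y := by
  have h1 : (fun x => L x + t) = ⇑(L.toAffineMap + AffineMap.const ℝ E3 t) := by
    ext; simp
  rw [h1, ← convexHull_pair, ← convexHull_pair, AffineMap.image_convexHull, ← h1]
  simp [Set.image_insert_eq]

lemma starFN_ne_zero (h : IsStar v w) (i : ZMod n) : starFN v w i ≠ 0 :=
  cross3_ne_zero (h.2.1 i)

lemma phi_neg (x : E3) : phi L (-x) = - phi L x := by
  have : cof L (-x) = - cof L x := by
    have := cof_smul L (-1) x
    simpa using this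
  unfold phi nrm
  rw [this]; simp

theorem isStar_map (hL : Function.Bijective L) (h : IsStar v w) :
    IsStar (L v + t) (fun i => L (w i) + t) := by
  have hinj : Function.Injective (fun x => L x + t) := fun x y hxy =>
    hL.1 (add_right_cancel hxy)
  refine ⟨h.1, ?_, ?_, ?_⟩
  · intro i
    apply linInd_of_cross3_ne_zero
    change starFN (L v + t) (fun i => L (w i) + t) i ≠ 0
    rw [starFN_map]
    exact cof_ne_zero L hL (starFN_ne_zero v w h i)
  · intro i
    have hm : ∀ i, nrm (starUN v w i) = starUN v w i := fun i => nrm_nrm _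
    have hm' : ∀ i, nrm (-starUN v w i) = -starUN v w i := fun i => by
      conv_rhs => rw [← hm i]
      simp [nrm]
    rw [starUN_map, starUN_map]
    constructor
    · intro he
      exact (h.2.2.1 i).1 (phi_injOn L hL (hm _) (hm _) he)
    · rw [← phi_neg]
      intro he
      exact (h.2.2.1 i).2 (phi_injOn L hL (hm _) (hm' _) he)
  · intro i j hij
    obtain ⟨h1, h2, h3⟩ := h.2.2.2 i j hij
    rw [starFace_map, starFace_map, ← Set.image_inter hinj]
    refine ⟨fun e => ?_, fun e => ?_, fun e e' => ?_⟩
    · rw [h1 e, segment_map]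
    · rw [h2 e, segment_map]
    · rw [h3 e e', Set.image_singleton]

theorem gaussEmb_map (hL : Function.Bijective L) (h : IsStar v w) (hG : GaussEmb v w) :
    GaussEmb (L v + t) (fun i => L (w i) + t) := by
  have hm : ∀ i, nrm (starUN v w i) = starUN v w i := fun i => nrm_nrm _
  have harc : ∀ i, sArc (starUN (L v + t) (fun i => L (w i) + t) i)
      (starUN (L v + t) (fun i => L (w i) + t) (i + 1)) =
      phi L '' sArc (starUN v w i) (starUN v w (i + 1)) := by
    intro i
    rw [starUN_eq, starUN_eq, starUN_eq, starUN_eq, starFN_map, starFN_map, sArc_nrm, sArc_nrm,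
      phi_sArc]
    any_goals exact starFN_ne_zero v w h _
    all_goals exact cof_ne_zero L hL (starFN_ne_zero v w h _)
  refine ⟨?_, ?_⟩
  · intro i j hij
    rw [starUN_map, starUN_map] at hij
    exact hG.1 (phi_injOn L hL (hm _) (hm _) hij)
  · intro i j hij
    obtain ⟨h1, h2, h3⟩ := hG.2 i j hij
    rw [harc, harc, ← (phi_injOn L hL).image_inter (sArc_subset _ _) (sArc_subset _ _)]
    refine ⟨fun e => ?_, fun e => ?_, fun e e' => ?_⟩
    · rw [h1 e, Set.image_singleton, starUN_map]
    · rw [h2 e, Set.image_singleton, starUN_map]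
    · rw [h3 e e', Set.image_empty]

end transfer

end Stmt11

namespace Stmt11
open InnerProductGeometry

lemma angle_add_of_cone {x y z : E3} {a b : ℝ} (ha : 0 ≤ a) (hb : 0 ≤ b) (hy : y ≠ 0)
    (h : y = a • x + b • z) : angle x z = angle x y + angle y z := by
  apply angle_eq_angle_add_add_angle_add_of_mem_span hy
  rw [Submodule.mem_span_pair]
  exact ⟨⟨a, ha⟩, ⟨b, hb⟩, h.symm⟩

lemma angle_lt_of_det {x y z : E3} (h : det3 x y z ≠ 0) :
    angle x z < angle x y + angle y z := by
  have hy : y ≠ 0 := by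
    rintro rfl; apply h; simp [det3]
  refine lt_of_le_of_ne (angle_le_angle_add_angle x y z) ?_
  intro he
  rw [angle_eq_angle_add_angle_iff hy] at he
  apply h
  rcases he with he | he
  · obtain ⟨_, r, _, rfl⟩ := angle_eq_pi_iff.1 he
    simp [det3]; ring
  · rw [Submodule.mem_span_pair] at he
    obtain ⟨a, b, rfl⟩ := he
    simp [det3, NNReal.smul_def]; ring

lemma chain_le (u : ℕ → E3) (h0 : u 0 ≠ 0) (k : ℕ) :
    angle (u 0) (u k) ≤ ∑ i ∈ Finset.range k, angle (u i) (u (i + 1)) := by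
  induction k with
  | zero => simp [angle_self h0]
  | succ k ih =>
    rw [Finset.sum_range_succ]
    linarith [angle_le_angle_add_angle (u 0) (u k) (u (k + 1))]

/-- perimeter of the closed spherical polygon `u 0, …, u k` -/
def per (u : ℕ → E3) (k : ℕ) : ℝ :=
  ∑ i ∈ Finset.range k, angle (u i) (u (i + 1)) + angle (u k) (u 0)

/-- merging the last two vertices `u (k+1)`, `u (k+2)` into `x` -/
lemma per_merge (u : ℕ → E3) (k : ℕ) (x : E3) {a b : ℝ} (ha : 0 ≤ a) (hb : 0 ≤ b) (hx : x ≠ 0)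
    (h : x = a • u (k + 1) + b • u (k + 2)) :
    per (Function.update u (k + 1) x) (k + 1) + (angle (u k) (u (k + 1)) + angle (u (k + 1)) x
      - angle (u k) x) ≤ per u (k + 2) := by
  unfold per
  rw [Finset.sum_range_succ, Finset.sum_range_succ, Finset.sum_range_succ]
  have h1 : ∑ i ∈ Finset.range k, angle (Function.update u (k + 1) x i)
      (Function.update u (k + 1) x (i + 1)) = ∑ i ∈ Finset.range k, angle (u i) (u (i + 1)) := by
    apply Finset.sum_congr rfl
    intro i hi
    have := Finset.mem_range.1 hi
    rw [Function.update_of_ne (by omega), Function.update_of_ne (by omega)]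
  rw [h1, Function.update_of_ne (show k ≠ k + 1 by omega), Function.update_self,
    Function.update_of_ne (show 0 ≠ k + 1 by omega)]
  have h2 := angle_add_of_cone ha hb hx h
  have h3 := angle_le_angle_add_angle x (u (k + 2)) (u 0)
  rw [show k + 1 + 1 = k + 2 from rfl]
  linarith

lemma sum_merge (u : ℕ → E3) (l : ℕ → ℝ) (k : ℕ) (x : E3) (m : ℝ)
    (h : m • x = l k • u k + l (k + 1) • u (k + 1)) :
    ∑ i ∈ Finset.range (k + 1), Function.update l k m i • Function.update u k x i =
    ∑ i ∈ Finset.range (k + 2), l i • u i := by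
  rw [Finset.sum_range_succ, Finset.sum_range_succ, Finset.sum_range_succ, Function.update_self,
    Function.update_self, h, add_assoc]
  congr 1
  apply Finset.sum_congr rfl
  intro i hi
  have := Finset.mem_range.1 hi
  rw [Function.update_of_ne (by omega), Function.update_of_ne (by omega)]

lemma fenchel_weak (k : ℕ) : ∀ (u : ℕ → E3) (l : ℕ → ℝ), (∀ i ≤ k, u i ≠ 0) → (∀ i ≤ k, 0 ≤ l i) →
    (∃ i ≤ k, 0 < l i) → ∑ i ∈ Finset.range (k + 1), l i • u i = 0 →
    2 * Real.pi ≤ per u k := by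
  induction k with
  | zero =>
    intro u l hu hl ⟨i, hi, hli⟩ hs
    exfalso
    obtain rfl : i = 0 := by omega
    simp at hs
    rcases hs with hs | hs
    · exact hli.ne' hs
    · exact hu 0 le_rfl hs
  | succ k ih =>
    intro u l hu hl ⟨i, hi, hli⟩ hs
    by_cases hanti : angle (u k) (u (k + 1)) = Real.pi
    · -- antipodal consecutive vertices
      unfold per
      rw [Finset.sum_range_succ, hanti]
      have h1 := chain_le u (hu 0 (by omega)) k
      have h2 := angle_le_angle_add_angle (u (k + 1)) (u 0) (u k)
      rw [angle_comm (u (k+1)) (u k), hanti] at h2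
      linarith
    · obtain ⟨x, m, a, b, hx, hm, ha, hb, hxab, hmx, hpos⟩ : ∃ (x : E3) (m a b : ℝ), x ≠ 0 ∧ 0 ≤ m ∧
          0 ≤ a ∧ 0 ≤ b ∧ x = a • u k + b • u (k + 1) ∧
          m • x = l k • u k + l (k + 1) • u (k + 1) ∧ (0 < l k ∨ 0 < l (k + 1) → 0 < m) := by
        by_cases hz : l k = 0 ∧ l (k + 1) = 0
        · refine ⟨u k, 0, 1, 0, hu k (by omega), le_rfl, zero_le_one, le_rfl, by simp, ?_, ?_⟩
          · simp [hz.1, hz.2]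
          · rw [hz.1, hz.2]; simp
        · refine ⟨l k • u k + l (k + 1) • u (k + 1), 1, l k, l (k + 1), ?_, zero_le_one,
            hl k (by omega), hl _ le_rfl, rfl, by simp, fun _ => one_pos⟩
          intro h0
          have huk := hu k (by omega)
          have huk1 := hu (k + 1) le_rfl
          have h1 : 0 < l k := by
            rcases (hl k (by omega)).lt_or_eq with h | h
            · exact h
            · rw [← h] at h0
              simp [huk1] at h0
              exact absurd ⟨h.symm, h0⟩ hz
          have h2 : 0 < l (k + 1) := by
            rcases (hl (k + 1) le_rfl).lt_or_eq with h | h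
            · exact h
            · rw [← h] at h0
              simp [huk] at h0
              exact absurd ⟨h0, h.symm⟩ hz
          apply hanti
          rw [angle_eq_pi_iff]
          refine ⟨huk, -(l k / l (k + 1)), by simp only [Left.neg_neg_iff]; positivity, ?_⟩
          have h3 : l (k + 1) • u (k + 1) = - (l k • u k) := by
            rw [eq_neg_iff_add_eq_zero, add_comm]; exact h0
          rw [neg_smul, div_eq_inv_mul, ← smul_smul, ← smul_neg, ← h3, smul_smul,
            inv_mul_cancel₀ h2.ne', one_smul]
      have hrec := ih (Function.update u k x) (Function.update l k m) ?_ ?_ ?_ ?_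
      · cases k with
        | zero =>
          exfalso
          unfold per at hrec
          simp [angle_self hx] at hrec
          linarith [Real.pi_pos]
        | succ k =>
          have := per_merge u k x ha hb hx hxab
          linarith [angle_le_angle_add_angle (u k) (u (k + 1)) x]
      · intro j hj
        by_cases hjk : j = k
        · rw [hjk, Function.update_self]; exact hx
        · rw [Function.update_of_ne hjk]; exact hu j (by omega)
      · intro j hj
        by_cases hjk : j = k
        · rw [hjk, Function.update_self]; exact hm
        · rw [Function.update_of_ne hjk]; exact hl j (by omega)
      · by_cases hik : i < k
        · exact ⟨i, hik.le, by rw [Function.update_of_ne hik.ne]; exact hli⟩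
        · refine ⟨k, le_rfl, ?_⟩
          rw [Function.update_self]
          apply hpos
          have : i = k ∨ i = k + 1 := by omega
          rcases this with rfl | rfl <;> simp [hli]
      · rw [sum_merge u l k x m hmx]; exact hs

lemma fenchel_strict (k : ℕ) (u : ℕ → E3) (l : ℕ → ℝ) (hu : ∀ i, u i ≠ 0)
    (hl : ∀ i, 0 ≤ l i) (hlast : 0 < l (k + 2))
    (hdet : det3 (u k) (u (k + 1)) (u (k + 2)) ≠ 0)
    (hs : ∑ i ∈ Finset.range (k + 3), l i • u i = 0) :
    2 * Real.pi < per u (k + 2) := by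
  set x := l (k + 1) • u (k + 1) + l (k + 2) • u (k + 2) with hxdef
  have hdx : det3 (u k) (u (k + 1)) x ≠ 0 := by
    have : det3 (u k) (u (k + 1)) x = l (k + 2) * det3 (u k) (u (k + 1)) (u (k + 2)) := by
      rw [hxdef]; simp [det3]; ring
    rw [this]
    exact mul_ne_zero hlast.ne' hdet
  have hx : x ≠ 0 := by
    intro h; rw [h] at hdx; simp [det3] at hdx
  have h1 := per_merge u k x (hl _) (hl _) hx hxdef
  have h2 := angle_lt_of_det hdx
  have h3 := fenchel_weak (k + 1) (Function.update u (k + 1) x) (Function.update l (k + 1) 1)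
    ?_ ?_ ?_ ?_
  · linarith
  · intro j hj
    by_cases hjk : j = k + 1
    · rw [hjk, Function.update_self]; exact hx
    · rw [Function.update_of_ne hjk]; exact hu j
  · intro j hj
    by_cases hjk : j = k + 1
    · rw [hjk, Function.update_self]; exact zero_le_one
    · rw [Function.update_of_ne hjk]; exact hl j
  · exact ⟨k + 1, le_rfl, by simp⟩
  · rw [sum_merge u l (k + 1) x 1 (by rw [one_smul])]; exact hs

/-! ### cyclic sums -/

lemma sum_zmod {M : Type*} [AddCommMonoid M] {n : ℕ} [NeZero n] (a : ZMod n) (f : ZMod n → M) :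
    ∑ i, f i = ∑ k ∈ Finset.range n, f (a + (k : ZMod n)) := by
  rw [← Equiv.sum_comp (Equiv.addLeft a) f]
  symm
  apply Finset.sum_nbij' (fun k : ℕ => (k : ZMod n)) (fun i : ZMod n => i.val)
  · intro k _; simp
  · intro i _; simp [ZMod.val_lt]
  · intro k hk; exact ZMod.val_cast_of_lt (Finset.mem_range.1 hk)
  · intro i _; simp
  · intro k _; simp

lemma sum_angle_eq_per {n : ℕ} [NeZero n] (u : ZMod n → E3) (a : ZMod n) (k : ℕ) (hk : n = k + 1) :
    ∑ i, angle (u i) (u (i + 1)) = per (fun j => u (a + (j : ZMod n))) k := by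
  rw [sum_zmod a]
  unfold per
  have h1 : (((k + 1 : ℕ) : ZMod n)) = 0 := by rw [← hk]; exact ZMod.natCast_self n
  have h2 : ∀ j : ℕ, a + (j : ZMod n) + 1 = a + ((j + 1 : ℕ) : ZMod n) := by
    intro j; push_cast; ring
  have h3 : Finset.range n = Finset.range (k + 1) := by rw [hk]
  rw [h3, Finset.sum_range_succ]
  simp only [h2, h1]
  simp

theorem sum_angle_gt {n : ℕ} [NeZero n] (hn : 3 ≤ n) (u : ZMod n → E3)
    (hdet : ∀ i, det3 (u i) (u (i + 1)) (u (i + 2)) ≠ 0)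
    (l : ZMod n → ℝ) (hl : ∀ i, 0 ≤ l i) (hpos : ∃ i, 0 < l i) (hs : ∑ i, l i • u i = 0) :
    2 * Real.pi < ∑ i, angle (u i) (u (i + 1)) := by
  obtain ⟨i0, hi0⟩ := hpos
  obtain ⟨k, rfl⟩ : ∃ k, n = k + 3 := ⟨n - 3, by omega⟩
  rw [sum_angle_eq_per u (i0 + 1) (k + 2) rfl]
  have h1 : (((k + 2 : ℕ) : ZMod (k + 3))) = -1 := by
    have := ZMod.natCast_self (k + 3)
    push_cast at this ⊢
    linear_combination this
  apply fenchel_strict k _ (fun j => l (i0 + 1 + (j : ZMod (k + 3))))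
  · intro i h0
    apply hdet (i0 + 1 + (i : ZMod (k + 3)))
    rw [h0]; simp [det3]
  · intro i; exact hl _
  · rw [h1]; simpa using hi0
  · have := hdet (i0 + 1 + (k : ZMod (k + 3)))
    convert this using 3 <;> push_cast <;> ring
  · rw [← hs, sum_zmod (i0 + 1)]

end Stmt11

namespace Stmt11
open InnerProductGeometry

/-- intersection of the line `p q` with the plane through `e` and `z` -/
def hitPt (e z p q : E3) : E3 := det3 e z p • q - det3 e z q • p

lemma hitPt_rel (e z p q r : E3) :
    det3 p q e • hitPt e z q r = det3 q r e • hitPt e z p q + (det3 e z q * det3 p q r) • e := by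
  unfold hitPt
  apply ext3 <;> simp only [det3, PiLp.smul_apply, PiLp.add_apply, PiLp.sub_apply, smul_eq_mul]
    <;> ring

lemma hitPt_ne_zero {e z p q : E3} (hpq : cross3 p q ≠ 0) (hp : det3 e z p ≠ 0) :
    hitPt e z p q ≠ 0 := by
  intro h
  have := LinearIndependent.pair_iff.1 (linInd_of_cross3_ne_zero hpq) (-det3 e z q) (det3 e z p)
    (by rw [← h, hitPt]; module)
  exact hp this.2

lemma hitPt_ne_zero' {e z p q : E3} (hpq : cross3 p q ≠ 0) (hp : det3 e z q ≠ 0) :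
    hitPt e z p q ≠ 0 := by
  intro h
  have := LinearIndependent.pair_iff.1 (linInd_of_cross3_ne_zero hpq) (-det3 e z q) (det3 e z p)
    (by rw [← h, hitPt]; module)
  exact hp (by linarith [this.1])

lemma cross3_ne_zero_of_det {p q r : E3} (h : det3 p q r ≠ 0) : cross3 p q ≠ 0 := by
  intro h0
  rw [← inner_cross3, h0, inner_zero_left] at h
  exact h rfl

/-- A convex spherical polygon has perimeter less than `2π`. -/
lemma convex_per (M : ℕ) (p : ℕ → E3)
    (h : ∀ j ≤ M + 1, ∀ i ≤ M + 2, i ≠ j → i ≠ j + 1 → 0 < det3 (p j) (p (j + 1)) (p i))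
    (hc : ∀ i ≤ M + 2, i ≠ 0 → i ≠ M + 2 → 0 < det3 (p (M + 2)) (p 0) (p i)) :
    per p (M + 2) < 2 * Real.pi := by
  set e := p (M + 2) with he
  set x : ℕ → E3 := fun j => hitPt e (p 0) (p j) (p (j + 1)) with hx
  have hp0 : det3 e (p 0) (p 0) = 0 := by simp [det3]; ring
  have hpe : det3 e (p 0) e = 0 := by simp [det3]; ring
  have hynn : ∀ i ≤ M + 2, 0 ≤ det3 e (p 0) (p i) := by
    intro i hi
    by_cases h0 : i = 0
    · rw [h0, hp0]
    by_cases h1 : i = M + 2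
    · rw [h1, hpe]
    exact (hc i hi h0 h1).le
  have hcr : ∀ j ≤ M + 1, cross3 (p j) (p (j + 1)) ≠ 0 := by
    intro j hj
    by_cases h0 : j = 0
    · exact cross3_ne_zero_of_det (h j hj 2 (by omega) (by omega) (by omega)).ne'
    · exact cross3_ne_zero_of_det (h j hj 0 (by omega) (by omega) (by omega)).ne'
  have hpne : ∀ j ≤ M + 2, p j ≠ 0 := by
    intro j hj h0
    by_cases hj2 : j = M + 2
    · have := h 0 (by omega) j hj (by omega) (by omega)
      rw [h0] at this; simp [det3] at this
    · have := hcr j (by omega)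
      rw [h0] at this
      apply this
      apply ext3 <;> simp [cross3_zero, cross3_one, cross3_two]
  have hxne : ∀ j ≤ M + 1, x j ≠ 0 := by
    intro j hj
    by_cases h0 : j = 0
    · apply hitPt_ne_zero' (hcr j hj)
      exact (hc (j + 1) (by omega) (by omega) (by omega)).ne'
    · apply hitPt_ne_zero (hcr j hj)
      exact (hc j (by omega) h0 (by omega)).ne'
  have step : ∀ j ≤ M, angle (x j) e = angle (x j) (x (j + 1)) + angle (x (j + 1)) e ∧
      angle (p (j + 1)) (x (j + 1)) =
        angle (p (j + 1)) (p (j + 2)) + angle (p (j + 2)) (x (j + 1)) := by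
    intro j hj
    constructor
    · have hg : 0 < det3 (p j) (p (j + 1)) e := h j (by omega) (M + 2) le_rfl (by omega) (by omega)
      have hf : 0 ≤ det3 (p (j + 1)) (p (j + 2)) e := by
        by_cases hjM : j = M
        · have : det3 (p (j + 1)) (p (j + 2)) e = 0 := by
            rw [hjM]; simp [det3, he]; ring
          rw [this]
        · exact (h (j + 1) (by omega) (M + 2) le_rfl (by omega) (by omega)).le
      have hy := hc (j + 1) (by omega) (by omega) (by omega)
      have hD := h j (by omega) (j + 2) (by omega) (by omega) (by omega)
      apply angle_add_of_cone (a := (det3 (p j) (p (j + 1)) e)⁻¹ * det3 (p (j + 1)) (p (j + 2)) e)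
        (b := (det3 (p j) (p (j + 1)) e)⁻¹ *
          (det3 e (p 0) (p (j + 1)) * det3 (p j) (p (j + 1)) (p (j + 2))))
        (by positivity) (by positivity) (hxne (j + 1) (by omega))
      have := hitPt_rel e (p 0) (p j) (p (j + 1)) (p (j + 2))
      rw [← smul_smul, ← smul_smul, ← smul_add, ← this, smul_smul, inv_mul_cancel₀ hg.ne',
        one_smul]
    · have hy := hc (j + 1) (by omega) (by omega) (by omega)
      have hy2 := hynn (j + 2) (by omega)
      apply angle_add_of_cone (a := (det3 e (p 0) (p (j + 1)))⁻¹ * det3 e (p 0) (p (j + 2)))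
        (b := (det3 e (p 0) (p (j + 1)))⁻¹) (by positivity) (by positivity) (hpne _ (by omega))
      simp only [hx, hitPt]
      rw [← smul_smul, ← smul_add, add_sub_cancel, smul_smul, inv_mul_cancel₀ hy.ne', one_smul]
  have strict0 : angle (p 1) (x 1) < angle (p 1) (x 0) + angle (x 0) (x 1) := by
    apply angle_lt_of_det
    have h1 := hc 1 (by omega) (by omega) (by omega)
    have hD := h 0 (by omega) 2 (by omega) (by omega) (by omega)
    have : det3 (p 1) (x 0) (x 1) = det3 e (p 0) (p 1) ^ 2 * det3 (p 0) (p 1) (p 2) := by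
      simp only [hx, hitPt, hp0]
      generalize det3 e (p 0) (p 1) = y1
      generalize det3 e (p 0) (p (1 + 1)) = y2
      simp [det3]; ring
    rw [this]; positivity
  have main : ∀ j ≤ M, ∑ i ∈ Finset.range (j + 1), angle (p (i + 1)) (p (i + 2)) +
      angle (p (j + 2)) (x (j + 1)) + angle (x (j + 1)) e < angle (p 1) (x 0) + angle (x 0) e := by
    intro j
    induction j with
    | zero =>
      intro _
      obtain ⟨h1, h2⟩ := step 0 (by omega)
      simp only [zero_add, Finset.sum_range_one] at h1 h2 ⊢
      linarith
    | succ j ih =>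
      intro hj
      have := ih (by omega)
      obtain ⟨h1, h2⟩ := step (j + 1) hj
      rw [Finset.sum_range_succ]
      have h3 := angle_le_angle_add_angle (p (j + 2)) (x (j + 1)) (x (j + 2))
      simp only [show j + 1 + 1 = j + 2 from rfl, show j + 1 + 2 = j + 3 from rfl] at *
      linarith
  have hfin := main M le_rfl
  have hx0 : x 0 = -(det3 e (p 0) (p 1) • p 0) := by
    simp [hx, hitPt, hp0]
  have h1 := hc 1 (by omega) (by omega) (by omega)
  rw [hx0, ← smul_neg, angle_smul_right_of_pos _ _ h1, angle_smul_left_of_pos _ _ h1,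
    angle_neg_right, angle_neg_left, angle_comm (p 1)] at hfin
  unfold per
  rw [Finset.sum_range_succ', angle_comm (p (M + 2)) (p 0)]
  have a1 := angle_nonneg (p (M + 2)) (x (M + 1))
  have a2 := angle_nonneg (x (M + 1)) e
  simp only [zero_add, he] at *
  linarith

theorem sum_angle_lt {n : ℕ} [NeZero n] (hn : 3 ≤ n) (u : ZMod n → E3)
    (hdet : ∀ i j, j ≠ i → j ≠ i + 1 → 0 < det3 (u i) (u (i + 1)) (u j)) :
    ∑ i, angle (u i) (u (i + 1)) < 2 * Real.pi := by
  obtain ⟨k, rfl⟩ : ∃ k, n = k + 3 := ⟨n - 3, by omega⟩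
  rw [sum_angle_eq_per u 0 (k + 2) rfl]
  have hne : ∀ i j : ℕ, i < k + 3 → j < k + 3 → i ≠ j → (i : ZMod (k + 3)) ≠ j := by
    intro i j hi hj hij h
    have := congrArg ZMod.val h
    rw [ZMod.val_cast_of_lt hi, ZMod.val_cast_of_lt hj] at this
    exact hij this
  have hlast : ((k + 2 : ℕ) : ZMod (k + 3)) + 1 = 0 := by
    have := ZMod.natCast_self (k + 3)
    push_cast at this ⊢
    linear_combination this
  apply convex_per
  · intro j hj i hi h1 h2
    simp only [zero_add]
    have := hdet j i (hne _ _ (by omega) (by omega) h1)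
      (by have := hne i (j + 1) (by omega) (by omega) h2; simpa using this)
    simpa using this
  · intro i hi h1 h2
    simp only [zero_add, Nat.cast_zero]
    have := hdet (k + 2 : ℕ) i (hne _ _ (by omega) (by omega) h2)
      (by rw [hlast]; have := hne i 0 (by omega) (by omega) h1; simpa using this)
    rwa [hlast] at this

theorem sum_angle_lt' {n : ℕ} [NeZero n] (hn : 3 ≤ n) (u : ZMod n → E3) (s : ℝ)
    (hdet : ∀ i j, j ≠ i → j ≠ i + 1 → 0 < s * det3 (u i) (u (i + 1)) (u j)) :
    ∑ i, angle (u i) (u (i + 1)) < 2 * Real.pi := by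
  rcases lt_trichotomy s 0 with hs | hs | hs
  · have := sum_angle_lt hn (fun i => - u i) (fun i j h1 h2 => by
      have : det3 (u i) (u (i + 1)) (u j) < 0 := by
        rcases mul_pos_iff.1 (hdet i j h1 h2) with h | h
        · linarith [h.1]
        · exact h.2
      have h3 : det3 (-u i) (-u (i + 1)) (-u j) = - det3 (u i) (u (i + 1)) (u j) := by
        simp [det3]; ring
      rw [h3]; linarith)
    simpa using this
  · exfalso
    obtain ⟨k, rfl⟩ : ∃ k, n = k + 3 := ⟨n - 3, by omega⟩
    have h2 : (2 : ZMod (k + 3)) ≠ 0 := by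
      intro h
      have := congrArg ZMod.val (show ((2 : ℕ) : ZMod (k + 3)) = 0 by exact_mod_cast h)
      rw [ZMod.val_cast_of_lt (by omega)] at this
      simp at this
    have h1 : (2 : ZMod (k + 3)) ≠ 0 + 1 := by
      intro h
      have := congrArg ZMod.val (show ((2 : ℕ) : ZMod (k + 3)) = ((1 : ℕ) : ZMod (k + 3)) by
        push_cast; simpa using h)
      rw [ZMod.val_cast_of_lt (by omega), ZMod.val_cast_of_lt (by omega)] at this
      omega
    have := hdet 0 2 h2 h1
    rw [hs] at this; simp at this
  · exact sum_angle_lt hn u (fun i j h1 h2 => (mul_pos_iff_of_pos_left hs).1 (hdet i j h1 h2))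

end Stmt11

namespace Stmt11
open Complex Filter Topology

/-- angle under which the segment from `p` to `q` is seen from `z` -/
def seen (p q z : ℂ) : ℝ := arg ((q - z) / (p - z))

lemma seen_slit {p q z : ℂ} (h : z ∉ segment ℝ p q) : (q - z) / (p - z) ∈ slitPlane := by
  by_contra hs
  apply h
  rw [mem_slitPlane_iff_not_le_zero, not_not] at hs
  obtain ⟨r, hr, hrz⟩ : ∃ r : ℝ, 0 ≤ r ∧ (q - z) / (p - z) = -(r : ℂ) := by
    refine ⟨-((q - z) / (p - z)).re, ?_, ?_⟩
    · have := (Complex.le_def.1 hs).1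
      simp only [zero_re] at this
      linarith
    · have h2 := (Complex.le_def.1 hs).2
      simp only [zero_im] at h2
      apply Complex.ext
      · simp
      · simp [h2]
  have hp : p - z ≠ 0 := by
    intro h0
    apply h
    have : z = p := by linear_combination -h0
    rw [this]; exact left_mem_segment ℝ p q
  rw [div_eq_iff hp] at hrz
  refine ⟨r / (1 + r), 1 / (1 + r), by positivity, by positivity, by field_simp; ring, ?_⟩
  have h1 : (1 + r : ℂ) ≠ 0 := by
    have : (1 + r : ℝ) ≠ 0 := by positivity
    exact_mod_cast this
  simp only [real_smul]
  push_cast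
  field_simp
  linear_combination hrz

lemma seen_continuousAt {p q z : ℂ} (h : z ∉ segment ℝ p q) : ContinuousAt (seen p q) z := by
  have hp : p - z ≠ 0 := by
    intro h0
    apply h
    have : z = p := by linear_combination -h0
    rw [this]; exact left_mem_segment ℝ p q
  unfold seen
  have h1 : ContinuousAt (fun z => (q - z) / (p - z)) z := by
    apply ContinuousAt.div _ _ hp <;> fun_prop
  exact ContinuousAt.comp (f := fun z => (q - z) / (p - z)) (continuousAt_arg (seen_slit h)) h1

lemma seen_coe {p q z : ℂ} (hp : z ≠ p) (hq : z ≠ q) :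
    ((seen p q z : ℝ) : Real.Angle) = (arg (q - z) : Real.Angle) - (arg (p - z) : Real.Angle) :=
  arg_div_coe_angle (sub_ne_zero.2 hq.symm) (sub_ne_zero.2 hp.symm)

lemma seen_below {p q z : ℂ} (hp : z.im < p.im) (hq : z.im < q.im) :
    seen p q z = arg (q - z) - arg (p - z) := by
  have h1 := seen_coe (p := p) (q := q) (z := z) (by rintro rfl; exact lt_irrefl _ hp)
    (by rintro rfl; exact lt_irrefl _ hq)
  have hargs : ∀ x : ℂ, z.im < x.im → 0 < arg (x - z) ∧ arg (x - z) < Real.pi := by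
    intro x hx
    have : 0 < (x - z).im := by simp; exact hx
    constructor
    · have h0 := arg_nonneg_iff.2 this.le
      refine lt_of_le_of_ne h0 (fun h => ?_)
      have := (arg_eq_zero_iff.1 h.symm).2
      linarith
    · exact arg_lt_pi_iff.2 (Or.inr this.ne')
  have a1 := hargs p hp
  have a2 := hargs q hq
  rw [← Real.Angle.coe_sub] at h1
  have h2 := congrArg Real.Angle.toReal h1
  have e1 : ((arg (q - z) - arg (p - z) : ℝ) : Real.Angle).toReal = arg (q - z) - arg (p - z) :=
    Real.Angle.toReal_coe_eq_self_iff.2 ⟨by linarith [a1.1, a1.2], by linarith [a1.1, a1.2]⟩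
  have e2 : ((seen p q z : ℝ) : Real.Angle).toReal = seen p q z :=
    Real.Angle.toReal_coe_eq_self_iff.2 ⟨neg_pi_lt_arg _, arg_le_pi _⟩
  rw [e1, e2] at h2
  exact h2

/-- winding of the closed polygon `q 0, …, q m` around `z` -/
def wind (q : ℕ → ℂ) (m : ℕ) (z : ℂ) : ℝ :=
  ∑ j ∈ Finset.range m, seen (q j) (q (j + 1)) z + seen (q m) (q 0) z

lemma wind_int (q : ℕ → ℂ) (m : ℕ) (z : ℂ) (h : ∀ j ≤ m, z ≠ q j) :
    ∃ k : ℤ, wind q m z = k * (2 * Real.pi) := by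
  have key : ((wind q m z : ℝ) : Real.Angle) = 0 := by
    unfold wind
    rw [Real.Angle.coe_add, seen_coe (h m le_rfl) (h 0 (by omega))]
    have : ∀ k ≤ m, ((∑ j ∈ Finset.range k, seen (q j) (q (j + 1)) z : ℝ) : Real.Angle) =
        (arg (q k - z) : Real.Angle) - (arg (q 0 - z) : Real.Angle) := by
      intro k
      induction k with
      | zero => simp
      | succ k ih =>
        intro hk
        rw [Finset.sum_range_succ, Real.Angle.coe_add, ih (by omega),
          seen_coe (h k (by omega)) (h (k + 1) hk)]
        abel
    rw [this m le_rfl]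
    abel
  rw [← Real.Angle.coe_zero, Real.Angle.angle_eq_iff_two_pi_dvd_sub] at key
  obtain ⟨k, hk⟩ := key
  exact ⟨k, by linarith⟩

lemma wind_below (q : ℕ → ℂ) (m : ℕ) (z : ℂ) (h : ∀ j ≤ m, z.im < (q j).im) : wind q m z = 0 := by
  unfold wind
  rw [seen_below (h m le_rfl) (h 0 (by omega))]
  have : ∀ k ≤ m, (∑ j ∈ Finset.range k, seen (q j) (q (j + 1)) z : ℝ) =
      arg (q k - z) - arg (q 0 - z) := by
    intro k
    induction k with
    | zero => simp
    | succ k ih =>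
      intro hk
      rw [Finset.sum_range_succ, ih (by omega), seen_below (h k (by omega)) (h (k + 1) hk)]
      ring
  rw [this m le_rfl]; ring

lemma wind_continuousAt (q : ℕ → ℂ) (m : ℕ) (z : ℂ)
    (h : ∀ j < m, z ∉ segment ℝ (q j) (q (j + 1))) (hlast : z ∉ segment ℝ (q m) (q 0)) :
    ContinuousAt (wind q m) z := by
  unfold wind
  apply ContinuousAt.add
  · apply tendsto_finsetSum
    intro j hj
    exact seen_continuousAt (h j (Finset.mem_range.1 hj))
  · exact seen_continuousAt hlast

/-- A continuous function on an interval with values in `2πℤ` is constant. -/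
lemma const_of_int {g : ℝ → ℝ} {a b : ℝ} (hg : ContinuousOn g (Set.uIcc a b))
    (hi : ∀ t ∈ Set.uIcc a b, ∃ k : ℤ, g t = k * (2 * Real.pi)) : g a = g b := by
  by_contra hne
  obtain ⟨ka, hka⟩ := hi a Set.left_mem_uIcc
  obtain ⟨kb, hkb⟩ := hi b Set.right_mem_uIcc
  have hpi := Real.pi_pos
  have hsub := intermediate_value_uIcc hg
  have key : ∀ x y : ℤ, x < y → Set.uIcc (g a) (g b) = Set.Icc (x * (2 * Real.pi)) (y * (2 * Real.pi)) → False := by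
    intro x y hxy he
    have hxy' : (x : ℝ) + 1 ≤ y := by exact_mod_cast hxy
    have hm : (x + 1 / 2) * (2 * Real.pi) ∈ Set.uIcc (g a) (g b) := by
      rw [he]
      constructor <;> nlinarith
    obtain ⟨t, ht, hgt⟩ := hsub hm
    obtain ⟨k, hk⟩ := hi t ht
    rw [hk] at hgt
    have h2 := mul_right_cancel₀ (by positivity : (2 * Real.pi) ≠ 0) hgt
    have h3 : (2 * k : ℤ) = 2 * x + 1 := by
      have : (2 * k : ℝ) = 2 * x + 1 := by linarith
      exact_mod_cast this
    omega
  rcases lt_trichotomy ka kb with h | h | h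
  · apply key ka kb h
    have : (ka : ℝ) ≤ kb := by exact_mod_cast h.le
    rw [hka, hkb, Set.uIcc_of_le (by nlinarith)]
  · apply hne; rw [hka, hkb, h]
  · apply key kb ka h
    have : (kb : ℝ) ≤ ka := by exact_mod_cast h.le
    rw [hka, hkb, Set.uIcc_of_ge (by nlinarith)]

/-- limit of the winding function along a ray at a vertex `c` with next vertex `c + X` and
previous vertex `c + Y`. -/
lemma local_val (c X Y δ : ℂ) (f W : ℂ → ℝ) (hf : ContinuousAt f c)
    (hW : ∀ z, W z = f z + seen c (c + X) z + seen (c + Y) c z)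
    (h1 : -X / δ ∈ slitPlane) (h2 : -δ / Y ∈ slitPlane) (W0 : ℝ)
    (h : ∀ t : ℝ, 0 < t → t < 1 → W (c + t * δ) = W0) :
    W0 = f c + arg (-X / δ) + arg (-δ / Y) := by
  have hδ : δ ≠ 0 := by
    rintro rfl; simp at h1
  have hY : Y ≠ 0 := by
    rintro rfl; simp at h2
  have lim : Tendsto (fun t : ℝ => f (c + t * δ) + arg ((X - t * δ) / (-δ)) + arg (-δ / (Y - t * δ)))
      (𝓝[>] 0) (𝓝 (f c + arg (-X / δ) + arg (-δ / Y))) := by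
    apply Tendsto.mono_left _ nhdsWithin_le_nhds
    have hc0 : ContinuousAt (fun t : ℝ => f (c + t * δ)) 0 := by
      have : ContinuousAt (fun t : ℝ => (c + t * δ : ℂ)) 0 := by fun_prop
      refine ContinuousAt.comp (f := fun t : ℝ => (c + t * δ : ℂ)) ?_ this
      simpa using hf
    have hc1 : ContinuousAt (fun t : ℝ => arg ((X - t * δ) / (-δ))) 0 := by
      have : ContinuousAt (fun t : ℝ => ((X - t * δ) / (-δ) : ℂ)) 0 := by fun_prop
      refine ContinuousAt.comp (f := fun t : ℝ => ((X - t * δ) / (-δ) : ℂ)) (continuousAt_arg ?_) this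
      simpa [div_neg, neg_div] using h1
    have hc2 : ContinuousAt (fun t : ℝ => arg (-δ / (Y - t * δ))) 0 := by
      have : ContinuousAt (fun t : ℝ => (-δ / (Y - t * δ) : ℂ)) 0 := by
        apply ContinuousAt.div
        · fun_prop
        · fun_prop
        · simpa using hY
      refine ContinuousAt.comp (f := fun t : ℝ => (-δ / (Y - t * δ) : ℂ)) (continuousAt_arg ?_) this
      simpa using h2
    have := ((hc0.add hc1).add hc2).tendsto
    simpa [Pi.add_def, div_neg, neg_div] using this
  have lim2 : Tendsto (fun t : ℝ => f (c + t * δ) + arg ((X - t * δ) / (-δ)) + arg (-δ / (Y - t * δ)))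
      (𝓝[>] 0) (𝓝 W0) := by
    apply tendsto_const_nhds.congr'
    filter_upwards [Ioo_mem_nhdsGT (show (0:ℝ) < 1 by norm_num)] with t ht
    rw [← h t ht.1 ht.2, hW]
    have ht0 : (t : ℂ) ≠ 0 := by exact_mod_cast ht.1.ne'
    congr 1
    · congr 1
      unfold seen
      rw [show (c + X - (c + t * δ)) / (c - (c + t * δ)) =
        ((t⁻¹ : ℝ) : ℂ) * ((X - t * δ) / (-δ)) by push_cast; field_simp; ring]
      rw [arg_real_mul _ (inv_pos.2 ht.1)]
    · unfold seen
      rw [show (c - (c + t * δ)) / (c + Y - (c + t * δ)) = (t : ℂ) * (-δ / (Y - t * δ)) by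
        rw [mul_div_assoc']; congr 1 <;> ring]
      rw [arg_real_mul _ ht.1]
  exact tendsto_nhds_unique lim2 lim

lemma wind_const (q : ℕ → ℂ) (m N : ℕ) (hN : m + 2 ≤ N)
    (hR : ∀ i, ∀ t : ℝ, m ≤ i → i < N → 0 ≤ t → t ≤ 1 → ¬ (i = m ∧ t = 0) → ¬ (i + 1 = N ∧ t = 1) →
      (∀ j < m, q i + t * (q (i + 1) - q i) ∉ segment ℝ (q j) (q (j + 1))) ∧
      q i + t * (q (i + 1) - q i) ∉ segment ℝ (q m) (q 0)) :
    ∃ W0 : ℝ, (∃ k : ℤ, W0 = k * (2 * Real.pi)) ∧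
      ∀ i, ∀ t : ℝ, m ≤ i → i < N → 0 ≤ t → t ≤ 1 → ¬ (i = m ∧ t = 0) → ¬ (i + 1 = N ∧ t = 1) →
        wind q m (q i + t * (q (i + 1) - q i)) = W0 := by
  have hmeet : ∀ z, (∀ j < m, z ∉ segment ℝ (q j) (q (j + 1))) ∧ z ∉ segment ℝ (q m) (q 0) →
      ∃ k : ℤ, wind q m z = k * (2 * Real.pi) := by
    intro z hz
    apply wind_int
    intro j hj he
    rcases hj.lt_or_eq with h | h
    · apply hz.1 j h; rw [he]; exact left_mem_segment ℝ _ _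
    · apply hz.2; rw [he, h]; exact left_mem_segment ℝ _ _
  have hedge : ∀ i, ∀ s t : ℝ, m ≤ i → i < N → 0 ≤ s → s ≤ 1 → 0 ≤ t → t ≤ 1 →
      ¬ (i = m ∧ s = 0) → ¬ (i + 1 = N ∧ s = 1) → ¬ (i = m ∧ t = 0) → ¬ (i + 1 = N ∧ t = 1) →
      wind q m (q i + s * (q (i + 1) - q i)) = wind q m (q i + t * (q (i + 1) - q i)) := by
    intro i s t hmi hiN hs0 hs1 ht0 ht1 a1 a2 a3 a4
    have hx : ∀ x ∈ Set.uIcc s t, (∀ j < m, q i + x * (q (i + 1) - q i) ∉ segment ℝ (q j) (q (j + 1))) ∧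
        q i + x * (q (i + 1) - q i) ∉ segment ℝ (q m) (q 0) := by
      intro x hx
      rcases le_total s t with hst | hst
      · rw [Set.uIcc_of_le hst] at hx
        refine hR i x hmi hiN (hs0.trans hx.1) (hx.2.trans ht1) ?_ ?_
        · rintro ⟨h1, h2⟩; exact a1 ⟨h1, le_antisymm (h2 ▸ hx.1) hs0⟩
        · rintro ⟨h1, h2⟩; exact a4 ⟨h1, le_antisymm ht1 (h2 ▸ hx.2)⟩
      · rw [Set.uIcc_of_ge hst] at hx
        refine hR i x hmi hiN (ht0.trans hx.1) (hx.2.trans hs1) ?_ ?_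
        · rintro ⟨h1, h2⟩; exact a3 ⟨h1, le_antisymm (h2 ▸ hx.1) ht0⟩
        · rintro ⟨h1, h2⟩; exact a2 ⟨h1, le_antisymm hs1 (h2 ▸ hx.2)⟩
    apply const_of_int (g := fun x : ℝ => wind q m (q i + x * (q (i + 1) - q i)))
    · intro x hxm
      apply ContinuousAt.continuousWithinAt
      have c1 : ContinuousAt (fun x : ℝ => (q i + x * (q (i + 1) - q i) : ℂ)) x := by fun_prop
      exact ContinuousAt.comp (f := fun x : ℝ => (q i + x * (q (i + 1) - q i) : ℂ))
        (wind_continuousAt q m _ (hx x hxm).1 (hx x hxm).2) c1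
    · intro x hxm
      exact hmeet _ (hx x hxm)
  have hh : (0:ℝ) ≤ 1/2 ∧ (1/2 : ℝ) ≤ 1 ∧ (1/2 : ℝ) ≠ 0 ∧ (1/2 : ℝ) ≠ 1 := by norm_num
  refine ⟨wind q m (q m + (1/2 : ℝ) * (q (m + 1) - q m)), hmeet _ (hR m (1/2) le_rfl (by omega) hh.1 hh.2.1
    (fun h => hh.2.2.1 h.2) (fun h => hh.2.2.2 h.2)), ?_⟩
  intro i t hmi
  induction i, hmi using Nat.le_induction generalizing t with
  | base =>
    intro h1 h2 h3 h4 h5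
    exact hedge m t (1/2) le_rfl h1 h2 h3 hh.1 hh.2.1 h4 h5 (fun h => hh.2.2.1 h.2) (fun h => hh.2.2.2 h.2)
  | succ i hi ih =>
    intro h1 h2 h3 h4 h5
    have e1 := ih 1 (by omega) (by norm_num) le_rfl (by norm_num) (by omega)
    have e2 := hedge (i + 1) t 0 (by omega) h1 h2 h3 le_rfl (by norm_num) h4 h5 (by omega) (by norm_num)
    rw [e2, ← e1]
    congr 1
    push_cast
    ring

lemma arg_im_pos {z : ℂ} (h : 0 < z.im) : 0 < arg z ∧ arg z < Real.pi := by
  refine ⟨lt_of_le_of_ne (arg_nonneg_iff.2 h.le) fun h0 => ?_, arg_lt_pi_iff.2 (Or.inr h.ne')⟩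
  have := (arg_eq_zero_iff.1 h0.symm).2
  linarith

lemma arg_im_neg {z : ℂ} (h : z.im < 0) : -Real.pi < arg z ∧ arg z < 0 :=
  ⟨neg_pi_lt_arg z, arg_neg_iff.2 h⟩

lemma arg_im_nonpos {z : ℂ} (h : z.im ≤ 0) (hs : z ∈ slitPlane) : -Real.pi < arg z ∧ arg z ≤ 0 := by
  refine ⟨neg_pi_lt_arg z, ?_⟩
  rcases h.lt_or_eq with h | h
  · exact (arg_neg_iff.2 h).le
  · rcases hs with hs | hs
    · exact (arg_eq_zero_iff.2 ⟨hs.le, h⟩).le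
    · exact absurd h hs

/-- final numerology -/
lemma corner_val {s A B C D W0 F : ℝ} (k : ℤ) (hk : W0 = k * (2 * Real.pi))
    (h1 : W0 = F + A + B) (h2 : 0 = F + C + D)
    (hp : 0 < s → 0 < A ∧ A < Real.pi) (hn : s < 0 → -Real.pi < A ∧ A < 0)
    (hB : -Real.pi < B ∧ B ≤ 0) (hC : |C| ≤ Real.pi / 2) (hD : D = Real.pi / 2) :
    (0 < s → W0 = 0) ∧ (s < 0 → W0 < 0) := by
  have hpi := Real.pi_pos
  obtain ⟨c1, c2⟩ := abs_le.1 hC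
  constructor
  · intro hs
    obtain ⟨p1, p2⟩ := hp hs
    have a : (k : ℝ) < 1 := by nlinarith
    have b : (-1 : ℝ) < k := by nlinarith
    have a' : k < 1 := by exact_mod_cast a
    have b' : -1 < k := by exact_mod_cast b
    have : k = 0 := by omega
    rw [hk, this]; simp
  · intro hs
    obtain ⟨p1, p2⟩ := hn hs
    linarith [hB.2]

end Stmt11

namespace Stmt11
open Complex Filter Topology

lemma div_im' (z w : ℂ) : (z / w).im = (z.im * w.re - z.re * w.im) / normSq w := by
  rw [div_im]; ring

lemma div_re' (z w : ℂ) : (z / w).re = (z.re * w.re + z.im * w.im) / normSq w := by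
  rw [div_re]; ring

theorem topo (q : ℕ → ℂ) (m N : ℕ) (hm : 2 ≤ m) (hN : m + 2 ≤ N) (hqN : q N = q 0)
    (him : ∀ j, 0 ≤ (q j).im) (ha0 : (q 0).im = 0) (hb0 : (q m).im = 0)
    (hre : (q 0).re < (q m).re)
    (hR : ∀ i, ∀ t : ℝ, m ≤ i → i < N → 0 ≤ t → t ≤ 1 → ¬ (i = m ∧ t = 0) → ¬ (i + 1 = N ∧ t = 1) →
      (∀ j < m, q i + t * (q (i + 1) - q i) ∉ segment ℝ (q j) (q (j + 1))) ∧
      q i + t * (q (i + 1) - q i) ∉ segment ℝ (q m) (q 0))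
    (ha : ∀ j, 1 ≤ j → j < m → q 0 ∉ segment ℝ (q j) (q (j + 1)))
    (hb : ∀ j, j + 1 < m → q m ∉ segment ℝ (q j) (q (j + 1)))
    (hna : ¬ ((q (N - 1) - q 0).im = 0 ∧ 0 < (q (N - 1) - q 0).re))
    (hnb : ¬ ((q (m + 1) - q m).im = 0 ∧ (q (m + 1) - q m).re < 0))
    (hsa : (q 1 - q 0).re * (q (N - 1) - q 0).im - (q 1 - q 0).im * (q (N - 1) - q 0).re ≠ 0)
    (hsb : (q (m + 1) - q m).re * (q (m - 1) - q m).im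
      - (q (m + 1) - q m).im * (q (m - 1) - q m).re ≠ 0) :
    0 < ((q 1 - q 0).re * (q (N - 1) - q 0).im - (q 1 - q 0).im * (q (N - 1) - q 0).re) *
      ((q (m + 1) - q m).re * (q (m - 1) - q m).im
        - (q (m + 1) - q m).im * (q (m - 1) - q m).re) := by
  obtain ⟨W0, ⟨k, hk⟩, hW⟩ := wind_const q m N hN hR
  have below : ∀ c : ℂ, c.im = 0 → ∀ t : ℝ, 0 < t → t < 1 → wind q m (c + t * (-I)) = 0 := by
    intro c hc t ht _
    apply wind_below
    intro j _
    have := him j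
    simp [hc]; linarith
  -- corner at a
  have A : (0 < (q 1 - q 0).re * (q (N - 1) - q 0).im - (q 1 - q 0).im * (q (N - 1) - q 0).re → W0 = 0) ∧
      ((q 1 - q 0).re * (q (N - 1) - q 0).im - (q 1 - q 0).im * (q (N - 1) - q 0).re < 0 → W0 < 0) := by
    have hXim : 0 ≤ (q 1 - q 0).im := by simp [ha0, him]
    have hδim : 0 ≤ (q (N - 1) - q 0).im := by simp [ha0, him]
    have hYim : (q m - q 0).im = 0 := by simp [ha0, hb0]
    have hYre : 0 < (q m - q 0).re := by simp; exact hre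
    have hWf : ∀ z, wind q m z = (∑ j ∈ Finset.range (m - 1), seen (q (j + 1)) (q (j + 1 + 1)) z)
        + seen (q 0) (q 0 + (q 1 - q 0)) z + seen (q 0 + (q m - q 0)) (q 0) z := by
      intro z
      unfold wind
      obtain ⟨m', rfl⟩ : ∃ m', m = m' + 1 := ⟨m - 1, by omega⟩
      rw [Finset.sum_range_succ']
      simp
    have hfc : ContinuousAt (fun z => ∑ j ∈ Finset.range (m - 1), seen (q (j + 1)) (q (j + 1 + 1)) z) (q 0) := by
      apply tendsto_finsetSum
      intro j hj
      have := Finset.mem_range.1 hj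
      exact seen_continuousAt (ha (j + 1) (by omega) (by omega))
    have hray : ∀ t : ℝ, 0 < t → t < 1 → wind q m (q 0 + t * (q (N - 1) - q 0)) = W0 := by
      intro t ht0 ht1
      have := hW (N - 1) (1 - t) (by omega) (by omega) (by linarith) (by linarith) (by omega)
        (by rintro ⟨_, h⟩; linarith)
      rw [← this]
      congr 1
      rw [show N - 1 + 1 = N by omega, hqN]
      push_cast; ring
    generalize q 1 - q 0 = X at *
    generalize q (N - 1) - q 0 = δ at *
    generalize q m - q 0 = Y at *
    have hY : Y ≠ 0 := by rintro rfl; simp at hYre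
    have hδ : δ ≠ 0 := by rintro rfl; simp at hsa
    have hX : X ≠ 0 := by rintro rfl; simp at hsa
    have nY : 0 < normSq Y := normSq_pos.2 hY
    have nδ : 0 < normSq δ := normSq_pos.2 hδ
    have i1 : (-X / δ).im = (X.re * δ.im - X.im * δ.re) / normSq δ := by
      rw [div_im']; simp; ring
    have i2 : (-δ / Y).im = -(δ.im * Y.re) / normSq Y := by
      rw [div_im']; simp [hYim]
    have s2 : -δ / Y ∈ slitPlane := by
      rcases hδim.lt_or_eq with h | h
      · right; rw [i2]
        exact div_ne_zero (neg_ne_zero.2 (mul_pos h hYre).ne') nY.ne'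
      · left
        rw [div_re']
        apply div_pos _ nY
        have : δ.re ≤ 0 := not_lt.1 fun h' => hna ⟨h.symm, h'⟩
        have h3 : δ.re ≠ 0 := fun h' => hδ (Complex.ext h' h.symm)
        have h4 := lt_of_le_of_ne this h3
        simp [hYim]; nlinarith
    have r3 : (-X / -I).re = X.im := by simp
    have i3 : (-X / -I).im = -X.re := by simp
    have s3 : -X / -I ∈ slitPlane := by
      rcases hXim.lt_or_eq with h | h
      · left; rw [r3]; exact h
      · right; rw [i3]; intro h'; exact hX (Complex.ext (by simpa using h') h.symm)
    have r4 : (-(-I) / Y).re = 0 := by rw [div_re']; simp [hYim]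
    have i4 : 0 < (-(-I) / Y).im := by
      rw [div_im']; simp; positivity
    have e1 := local_val (q 0) X Y δ _ _ hfc hWf
      (Or.inr (by rw [i1]; exact div_ne_zero hsa nδ.ne')) s2 W0 hray
    have e2 := local_val (q 0) X Y (-I) _ _ hfc hWf s3 (Or.inr i4.ne') 0 (below _ ha0)
    refine corner_val k hk e1 e2 ?_ ?_ ?_ ?_ ?_
    · intro h; apply arg_im_pos; rw [i1]; positivity
    · intro h; apply arg_im_neg; rw [i1]; exact div_neg_of_neg_of_pos h nδ
    · apply arg_im_nonpos _ s2
      rw [i2]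
      apply div_nonpos_of_nonpos_of_nonneg _ nY.le
      nlinarith
    · rw [abs_arg_le_pi_div_two_iff, r3]; exact hXim
    · rw [arg_eq_pi_div_two_iff]; exact ⟨r4, i4⟩
  -- corner at b
  have B : (0 < (q (m + 1) - q m).re * (q (m - 1) - q m).im - (q (m + 1) - q m).im * (q (m - 1) - q m).re → W0 = 0) ∧
      ((q (m + 1) - q m).re * (q (m - 1) - q m).im - (q (m + 1) - q m).im * (q (m - 1) - q m).re < 0 → W0 < 0) := by
    have hYim : 0 ≤ (q (m - 1) - q m).im := by simp [hb0, him]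
    have hδim : 0 ≤ (q (m + 1) - q m).im := by simp [hb0, him]
    have hXim : (q 0 - q m).im = 0 := by simp [ha0, hb0]
    have hXre : (q 0 - q m).re < 0 := by simp; exact hre
    have hWf : ∀ z, wind q m z = (∑ j ∈ Finset.range (m - 1), seen (q j) (q (j + 1)) z)
        + seen (q m) (q m + (q 0 - q m)) z + seen (q m + (q (m - 1) - q m)) (q m) z := by
      intro z
      unfold wind
      obtain ⟨m', rfl⟩ : ∃ m', m = m' + 1 := ⟨m - 1, by omega⟩
      rw [Finset.sum_range_succ]
      simp; ring
    have hfc : ContinuousAt (fun z => ∑ j ∈ Finset.range (m - 1), seen (q j) (q (j + 1)) z) (q m) := by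
      apply tendsto_finsetSum
      intro j hj
      have := Finset.mem_range.1 hj
      exact seen_continuousAt (hb j (by omega))
    have hray : ∀ t : ℝ, 0 < t → t < 1 → wind q m (q m + t * (q (m + 1) - q m)) = W0 := by
      intro t ht0 ht1
      exact hW m t le_rfl (by omega) (by linarith) (by linarith) (by rintro ⟨_, h⟩; linarith)
        (by omega)
    generalize q 0 - q m = X at *
    generalize q (m + 1) - q m = δ at *
    generalize q (m - 1) - q m = Y at *
    have hX : X ≠ 0 := by rintro rfl; simp at hXre
    have hδ : δ ≠ 0 := by rintro rfl; simp at hsb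
    have hY : Y ≠ 0 := by rintro rfl; simp at hsb
    have nY : 0 < normSq Y := normSq_pos.2 hY
    have nδ : 0 < normSq δ := normSq_pos.2 hδ
    have i1 : (-δ / Y).im = (δ.re * Y.im - δ.im * Y.re) / normSq Y := by
      rw [div_im']; simp; ring
    have i2 : (-X / δ).im = (X.re * δ.im) / normSq δ := by
      rw [div_im']; simp [hXim]
    have s2 : -X / δ ∈ slitPlane := by
      rcases hδim.lt_or_eq with h | h
      · right; rw [i2]
        exact div_ne_zero (mul_neg_of_neg_of_pos hXre h).ne nδ.ne'
      · left
        rw [div_re']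
        apply div_pos _ nδ
        have : 0 ≤ δ.re := not_lt.1 fun h' => hnb ⟨h.symm, h'⟩
        have h3 : δ.re ≠ 0 := fun h' => hδ (Complex.ext h' h.symm)
        have h4 := lt_of_le_of_ne this h3.symm
        simp [hXim]; nlinarith
    have i3 : (-(-I) / Y).im = Y.re / normSq Y := by rw [div_im']; simp
    have r3 : (-(-I) / Y).re = Y.im / normSq Y := by rw [div_re']; simp
    have s3 : -(-I) / Y ∈ slitPlane := by
      rcases hYim.lt_or_eq with h | h
      · left; rw [r3]; positivity
      · right; rw [i3]; intro h'
        rcases div_eq_zero_iff.1 h' with h2 | h2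
        · exact hY (Complex.ext h2 h.symm)
        · exact nY.ne' h2
    have r4 : (-X / -I).re = 0 := by simp [hXim]
    have i4 : 0 < (-X / -I).im := by simp [hXre]
    have e1 := local_val (q m) X Y δ _ _ hfc hWf s2
      (Or.inr (by rw [i1]; exact div_ne_zero hsb nY.ne')) W0 hray
    have e2 := local_val (q m) X Y (-I) _ _ hfc hWf (Or.inr i4.ne') s3 0 (below _ hb0)
    rw [add_right_comm] at e1 e2
    refine corner_val k hk e1 e2 ?_ ?_ ?_ ?_ ?_
    · intro h; apply arg_im_pos; rw [i1]; positivity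
    · intro h; apply arg_im_neg; rw [i1]; exact div_neg_of_neg_of_pos h nY
    · apply arg_im_nonpos _ s2
      rw [i2]
      apply div_nonpos_of_nonpos_of_nonneg _ nδ.le
      nlinarith
    · rw [abs_arg_le_pi_div_two_iff, r3]; positivity
    · rw [arg_eq_pi_div_two_iff]; exact ⟨r4, i4⟩
  rcases lt_or_gt_of_ne hsa with h1 | h1 <;> rcases lt_or_gt_of_ne hsb with h2 | h2
  · exact mul_pos_of_neg_of_neg h1 h2
  · have := A.2 h1; have := B.1 h2; linarith
  · have := A.1 h1; have := B.2 h2; linarith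
  · exact mul_pos h1 h2

end Stmt11

namespace Stmt11

def edgeP {n : ℕ} (z : ZMod n → ℂ) (i : ZMod n) (t : ℝ) : ℂ := z i + t * (z (i + 1) - z i)

lemma edgeP_zero {n : ℕ} (z : ZMod n → ℂ) (i : ZMod n) : edgeP z i 0 = z i := by simp [edgeP]
lemma edgeP_one {n : ℕ} (z : ZMod n → ℂ) (i : ZMod n) : edgeP z i 1 = z (i + 1) := by simp [edgeP]

/-- embedded closed planar polygon -/
structure PolyEmb {n : ℕ} (z : ZMod n → ℂ) : Prop where
  far : ∀ i j, i ≠ j → j ≠ i + 1 → i ≠ j + 1 → ∀ s t : ℝ, 0 ≤ s → s ≤ 1 → 0 ≤ t → t ≤ 1 →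
    edgeP z i s ≠ edgeP z j t
  near : ∀ i, ∀ s t : ℝ, 0 ≤ s → s ≤ 1 → 0 ≤ t → t ≤ 1 →
    edgeP z i s = edgeP z (i + 1) t → s = 1 ∧ t = 0

lemma PolyEmb.vert {n : ℕ} {z : ZMod n → ℂ} (h : PolyEmb z) (k i : ZMod n) (h1 : k ≠ i) (h2 : k ≠ i + 1)
    (t : ℝ) (ht0 : 0 ≤ t) (ht1 : t ≤ 1) : z k ≠ edgeP z i t := by
  intro he
  rw [← edgeP_zero z k] at he
  by_cases h3 : i = k + 1
  · subst h3
    have := h.near k 0 t le_rfl zero_le_one ht0 ht1 he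
    exact zero_ne_one this.1
  · exact h.far k i h1 h3 h2 0 t le_rfl zero_le_one ht0 ht1 he

lemma mem_segment_edge {p q z : ℂ} (h : z ∈ segment ℝ p q) :
    ∃ t : ℝ, 0 ≤ t ∧ t ≤ 1 ∧ z = p + t * (q - p) := by
  rw [segment_eq_image'] at h
  obtain ⟨t, ht, rfl⟩ := h
  exact ⟨t, ht.1, ht.2, by simp⟩

lemma cast_inj {n : ℕ} {i j : ℕ} (hi : i < n) (hj : j < n) (h : (i : ZMod n) = j) : i = j := by
  rw [ZMod.natCast_eq_natCast_iff', Nat.mod_eq_of_lt hi, Nat.mod_eq_of_lt hj] at h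
  exact h

lemma real_between {p r b : ℂ} (hp : p.im = 0) (hr : r.im = 0) (hb : b.im = 0)
    (h : (p.re ≤ b.re ∧ b.re ≤ r.re) ∨ (r.re ≤ b.re ∧ b.re ≤ p.re)) :
    ∃ t : ℝ, 0 ≤ t ∧ t ≤ 1 ∧ b = p + t * (r - p) := by
  by_cases he : r.re = p.re
  · refine ⟨0, le_rfl, zero_le_one, ?_⟩
    apply Complex.ext
    · simp; rcases h with h | h <;> linarith [h.1, h.2]
    · simp [hp, hb]
  · have hne : r.re - p.re ≠ 0 := sub_ne_zero.2 he
    refine ⟨(b.re - p.re) / (r.re - p.re), ?_, ?_, ?_⟩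
    · rcases h with h | h
      · exact div_nonneg (by linarith) (by linarith)
      · exact div_nonneg_of_nonpos (by linarith) (by linarith)
    · rcases h with h | h
      · rw [div_le_one (lt_of_le_of_ne (by linarith) hne.symm)]; linarith
      · rw [div_le_one_of_neg (lt_of_le_of_ne (by linarith) hne)]; linarith
    · apply Complex.ext
      · simp only [Complex.add_re, Complex.mul_re, Complex.ofReal_re, Complex.ofReal_im, Complex.sub_re]
        field_simp; ring
      · simp only [Complex.add_im, Complex.mul_im, Complex.ofReal_re, Complex.ofReal_im, Complex.sub_im, hp, hr, hb]
        ring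

theorem planar_core {n : ℕ} [NeZero n] {z : ZMod n → ℂ} (hz : PolyEmb z) (him : ∀ j, 0 ≤ (z j).im)
    (a b : ZMod n) (hab : b ≠ a) (hab1 : b ≠ a + 1) (hba1 : a ≠ b + 1)
    (ha0 : (z a).im = 0) (hb0 : (z b).im = 0) (hre : (z a).re < (z b).re)
    (hgap : ∀ j, (z j).im = 0 → (z j).re ≤ (z a).re ∨ (z b).re ≤ (z j).re)
    (hsa : (z (a + 1) - z a).re * (z (a - 1) - z a).im - (z (a + 1) - z a).im * (z (a - 1) - z a).re ≠ 0)
    (hsb : (z (b + 1) - z b).re * (z (b - 1) - z b).im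
      - (z (b + 1) - z b).im * (z (b - 1) - z b).re ≠ 0) :
    0 < ((z (a + 1) - z a).re * (z (a - 1) - z a).im - (z (a + 1) - z a).im * (z (a - 1) - z a).re) *
      ((z (b + 1) - z b).re * (z (b - 1) - z b).im
        - (z (b + 1) - z b).im * (z (b - 1) - z b).re) := by
  have hn0 : 0 < n := Nat.pos_of_ne_zero (NeZero.ne n)
  set m := (b - a).val with hmdef
  have hmn : m < n := ZMod.val_lt _
  have hmb : a + (m : ZMod n) = b := by rw [hmdef, ZMod.natCast_zmod_val]; ring
  have hm : 2 ≤ m := by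
    by_contra hlt
    have : m = 0 ∨ m = 1 := by omega
    rcases this with h | h
    · rw [h] at hmb; simp at hmb; exact hab hmb.symm
    · rw [h] at hmb; simp at hmb; exact hab1 hmb.symm
  have hN : m + 2 ≤ n := by
    by_contra hlt
    have h : m + 1 = n := by omega
    apply hba1
    rw [← hmb]
    have : ((m + 1 : ℕ) : ZMod n) = 0 := by rw [h]; simp
    push_cast at this
    linear_combination -this
  set q : ℕ → ℂ := fun k => z (a + (k : ZMod n)) with hq
  have q0 : q 0 = z a := by simp [hq]
  have qm : q m = z b := by simp only [hq]; rw [hmb]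
  have qs : ∀ k : ℕ, q (k + 1) = z (a + (k : ZMod n) + 1) := by
    intro k; simp only [hq]; push_cast; rw [add_assoc]
  have qe : ∀ (k : ℕ) (t : ℝ), q k + t * (q (k + 1) - q k) = edgeP z (a + (k : ZMod n)) t := by
    intro k t; rw [qs]; rfl
  have qN : q n = q 0 := by simp [hq]
  have qN1 : q (n - 1) = z (a - 1) := by
    simp only [hq]; congr 1
    have : (((n - 1) + 1 : ℕ) : ZMod n) = 0 := by rw [Nat.sub_add_cancel hn0]; simp
    push_cast at this
    linear_combination this
  have qm1 : q (m - 1) = z (b - 1) := by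
    simp only [hq]; congr 1; rw [← hmb]
    have : (((m - 1) + 1 : ℕ) : ZMod n) = m := by rw [Nat.sub_add_cancel (by omega)]
    push_cast at this
    linear_combination this
  have qmp : q (m + 1) = z (b + 1) := by rw [qs, hmb]
  have q1 : q 1 = z (a + 1) := by simp [hq]
  -- vertices are not on other edges
  have vert : ∀ k i : ℕ, k < n → i < n → k ≠ i → k ≠ i + 1 → (k = 0 → i + 1 ≠ n) → ∀ t : ℝ, 0 ≤ t → t ≤ 1 →
      q k ≠ q i + t * (q (i + 1) - q i) := by
    intro k i hk hi h1 h2 h3 t ht0 ht1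
    rw [qe]
    apply hz.vert _ _ _ _ t ht0 ht1
    · intro h; exact h1 (cast_inj hk hi (add_left_cancel h))
    · intro h
      rw [add_assoc] at h
      have h := add_left_cancel h
      by_cases hin : i + 1 = n
      · have h0 : ((i + 1 : ℕ) : ZMod n) = ((0 : ℕ) : ZMod n) := by rw [hin]; simp
        push_cast at h0
        rw [h0] at h
        exact h3 (cast_inj hk hn0 (by simpa using h)) hin
      · exact h2 (cast_inj hk (by omega) (by push_cast; exact h))
  have key := topo q m n hm hN qN (fun j => him _) (by rw [q0]; exact ha0) (by rw [qm]; exact hb0)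
    (by rw [q0, qm]; exact hre) ?_ ?_ ?_ ?_ ?_ (by rw [q1, q0, qN1]; exact hsa)
    (by rw [qmp, qm, qm1]; exact hsb)
  · rw [q1, q0, qN1, qmp, qm, qm1] at key; exact key
  · intro i t hmi hin ht0 ht1 e1 e2
    constructor
    · intro j hj hmem
      obtain ⟨s, hs0, hs1, hs⟩ := mem_segment_edge hmem
      rw [qe, qe] at hs
      by_cases c1 : a + (i : ZMod n) = a + (j : ZMod n) + 1
      · rw [add_assoc] at c1
        have hij : i = j + 1 := cast_inj hin (by omega) (by push_cast; exact add_left_cancel c1)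
        have : a + (i : ZMod n) = a + (j : ZMod n) + 1 := by rw [hij]; push_cast; ring
        rw [this] at hs
        have := hz.near _ s t hs0 hs1 ht0 ht1 hs.symm
        exact e1 ⟨by omega, this.2⟩
      by_cases c2 : a + (j : ZMod n) = a + (i : ZMod n) + 1
      · rw [c2] at hs
        have h2 := hz.near _ t s ht0 ht1 hs0 hs1 hs
        refine e2 ⟨?_, h2.1⟩
        by_contra hne
        rw [add_assoc] at c2
        have : j = i + 1 := cast_inj (n := n) (by omega) (by omega) (by push_cast; exact add_left_cancel c2)
        omega
      refine hz.far _ _ ?_ c2 c1 t s ht0 ht1 hs0 hs1 hs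
      intro h
      have : i = j := cast_inj hin (by omega) (add_left_cancel h)
      omega
    · intro hmem
      obtain ⟨s, hs0, hs1, hs⟩ := mem_segment_edge hmem
      have hz0 : (q i + t * (q (i + 1) - q i)).im = 0 := by
        rw [hs, q0, qm]; simp [ha0, hb0]
      have hza : (z a).re ≤ (q i + t * (q (i + 1) - q i)).re := by
        rw [hs, q0, qm]; simp; nlinarith
      have hzb : (q i + t * (q (i + 1) - q i)).re ≤ (z b).re := by
        rw [hs, q0, qm]; simp; nlinarith
      -- vertices strictly inside (m, n) are off [a, b]
      have off : ∀ k, m < k → k < n → (q k).im = 0 → (q k).re < (z a).re ∨ (z b).re < (q k).re := by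
        intro k hk1 hk2 hk0
        rcases hgap _ hk0 with h | h
        · left
          refine lt_of_le_of_ne h fun h' => ?_
          apply vert k 0 hk2 hn0 (by omega) (by omega) (by omega) 0 le_rfl zero_le_one
          rw [q0]; simp
          exact Complex.ext h' (by rw [hk0, ha0])
        · right
          refine lt_of_le_of_ne h fun h' => ?_
          apply vert k m hk2 hmn (by omega) ?_ (by omega) 0 le_rfl zero_le_one
          · rw [qm]; simp
            exact Complex.ext h'.symm (by rw [hk0, hb0])
          · rintro rfl
            have : q (m + 1) = z b := Complex.ext h'.symm (by rw [hk0, hb0])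
            rw [qmp] at this
            have := hz.near b 1 1 zero_le_one le_rfl zero_le_one le_rfl
            apply hsb
            have e : z (b + 1) = z b := by assumption
            rw [e]; simp
      simp only [Complex.add_im, Complex.mul_im, Complex.ofReal_re, Complex.ofReal_im, zero_mul, add_zero,
        Complex.sub_im, Complex.add_re, Complex.mul_re, Complex.sub_re, sub_zero] at hz0 hza hzb
      have y1 : 0 ≤ (q i).im := him _
      have y2 : 0 ≤ (q (i + 1)).im := him _
      rcases ht0.eq_or_lt with rfl | ht0'
      · have him' : m < i := lt_of_le_of_ne hmi fun h => e1 ⟨h.symm, rfl⟩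
        rcases off i him' hin (by linarith) with h | h <;> linarith
      rcases ht1.eq_or_lt with rfl | ht1'
      · have hin' : i + 1 < n := lt_of_le_of_ne hin fun h => e2 ⟨h, rfl⟩
        rcases off (i + 1) (by omega) hin' (by linarith) with h | h <;> linarith
      have z1 : (q i).im = 0 := by nlinarith
      have z2 : (q (i + 1)).im = 0 := by nlinarith
      -- one endpoint strictly outside
      by_cases hin' : i + 1 < n
      · -- a not on edge i
        have na : ∀ s : ℝ, 0 ≤ s → s ≤ 1 → z a ≠ q i + s * (q (i + 1) - q i) := by
          rw [← q0]; exact vert 0 i hn0 hin (by omega) (by omega) (by omega)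
        have o2 := off (i + 1) (by omega) hin' z2
        have o1 := hgap _ z1
        change (q i).re ≤ _ ∨ _ ≤ (q i).re at o1
        rcases o2 with o2 | o2
        · rcases o1 with o1 | o1
          · nlinarith
          · obtain ⟨s, s0, s1, hs⟩ := real_between z1 z2 ha0 (Or.inr ⟨o2.le, by linarith⟩)
            exact na s s0 s1 hs
        · rcases o1 with o1 | o1
          · obtain ⟨s, s0, s1, hs⟩ := real_between z1 z2 ha0 (Or.inl ⟨o1, by linarith⟩)
            exact na s s0 s1 hs
          · nlinarith
      · have hin'' : i + 1 = n := by omega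
        have nb : ∀ s : ℝ, 0 ≤ s → s ≤ 1 → z b ≠ q i + s * (q (i + 1) - q i) := by
          rw [← qm]; exact vert m i hmn hin (by omega) (by omega) (by omega)
        have o1 := off i (by omega) hin z1
        have ha' : q (i + 1) = z a := by rw [hin'', qN, q0]
        rw [ha'] at hza hzb nb z2
        rcases o1 with o1 | o1
        · nlinarith
        · obtain ⟨s, s0, s1, hs⟩ := real_between z1 z2 hb0 (Or.inr ⟨hre.le, o1.le⟩)
          exact nb s s0 s1 hs
  · intro j hj1 hj2 hmem
    obtain ⟨s, hs0, hs1, hs⟩ := mem_segment_edge hmem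
    exact vert 0 j hn0 (by omega) (by omega) (by omega) (by omega) s hs0 hs1 hs
  · intro j hj hmem
    obtain ⟨s, hs0, hs1, hs⟩ := mem_segment_edge hmem
    exact vert m j hmn (by omega) (by omega) (by omega) (by omega) s hs0 hs1 hs
  · rintro ⟨h1, h2⟩
    rw [q0] at h1 h2
    have z1 : (q (n - 1)).im = 0 := by simp [ha0] at h1; exact h1
    simp only [Complex.sub_re, sub_pos] at h2
    rcases hgap _ z1 with h | h
    · exact absurd h (not_le.2 h2)
    · obtain ⟨s, s0, s1, hs⟩ := real_between z1 ha0 hb0 (Or.inr ⟨hre.le, h⟩)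
      apply vert m (n - 1) hmn (by omega) (by omega) (by omega) (by omega) s s0 s1
      rw [Nat.sub_add_cancel hn0, qN, q0, qm]; exact hs
  · rintro ⟨h1, h2⟩
    rw [qm] at h1 h2
    have z1 : (q (m + 1)).im = 0 := by simp [hb0] at h1; exact h1
    simp only [Complex.sub_re, sub_neg] at h2
    rcases hgap _ z1 with h | h
    · obtain ⟨s, s0, s1, hs⟩ := real_between hb0 z1 ha0 (Or.inr ⟨h, hre.le⟩)
      apply vert 0 m hn0 hmn (by omega) (by omega) (by omega) s s0 s1
      rw [qm, q0]; exact hs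
    · exact absurd h (not_le.2 h2)

end Stmt11

namespace Stmt11

/-- Abstract conditions on the edge vectors of a star. -/
structure Good {n : ℕ} (u : ZMod n → E3) : Prop where
  hn : 3 ≤ n
  det : ∀ i, det3 (u i) (u (i + 1)) (u (i + 2)) ≠ 0
  cone : ∀ i j, i ≠ j → j ≠ i + 1 → i ≠ j + 1 → ∀ s t s' t' : ℝ, 0 ≤ s → 0 ≤ t → 0 ≤ s' → 0 ≤ t' →
    s • u i + t • u (i + 1) = s' • u j + t' • u (j + 1) → s • u i + t • u (i + 1) = 0
  gauss : ∀ i j, i ≠ j → j ≠ i + 1 → i ≠ j + 1 → ∀ s t s' t' : ℝ, 0 ≤ s → 0 ≤ t → 0 ≤ s' → 0 ≤ t' →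
    0 < s + t → 0 < s' + t' →
    s • cross3 (u i) (u (i + 1)) + t • cross3 (u (i + 1)) (u (i + 2)) ≠
      s' • cross3 (u j) (u (j + 1)) + t' • cross3 (u (j + 1)) (u (j + 2))

/-- dual basis expansion -/
lemma dual_expand (p q r Y : E3) : det3 p q r • Y =
    ⟪Y, r⟫ • cross3 p q + ⟪Y, p⟫ • cross3 q r + ⟪Y, q⟫ • cross3 r p := by
  apply ext3 <;> simp only [cross3_zero, cross3_one, cross3_two, det3, inner3, PiLp.smul_apply,
    PiLp.add_apply, smul_eq_mul] <;> ring

lemma det3_rot (a b c : E3) : det3 a b c = det3 b c a := by simp only [det3]; ring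

lemma det3_mul (X Y H a b c : E3) :
    ⟪X, a⟫ * (⟪Y, b⟫ * ⟪H, c⟫ - ⟪H, b⟫ * ⟪Y, c⟫) + ⟪Y, a⟫ * (⟪H, b⟫ * ⟪X, c⟫ - ⟪X, b⟫ * ⟪H, c⟫)
      + ⟪H, a⟫ * (⟪X, b⟫ * ⟪Y, c⟫ - ⟪Y, b⟫ * ⟪X, c⟫) = det3 X Y H * det3 a b c := by
  simp only [det3, inner3]; ring

lemma eq_of_inner {X Y H p q : E3} (h : det3 X Y H ≠ 0) (h1 : ⟪X, p⟫ = ⟪X, q⟫)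
    (h2 : ⟪Y, p⟫ = ⟪Y, q⟫) (h3 : ⟪H, p⟫ = ⟪H, q⟫) : p = q := by
  have e1 := dual_expand X Y H p
  have e2 := dual_expand X Y H q
  rw [real_inner_comm p X, real_inner_comm q X] at h1
  rw [real_inner_comm p Y, real_inner_comm q Y] at h2
  rw [real_inner_comm p H, real_inner_comm q H] at h3
  have : det3 X Y H • p = det3 X Y H • q := by
    rw [e1, e2, h1, h2, h3]
  exact smul_right_injective _ h this

/-- central projection of the star to the plane -/
def zproj {n : ℕ} (X Y H : E3) (u : ZMod n → E3) (j : ZMod n) : ℂ :=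
  ⟨⟪X, u j⟫ / ⟪H, u j⟫, ⟪Y, u j⟫ / ⟪H, u j⟫⟩

def lift {n : ℕ} (H : E3) (u : ZMod n → E3) (i : ZMod n) (s : ℝ) : E3 :=
  ((1 - s) / ⟪H, u i⟫) • u i + (s / ⟪H, u (i + 1)⟫) • u (i + 1)

section
variable {n : ℕ} {u : ZMod n → E3} {X Y H : E3}

lemma inner_lift (Z : E3) (i : ZMod n) (s : ℝ) : ⟪Z, lift H u i s⟫ =
    (1 - s) * (⟪Z, u i⟫ / ⟪H, u i⟫) + s * (⟪Z, u (i + 1)⟫ / ⟪H, u (i + 1)⟫) := by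
  unfold lift
  rw [inner_add_right, inner_smul_right, inner_smul_right]; ring

lemma inner_lift_H (hH : ∀ i, 0 < ⟪H, u i⟫) (i : ZMod n) (s : ℝ) : ⟪H, lift H u i s⟫ = 1 := by
  rw [inner_lift, div_self (hH _).ne', div_self (hH _).ne']; ring

lemma edgeP_re (i : ZMod n) (s : ℝ) : (edgeP (zproj X Y H u) i s).re = ⟪X, lift H u i s⟫ := by
  rw [inner_lift]; simp [edgeP, zproj]; ring

lemma edgeP_im (i : ZMod n) (s : ℝ) : (edgeP (zproj X Y H u) i s).im = ⟪Y, lift H u i s⟫ := by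
  rw [inner_lift]; simp [edgeP, zproj]; ring

lemma lift_eq (hH : ∀ i, 0 < ⟪H, u i⟫) (hd : det3 X Y H ≠ 0) {i j : ZMod n} {s t : ℝ}
    (h : edgeP (zproj X Y H u) i s = edgeP (zproj X Y H u) j t) : lift H u i s = lift H u j t := by
  apply eq_of_inner hd
  · rw [← edgeP_re (Y := Y), h, edgeP_re]
  · rw [← edgeP_im (X := X), h, edgeP_im]
  · rw [inner_lift_H hH, inner_lift_H hH]

lemma polyEmb_zproj (hg : Good u) (hH : ∀ i, 0 < ⟪H, u i⟫) (hd : det3 X Y H ≠ 0) :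
    PolyEmb (zproj X Y H u) := by
  constructor
  · intro i j h1 h2 h3 s t hs0 hs1 ht0 ht1 he
    have hl := lift_eq hH hd he
    have h0 := hg.cone i j h1 h2 h3 _ _ _ _ (div_nonneg (sub_nonneg.2 hs1) (hH i).le)
      (div_nonneg hs0 (hH (i + 1)).le) (div_nonneg (sub_nonneg.2 ht1) (hH j).le)
      (div_nonneg ht0 (hH (j + 1)).le) hl
    have := inner_lift_H hH i s
    unfold lift at this
    rw [h0] at this
    simp at this
  · intro i s t hs0 hs1 ht0 ht1 he
    have hl := lift_eq hH hd he
    have hdet := hg.det i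
    unfold lift at hl
    rw [show i + 1 + 1 = i + 2 by ring] at hl
    have z1 : det3 (u (i + 1)) (u (i + 2)) (u (i + 1)) = 0 := by simp only [det3]; ring
    have z2 : det3 (u (i + 1)) (u (i + 2)) (u (i + 2)) = 0 := by simp only [det3]; ring
    have z3 : det3 (u i) (u (i + 1)) (u i) = 0 := by simp only [det3]; ring
    have z4 : det3 (u i) (u (i + 1)) (u (i + 1)) = 0 := by simp only [det3]; ring
    constructor
    · have := congrArg (fun x => ⟪cross3 (u (i + 1)) (u (i + 2)), x⟫) hl
      simp only [inner_add_right, inner_smul_right, inner_cross3, z1, z2] at this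
      rw [← det3_rot] at this
      have h2 : (1 - s) / ⟪H, u i⟫ * det3 (u i) (u (i + 1)) (u (i + 2)) = 0 := by linarith
      have h3 := (mul_eq_zero.1 h2).resolve_right hdet
      have h4 := (div_eq_zero_iff.1 h3).resolve_right (hH i).ne'
      linarith
    · have := congrArg (fun x => ⟪cross3 (u i) (u (i + 1)), x⟫) hl
      simp only [inner_add_right, inner_smul_right, inner_cross3, z3, z4] at this
      have h2 : t / ⟪H, u (i + 2)⟫ * det3 (u i) (u (i + 1)) (u (i + 2)) = 0 := by linarith
      have h3 := (mul_eq_zero.1 h2).resolve_right hdet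
      exact (div_eq_zero_iff.1 h3).resolve_right (hH _).ne'

lemma zproj_det (hH : ∀ i, 0 < ⟪H, u i⟫) (a b c : ZMod n) :
    (zproj X Y H u b - zproj X Y H u a).re * (zproj X Y H u c - zproj X Y H u a).im
      - (zproj X Y H u b - zproj X Y H u a).im * (zproj X Y H u c - zproj X Y H u a).re =
    det3 X Y H * det3 (u a) (u b) (u c) / (⟪H, u a⟫ * ⟪H, u b⟫ * ⟪H, u c⟫) := by
  have := hH a
  have := hH b
  have := hH c
  rw [← det3_mul]
  simp only [zproj, Complex.sub_re, Complex.sub_im]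
  field_simp
  ring

lemma expand_at (a : ZMod n) (hYa : ⟪Y, u a⟫ = 0) :
    det3 (u (a - 1)) (u a) (u (a + 1)) • Y =
      ⟪Y, u (a + 1)⟫ • cross3 (u (a - 1)) (u a) + ⟪Y, u (a - 1)⟫ • cross3 (u a) (u (a + 1)) := by
  rw [dual_expand, hYa]; simp

lemma Good.det' (hg : Good u) (a : ZMod n) : det3 (u (a - 1)) (u a) (u (a + 1)) ≠ 0 := by
  have := hg.det (a - 1)
  rwa [show a - 1 + 1 = a by ring, show a - 1 + 2 = a + 1 by ring] at this

theorem support_core [NeZero n] (hg : Good u) (hH : ∀ i, 0 < ⟪H, u i⟫) (hd : det3 X Y H ≠ 0)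
    (hY : ∀ i, 0 ≤ ⟪Y, u i⟫) (a b : ZMod n) (hab : b ≠ a)
    (ha0 : ⟪Y, u a⟫ = 0) (hb0 : ⟪Y, u b⟫ = 0)
    (hre : (zproj X Y H u a).re < (zproj X Y H u b).re)
    (hgap : ∀ j, ⟪Y, u j⟫ = 0 → (zproj X Y H u j).re ≤ (zproj X Y H u a).re ∨
      (zproj X Y H u b).re ≤ (zproj X Y H u j).re) : b = a + 1 ∨ a = b + 1 := by
  by_contra hcon
  push Not at hcon
  obtain ⟨hab1, hba1⟩ := hcon
  have hY0 : Y ≠ 0 := by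
    rintro rfl; apply hd; simp [det3]
  have hpe := polyEmb_zproj (X := X) (Y := Y) hg hH hd
  have da := hg.det' a
  have db := hg.det' b
  have ha1 := hH a
  have hb1 := hH b
  have hs : ∀ a, (zproj X Y H u (a + 1) - zproj X Y H u a).re * (zproj X Y H u (a - 1) - zproj X Y H u a).im
      - (zproj X Y H u (a + 1) - zproj X Y H u a).im * (zproj X Y H u (a - 1) - zproj X Y H u a).re =
      det3 X Y H * det3 (u (a - 1)) (u a) (u (a + 1)) / (⟪H, u a⟫ * ⟪H, u (a + 1)⟫ * ⟪H, u (a - 1)⟫) := by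
    intro a; rw [zproj_det hH, det3_rot (u (a - 1))]
  have hpos : ∀ a, 0 < ⟪H, u a⟫ * ⟪H, u (a + 1)⟫ * ⟪H, u (a - 1)⟫ := fun a =>
    mul_pos (mul_pos (hH _) (hH _)) (hH _)
  have key := planar_core hpe (fun j => div_nonneg (hY j) (hH j).le) a b hab hab1 hba1
    (by simp [zproj, ha0]) (by simp [zproj, hb0]) hre
    (fun j hj => hgap j ((div_eq_zero_iff.1 hj).resolve_right (hH j).ne'))
    (by rw [hs]; exact div_ne_zero (mul_ne_zero hd da) (hpos a).ne')
    (by rw [hs]; exact div_ne_zero (mul_ne_zero hd db) (hpos b).ne')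
  rw [hs, hs, div_mul_div_comm, div_pos_iff_of_pos_right (mul_pos (hpos a) (hpos b))] at key
  have hσ : 0 < det3 (u (a - 1)) (u a) (u (a + 1)) * det3 (u (b - 1)) (u b) (u (b + 1)) := by
    have : 0 < (det3 X Y H * det3 X Y H) *
      (det3 (u (a - 1)) (u a) (u (a + 1)) * det3 (u (b - 1)) (u b) (u (b + 1))) := by linarith
    exact (pos_iff_pos_of_mul_pos this).1 (mul_self_pos.2 hd)
  have ea := expand_at (u := u) a ha0
  have eb := expand_at (u := u) b hb0
  set σa := det3 (u (a - 1)) (u a) (u (a + 1)) with hσa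
  set σb := det3 (u (b - 1)) (u b) (u (b + 1)) with hσb
  have hsum : ∀ c, ⟪Y, u c⟫ = 0 → 0 < ⟪Y, u (c + 1)⟫ + ⟪Y, u (c - 1)⟫ := by
    intro c hc
    have h1 := hY (c + 1)
    have h2 := hY (c - 1)
    by_contra hle
    have e := expand_at (u := u) c hc
    rw [show ⟪Y, u (c + 1)⟫ = 0 by linarith, show ⟪Y, u (c - 1)⟫ = 0 by linarith] at e
    simp only [zero_smul, add_zero] at e
    exact (smul_ne_zero (hg.det' c) hY0) e
  have hmul : |σb| * σa = |σa| * σb := by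
    rcases mul_pos_iff.1 hσ with ⟨h1, h2⟩ | ⟨h1, h2⟩
    · rw [abs_of_pos h1, abs_of_pos h2]; ring
    · rw [abs_of_neg h1, abs_of_neg h2]; ring
  have pa : 0 < |σa| := abs_pos.2 da
  have pb : 0 < |σb| := abs_pos.2 db
  refine hg.gauss (a - 1) (b - 1) ?_ ?_ ?_ (|σb| * ⟪Y, u (a + 1)⟫) (|σb| * ⟪Y, u (a - 1)⟫)
    (|σa| * ⟪Y, u (b + 1)⟫) (|σa| * ⟪Y, u (b - 1)⟫) (mul_nonneg pb.le (hY _)) (mul_nonneg pb.le (hY _))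
    (mul_nonneg pa.le (hY _)) (mul_nonneg pa.le (hY _))
    (by rw [← mul_add]; exact mul_pos pb (hsum a ha0))
    (by rw [← mul_add]; exact mul_pos pa (hsum b hb0)) ?_
  · intro h; exact hab (sub_left_inj.1 h).symm
  · intro h; apply hab1; linear_combination h
  · intro h; apply hba1; linear_combination h
  · have f : ∀ c : ZMod n, c - 1 + 1 = c := fun c => by ring
    have f2 : ∀ c : ZMod n, c - 1 + 2 = c + 1 := fun c => by ring
    rw [f, f, f2, f2, mul_smul, mul_smul, ← smul_add, ← ea, mul_smul, mul_smul, ← smul_add, ← eb,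
      smul_smul, smul_smul, hmul]

lemma PolyEmb.inj {z : ZMod n → ℂ} (h : PolyEmb z) {i k : ZMod n} (he : z i = z k) : i = k := by
  by_contra hne
  by_cases h1 : i = k + 1
  · subst h1
    have := h.near k 0 0 le_rfl zero_le_one le_rfl zero_le_one (by rw [edgeP_zero, edgeP_zero, he])
    exact zero_ne_one this.1
  · exact h.vert i k hne h1 0 le_rfl zero_le_one (by rw [edgeP_zero, he])

theorem support_pair [NeZero n] (hg : Good u) (hH : ∀ i, 0 < ⟪H, u i⟫)
    (hY0 : Y ≠ 0) (hY : ∀ i, 0 ≤ ⟪Y, u i⟫) (a b : ZMod n) (hab : b ≠ a)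
    (ha0 : ⟪Y, u a⟫ = 0) (hb0 : ⟪Y, u b⟫ = 0) :
    (b = a + 1 ∨ a = b + 1) ∧ ∀ j, j ≠ a → j ≠ b → 0 < ⟪Y, u j⟫ := by
  classical
  obtain ⟨X, hd⟩ : ∃ X, det3 X Y H ≠ 0 := by
    refine ⟨cross3 Y H, ?_⟩
    have h1 : cross3 Y H ≠ 0 := by
      intro h0
      have := cross3_cross3_left Y H (u a)
      rw [h0, ha0] at this
      have h2 : cross3 0 (u a) = 0 := by apply ext3 <;> simp [cross3_zero, cross3_one, cross3_two]
      rw [h2, zero_smul, zero_sub, eq_comm, neg_eq_zero] at this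
      exact smul_ne_zero (hH a).ne' hY0 this
    rw [det3_rot, ← inner_cross3]
    exact fun h => h1 (inner_self_eq_zero.1 h)
  have hpe := polyEmb_zproj (X := X) (Y := Y) hg hH hd
  set r : ZMod n → ℝ := fun j => (zproj X Y H u j).re with hr
  have rinj : ∀ i j, ⟪Y, u i⟫ = 0 → ⟪Y, u j⟫ = 0 → r i = r j → i = j := by
    intro i j hi hj hij
    apply hpe.inj
    apply Complex.ext hij
    simp [zproj, hi, hj]
  have core : ∀ a b, ⟪Y, u a⟫ = 0 → ⟪Y, u b⟫ = 0 → r a < r b →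
      (∀ j, ⟪Y, u j⟫ = 0 → r j ≤ r a ∨ r b ≤ r j) → b = a + 1 ∨ a = b + 1 := by
    intro a b ha hb hlt hgap
    refine support_core hg hH hd hY a b ?_ ha hb hlt hgap
    rintro rfl; exact lt_irrefl _ hlt
  have hpos : ∀ j, j ≠ a → j ≠ b → 0 < ⟪Y, u j⟫ := by
    intro c hca hcb
    refine lt_of_le_of_ne (hY c) fun hc0 => ?_
    have hc0 := hc0.symm
    let Z : Finset (ZMod n) := Finset.univ.filter (fun j => ⟪Y, u j⟫ = 0)
    have mZ : ∀ j, j ∈ Z ↔ ⟪Y, u j⟫ = 0 := fun j => by simp [Z]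
    obtain ⟨p, hp, hpmin⟩ := Finset.exists_min_image Z r ⟨a, (mZ a).2 ha0⟩
    have hcard : 3 ≤ Z.card := by
      have : ({a, b, c} : Finset (ZMod n)) ⊆ Z := by
        intro x hx
        simp only [Finset.mem_insert, Finset.mem_singleton] at hx
        rcases hx with rfl | rfl | rfl
        · exact (mZ _).2 ha0
        · exact (mZ _).2 hb0
        · exact (mZ _).2 hc0
      have h2 := Finset.card_le_card this
      rwa [Finset.card_eq_three.2 ⟨a, b, c, hab.symm, hca.symm, hcb.symm, rfl⟩] at h2
    have hc1 := Finset.card_erase_of_mem hp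
    obtain ⟨p', hp', hpmin'⟩ := Finset.exists_min_image (Z.erase p) r
      (Finset.card_pos.1 (by omega))
    have hc2 := Finset.card_erase_of_mem hp'
    obtain ⟨p'', hp'', hpmin''⟩ := Finset.exists_min_image ((Z.erase p).erase p') r
      (Finset.card_pos.1 (by omega))
    simp only [Finset.mem_erase] at hp' hp'' hpmin' hpmin''
    have zp := (mZ p).1 hp
    have zp' := (mZ p').1 hp'.2
    have zp'' := (mZ p'').1 hp''.2.2
    have l1 : r p < r p' := lt_of_le_of_ne (hpmin _ hp'.2) fun h => hp'.1 (rinj _ _ zp zp' h).symm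
    have l2 : r p' < r p'' := lt_of_le_of_ne (hpmin' _ hp''.2) fun h => hp''.1 (rinj _ _ zp' zp'' h).symm
    have c1 := core p p' zp zp' l1 (by
      intro j hj
      by_cases hjp : j = p
      · left; rw [hjp]
      · right; exact hpmin' j ⟨hjp, (mZ j).2 hj⟩)
    have c2 := core p' p'' zp' zp'' l2 (by
      intro j hj
      by_cases hjp : j = p
      · left; rw [hjp]; exact l1.le
      by_cases hjp' : j = p'
      · left; rw [hjp']
      · right; exact hpmin'' j ⟨hjp', hjp, (mZ j).2 hj⟩)
    have e := expand_at (u := u) p' zp'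
    have : ⟪Y, u (p' + 1)⟫ = 0 ∧ ⟪Y, u (p' - 1)⟫ = 0 := by
      rcases c1 with c1 | c1 <;> rcases c2 with c2 | c2
      · rw [← c2, show p' - 1 = p by rw [c1]; ring]; exact ⟨zp'', zp⟩
      · exact absurd (add_right_cancel (c2.symm.trans c1)) hp''.2.1
      · exact absurd (c2.trans c1.symm) hp''.2.1
      · rw [← c1, show p' - 1 = p'' by rw [c2]; ring]; exact ⟨zp, zp''⟩
    rw [this.1, this.2] at e
    simp only [zero_smul, add_zero] at e
    exact smul_ne_zero (hg.det' p') hY0 e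
  refine ⟨?_, hpos⟩
  have only : ∀ j, ⟪Y, u j⟫ = 0 → j = a ∨ j = b := by
    intro j hj
    by_contra hcon
    push Not at hcon
    exact (hpos j hcon.1 hcon.2).ne' hj
  rcases lt_trichotomy (r a) (r b) with h | h | h
  · apply core a b ha0 hb0 h
    intro j hj
    rcases only j hj with rfl | rfl
    · left; exact le_rfl
    · right; exact le_rfl
  · exact absurd (rinj _ _ ha0 hb0 h).symm hab
  · apply Or.symm
    apply core b a hb0 ha0 h
    intro j hj
    rcases only j hj with rfl | rfl
    · right; exact le_rfl
    · left; exact le_rfl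

end
end Stmt11

namespace Stmt11
open InnerProductGeometry

section
variable {n : ℕ} {u : ZMod n → E3} {H : E3}

def Hull (u : ZMod n → E3) (s : ℝ) (i : ZMod n) : Prop :=
  ∀ j, j ≠ i → j ≠ i + 1 → 0 < s * det3 (u i) (u (i + 1)) (u j)

lemma det3_r1 (a b : E3) : det3 a b a = 0 := by simp only [det3]; ring
lemma det3_r2 (a b : E3) : det3 a b b = 0 := by simp only [det3]; ring

lemma ne_facts (hn : 3 ≤ n) (i : ZMod n) : i + 1 ≠ i ∧ i + 2 ≠ i ∧ i + 2 ≠ i + 1 := by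
  have h1 : (1 : ZMod n) ≠ 0 := by
    intro h
    have := cast_inj (n := n) (i := 1) (j := 0) (by omega) (by omega) (by simpa using h)
    omega
  have h2 : (2 : ZMod n) ≠ 0 := by
    intro h
    have := cast_inj (n := n) (i := 2) (j := 0) (by omega) (by omega) (by simpa using h)
    omega
  refine ⟨?_, ?_, ?_⟩
  · intro h; apply h1; linear_combination h
  · intro h; apply h2; linear_combination h
  · intro h; apply h1; linear_combination h

/-- a supporting functional vanishing at `i, i+1` gives a hull edge -/
lemma hull_of_support (hg : Good u) {Y : E3} (i : ZMod n) (h0 : ⟪Y, u i⟫ = 0) (h1 : ⟪Y, u (i + 1)⟫ = 0)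
    (hpos : ∀ j, j ≠ i → j ≠ i + 1 → 0 < ⟪Y, u j⟫) : ∃ s, Hull u s i := by
  have e := dual_expand (u i) (u (i + 1)) (u (i + 2)) Y
  rw [h0, h1] at e
  simp only [zero_smul, add_zero] at e
  have hd := hg.det i
  refine ⟨⟪Y, u (i + 2)⟫ / det3 (u i) (u (i + 1)) (u (i + 2)), fun j hj1 hj2 => ?_⟩
  have := congrArg (fun x => ⟪x, u j⟫) e
  simp only [inner_smul_left, inner_cross3, RCLike.conj_to_real] at this
  have h2 := hpos j hj1 hj2
  rw [div_mul_eq_mul_div, ← this, mul_div_cancel_left₀ _ hd]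
  exact h2

variable [NeZero n]

lemma hull_base (hg : Good u) (hH : ∀ i, 0 < ⟪H, u i⟫) : ∃ s i, Hull u s i := by
  classical
  -- reduce to a supporting functional with two zeros
  suffices hs : ∃ Y : E3, Y ≠ 0 ∧ (∀ i, 0 ≤ ⟪Y, u i⟫) ∧ ∃ a b, b ≠ a ∧ ⟪Y, u a⟫ = 0 ∧ ⟪Y, u b⟫ = 0 by
    obtain ⟨Y, hY0, hY, a, b, hab, ha, hb⟩ := hs
    obtain ⟨hadj, hpos⟩ := support_pair hg hH hY0 hY a b hab ha hb
    rcases hadj with rfl | rfl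
    · obtain ⟨s, hs⟩ := hull_of_support hg a ha hb hpos
      exact ⟨s, a, hs⟩
    · obtain ⟨s, hs⟩ := hull_of_support hg b hb ha (fun j h1 h2 => hpos j h2 h1)
      exact ⟨s, b, hs⟩
  set X := cross3 (u 0) (u (0 + 1)) with hX
  have hX0 : X ≠ 0 := by
    intro h
    apply hg.det 0
    rw [← inner_cross3, ← hX, h]; simp
  obtain ⟨a, -, hamin⟩ := Finset.exists_min_image Finset.univ (fun j => ⟪X, u j⟫ / ⟪H, u j⟫)
    ⟨0, Finset.mem_univ _⟩
  set c := ⟪X, u a⟫ / ⟪H, u a⟫ with hc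
  set Y1 := X - c • H with hY1
  have iY1 : ∀ j, ⟪Y1, u j⟫ = ⟪X, u j⟫ - c * ⟪H, u j⟫ := by
    intro j; rw [hY1, inner_sub_left, inner_smul_left]; rfl
  have Y1a : ⟪Y1, u a⟫ = 0 := by
    rw [iY1, hc, div_mul_cancel₀ _ (hH a).ne']; ring
  have Y1n : ∀ j, 0 ≤ ⟪Y1, u j⟫ := by
    intro j
    have := hamin j (Finset.mem_univ _)
    rw [le_div_iff₀ (hH j)] at this
    rw [iY1]; linarith
  have Y10 : Y1 ≠ 0 := by
    intro h
    have h0 := iY1 0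
    rw [h, hX, inner_cross3, det3_r1] at h0
    simp only [inner_zero_left, zero_sub, zero_eq_neg, mul_eq_zero, (hH 0).ne', or_false] at h0
    rw [h0] at hY1
    apply hX0
    rw [← h, hY1]; simp
  by_cases hz : ∃ b, b ≠ a ∧ ⟪Y1, u b⟫ = 0
  · obtain ⟨b, hba, hb⟩ := hz
    exact ⟨Y1, Y10, Y1n, a, b, hba, Y1a, hb⟩
  push Not at hz
  have Y1p : ∀ j, j ≠ a → 0 < ⟪Y1, u j⟫ := fun j hj => lt_of_le_of_ne (Y1n j) (hz j hj).symm
  set X2 := cross3 (u a) Y1 with hX2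
  have X2a : ⟪X2, u a⟫ = 0 := by rw [hX2, inner_cross3, det3_r1]
  have X2Y : ⟪X2, Y1⟫ = 0 := by rw [hX2, inner_cross3, det3_r2]
  have ua : u a ≠ 0 := by
    intro h; have := hH a; rw [h] at this; simp at this
  have X20 : X2 ≠ 0 := by
    intro h
    have := cross3_cross3_left (u a) Y1 Y1
    rw [← hX2, h, real_inner_comm, Y1a] at this
    have h2 : cross3 0 Y1 = 0 := by apply ext3 <;> simp [cross3_zero, cross3_one, cross3_two]
    rw [h2, zero_smul, zero_sub, eq_comm, neg_eq_zero] at this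
    exact smul_ne_zero (fun h => Y10 (inner_self_eq_zero.1 h)) ua this
  obtain ⟨b, hb, hbmin⟩ := Finset.exists_min_image (Finset.univ.erase a)
    (fun j => ⟪X2, u j⟫ / ⟪Y1, u j⟫)
    ⟨a + 1, Finset.mem_erase.2 ⟨(ne_facts hg.hn a).1, Finset.mem_univ _⟩⟩
  have hba : b ≠ a := (Finset.mem_erase.1 hb).1
  set d := ⟪X2, u b⟫ / ⟪Y1, u b⟫ with hd
  have iY : ∀ j, ⟪X2 - d • Y1, u j⟫ = ⟪X2, u j⟫ - d * ⟪Y1, u j⟫ := by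
    intro j; rw [inner_sub_left, inner_smul_left]; rfl
  refine ⟨X2 - d • Y1, ?_, ?_, a, b, hba, ?_, ?_⟩
  · intro h
    apply X20
    have : ⟪X2, X2 - d • Y1⟫ = 0 := by rw [h]; simp
    rw [inner_sub_right, inner_smul_right, X2Y] at this
    simpa using this
  · intro j
    rw [iY]
    by_cases hj : j = a
    · rw [hj, X2a, Y1a]; simp
    · have := hbmin j (Finset.mem_erase.2 ⟨hj, Finset.mem_univ _⟩)
      rw [le_div_iff₀ (Y1p j hj)] at this
      linarith
  · rw [iY, X2a, Y1a]; simp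
  · rw [iY, hd, div_mul_cancel₀ _ (Y1p b hba).ne']; ring

lemma hull_step (hg : Good u) (hH : ∀ i, 0 < ⟪H, u i⟫) (s : ℝ) (i : ZMod n) (h : Hull u s i) :
    Hull u s (i + 1) := by
  classical
  obtain ⟨n1, n2, n3⟩ := ne_facts hg.hn i
  have e2 : i + 1 + 1 = i + 2 := by ring
  have hM : ∀ j, ⟪s • cross3 (u i) (u (i + 1)), u j⟫ = s * det3 (u i) (u (i + 1)) (u j) := by
    intro j; rw [inner_smul_left, inner_cross3]; rfl
  have hX : ∀ j, ⟪s • cross3 (u (i + 1)) (u (i + 2)), u j⟫ = s * det3 (u (i + 1)) (u (i + 2)) (u j) := by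
    intro j; rw [inner_smul_left, inner_cross3]; rfl
  set M := s • cross3 (u i) (u (i + 1))
  set X := s • cross3 (u (i + 1)) (u (i + 2))
  have Mp : ∀ j, j ≠ i → j ≠ i + 1 → 0 < ⟪M, u j⟫ := fun j h1 h2 => by rw [hM]; exact h j h1 h2
  have Mi : ⟪M, u i⟫ = 0 := by rw [hM, det3_r1, mul_zero]
  have Mi1 : ⟪M, u (i + 1)⟫ = 0 := by rw [hM, det3_r2, mul_zero]
  have Xi1 : ⟪X, u (i + 1)⟫ = 0 := by rw [hX, det3_r1, mul_zero]
  have Xi2 : ⟪X, u (i + 2)⟫ = 0 := by rw [hX, det3_r2, mul_zero]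
  have Xi : 0 < ⟪X, u i⟫ := by rw [hX, ← det3_rot]; exact h _ n2 n3
  obtain ⟨k, hk, hkmin⟩ := Finset.exists_min_image ((Finset.univ.erase i).erase (i + 1))
    (fun j => ⟪X, u j⟫ / ⟪M, u j⟫)
    ⟨i + 2, Finset.mem_erase.2 ⟨n3, Finset.mem_erase.2 ⟨n2, Finset.mem_univ _⟩⟩⟩
  simp only [Finset.mem_erase, Finset.mem_univ, and_true] at hk hkmin
  set c := ⟪X, u k⟫ / ⟪M, u k⟫ with hc
  have iY : ∀ j, ⟪X - c • M, u j⟫ = ⟪X, u j⟫ - c * ⟪M, u j⟫ := by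
    intro j; rw [inner_sub_left, inner_smul_left M (u j) c]; rfl
  have Yi : 0 < ⟪X - c • M, u i⟫ := by rw [iY, Mi]; linarith
  have Yk : ⟪X - c • M, u k⟫ = 0 := by
    rw [iY, hc, div_mul_cancel₀ _ (Mp k hk.2 hk.1).ne']; ring
  have Yi1 : ⟪X - c • M, u (i + 1)⟫ = 0 := by rw [iY, Xi1, Mi1]; ring
  have Yn : ∀ j, 0 ≤ ⟪X - c • M, u j⟫ := by
    intro j
    by_cases h1 : j = i
    · rw [h1]; exact Yi.le
    by_cases h2 : j = i + 1
    · rw [h2, Yi1]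
    have := hkmin j ⟨h2, h1⟩
    rw [le_div_iff₀ (Mp j h1 h2)] at this
    rw [iY]; linarith
  have Y0 : X - c • M ≠ 0 := by
    intro h0; rw [h0] at Yi; simp at Yi
  obtain ⟨hadj, hpos⟩ := support_pair hg hH Y0 Yn (i + 1) k hk.1 Yi1 Yk
  have hk2 : k = i + 2 := by
    rcases hadj with h | h
    · rw [h, e2]
    · exact absurd (add_right_cancel h).symm hk.2
  have c0 : c = 0 := by rw [hc, hk2, Xi2, zero_div]
  intro j h1 h2
  rw [e2] at h2 ⊢
  have := hpos j h1 (by rw [hk2]; exact h2)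
  rw [iY, c0, hX] at this
  linarith

theorem lt_of_half (hg : Good u) (hH : ∀ i, 0 < ⟪H, u i⟫) :
    ∑ i, angle (u i) (u (i + 1)) < 2 * Real.pi := by
  obtain ⟨s, i0, h0⟩ := hull_base hg hH
  have hall : ∀ k : ℕ, Hull u s (i0 + (k : ZMod n)) := by
    intro k
    induction k with
    | zero => simpa using h0
    | succ k ih =>
      have := hull_step hg hH s _ ih
      push_cast
      rwa [add_assoc] at this
  apply sum_angle_lt' hg.hn u s
  intro i j h1 h2
  have := hall (i - i0).val
  rw [ZMod.natCast_zmod_val, add_sub_cancel] at this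
  exact this j h1 h2

theorem gt_of_not_half (hg : Good u) (hH : ¬ ∃ f : E3 →ₗ[ℝ] ℝ, ∀ i, 0 < f (u i)) :
    2 * Real.pi < ∑ i, angle (u i) (u (i + 1)) := by
  classical
  let T : (ZMod n → ℝ) →ₗ[ℝ] E3 := Fintype.linearCombination ℝ u
  have hT : ∀ l, T l = ∑ i, l i • u i := fun l => Fintype.linearCombination_apply ℝ u l
  have h0 : (0 : E3) ∈ T '' stdSimplex ℝ (ZMod n) := by
    by_contra hcon
    have hcl : IsClosed (T '' stdSimplex ℝ (ZMod n)) :=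
      ((isCompact_stdSimplex ℝ (ZMod n)).image T.continuous_of_finiteDimensional).isClosed
    obtain ⟨f, c, hf, hc⟩ := geometric_hahn_banach_point_closed
      ((convex_stdSimplex ℝ (ZMod n)).linear_image T) hcl hcon
    apply hH
    refine ⟨f.toLinearMap, fun i => ?_⟩
    have := hc (u i) ⟨Pi.single i 1, single_mem_stdSimplex ℝ i, by
      rw [hT]; simp [Pi.single_apply]⟩
    rw [map_zero] at hf
    exact hf.trans this
  obtain ⟨l, hl, hl0⟩ := h0
  rw [hT] at hl0
  refine sum_angle_gt hg.hn u hg.det l hl.1 ?_ hl0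
  by_contra hcon
  push Not at hcon
  have := hl.2
  have h2 : ∑ i, l i ≤ 0 := Finset.sum_nonpos fun i _ => hcon i
  linarith

end

section
variable {n : ℕ}

lemma nrm_neg (x : E3) : nrm (-x) = - nrm x := by simp [nrm]

lemma good_of_star (v : E3) (w : ZMod n → E3) (h : IsStar v w) (hG : GaussEmb v w) :
    Good (fun i => w i - v) := by
  have fn : ∀ i, starFN v w i = cross3 (w i - v) (w (i + 1) - v) := fun i => rfl
  have fne := fun i => starFN_ne_zero v w h i
  refine ⟨h.1, ?_, ?_, ?_⟩
  · intro i hdet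
    have hc := cross3_cross3 (w i - v) (w (i + 1) - v) (w (i + 2) - v)
    rw [hdet, zero_smul, ← fn i, show i + 2 = i + 1 + 1 by ring, ← fn (i + 1)] at hc
    have hli : ¬ LinearIndependent ℝ ![starFN v w i, starFN v w (i + 1)] :=
      fun hl => cross3_ne_zero hl hc
    rw [LinearIndependent.pair_iff' (fne i)] at hli
    push Not at hli
    obtain ⟨c, hc⟩ := hli
    have h3 := h.2.2.1 i
    rw [starUN_eq, starUN_eq, ← hc] at h3
    rcases lt_trichotomy c 0 with h0 | h0 | h0
    · apply h3.2
      rw [← nrm_pos_smul (neg_pos.2 h0) (starFN v w i), ← nrm_neg]; congr 1; module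
    · rw [h0, zero_smul] at hc; exact fne (i + 1) hc.symm
    · exact h3.1 (nrm_pos_smul h0 _)
  · intro i j h1 h2 h3 s t s' t' hs ht hs' ht' he
    have hmeet := (h.2.2.2 i j h1).2.2 h2 h3
    have memface : ∀ (i : ZMod n) (s t : ℝ), 0 ≤ s → 0 ≤ t → s + t ≤ 1 →
        v + (s • (w i - v) + t • (w (i + 1) - v)) ∈ starFace v w i := by
      intro i s t hs ht hst
      unfold starFace
      rw [convexHull_insert ⟨w i, by simp⟩, convexHull_pair, mem_convexJoin]
      by_cases h0 : s + t = 0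
      · have s0 : s = 0 := by linarith
        have t0 : t = 0 := by linarith
        refine ⟨v, by simp, w i, left_mem_segment ℝ _ _, ?_⟩
        rw [s0, t0]; simp [left_mem_segment]
      · have hp : 0 < s + t := lt_of_le_of_ne (by linarith) (Ne.symm h0)
        refine ⟨v, by simp, (s / (s + t)) • w i + (t / (s + t)) • w (i + 1),
          ⟨_, _, by positivity, by positivity, by field_simp, rfl⟩,
          ⟨1 - (s + t), s + t, by linarith, hp.le, by ring, ?_⟩⟩
        rw [smul_add, smul_smul, smul_smul, mul_div_cancel₀ _ h0, mul_div_cancel₀ _ h0]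
        module
    set ε := (1 + s + t + s' + t')⁻¹ with hε
    have hD : 0 < 1 + s + t + s' + t' := by positivity
    have hεp : 0 < ε := inv_pos.2 hD
    have hεD : ε * (1 + s + t + s' + t') = 1 := inv_mul_cancel₀ hD.ne'
    have m1 := memface i (ε * s) (ε * t) (by positivity) (by positivity) (by nlinarith)
    have m2 := memface j (ε * s') (ε * t') (by positivity) (by positivity) (by nlinarith)
    rw [mul_smul, mul_smul, ← smul_add] at m1 m2
    rw [← he] at m2
    have := hmeet.subset ⟨m1, m2⟩
    rw [Set.mem_singleton_iff, add_eq_left] at this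
    exact (smul_eq_zero.1 this).resolve_left hεp.ne'
  · intro i j h1 h2 h3 s t s' t' hs ht hs' ht' hst hst' he
    have hmeet := (hG.2 i j h1).2.2 h2 h3
    rw [starUN_eq, starUN_eq, starUN_eq, starUN_eq, sArc_nrm (fne _) (fne _),
      sArc_nrm (fne _) (fne _)] at hmeet
    rw [show i + 2 = i + 1 + 1 by ring, show j + 2 = j + 1 + 1 by ring, ← fn, ← fn, ← fn, ← fn] at he
    have m1 : nrm (s • starFN v w i + t • starFN v w (i + 1)) ∈
        sArc (starFN v w i) (starFN v w (i + 1)) := ⟨s, t, hs, ht, hst, rfl⟩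
    have m2 : nrm (s • starFN v w i + t • starFN v w (i + 1)) ∈
        sArc (starFN v w j) (starFN v w (j + 1)) := ⟨s', t', hs', ht', hst', by rw [he]; rfl⟩
    have := hmeet.subset ⟨m1, m2⟩
    exact this

def Half (u : ZMod n → E3) : Prop := ∃ f : E3 →ₗ[ℝ] ℝ, ∀ i, 0 < f (u i)

theorem curv_sign [NeZero n] (v : E3) (w : ZMod n → E3) (h : IsStar v w) (hG : GaussEmb v w) :
    (Half (fun i => w i - v) → 0 < curv v w) ∧ (¬ Half (fun i => w i - v) → curv v w < 0) := by
  have hg := good_of_star v w h hG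
  constructor
  · rintro ⟨f, hf⟩
    have hH : ∀ i, 0 < ⟪(InnerProductSpace.toDual ℝ E3).symm (LinearMap.toContinuousLinearMap f),
        (fun i => w i - v) i⟫ := by
      intro i
      rw [InnerProductSpace.toDual_symm_apply]
      exact hf i
    have := lt_of_half hg hH
    unfold curv
    linarith
  · intro hn
    have := gt_of_not_half hg hn
    unfold curv
    linarith

theorem main [NeZero n] (v : E3) (w : ZMod n → E3)
    (hstar : IsStar v w) (hG : GaussEmb v w)
    (L : E3 →ₗ[ℝ] E3) (hL : Function.Bijective L) (t : E3) :
    (0 < curv (L v + t) (fun i => L (w i) + t) ↔ 0 < curv v w) ∧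
    (curv (L v + t) (fun i => L (w i) + t) < 0 ↔ curv v w < 0) := by
  have a := curv_sign v w hstar hG
  have b := curv_sign _ _ (isStar_map v w L t hL hstar) (gaussEmb_map v w L t hL hstar hG)
  have hiff : Half (fun i => w i - v) ↔ Half (fun i => (L (w i) + t) - (L v + t)) := by
    have hsub : ∀ i, (L (w i) + t) - (L v + t) = L (w i - v) := fun i => by rw [map_sub]; abel
    constructor
    · rintro ⟨f, hf⟩
      refine ⟨f ∘ₗ (LinearEquiv.ofBijective L hL).symm.toLinearMap, fun i => ?_⟩
      simp only [hsub]
      have : (LinearEquiv.ofBijective L hL).symm (L (w i - v)) = w i - v :=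
        (LinearEquiv.ofBijective L hL).symm_apply_apply _
      simp only [LinearMap.comp_apply, LinearEquiv.coe_coe]
      rw [this]
      exact hf i
    · rintro ⟨f, hf⟩
      refine ⟨f ∘ₗ L, fun i => ?_⟩
      have := hf i
      simp only [hsub] at this
      exact this
  by_cases hh : Half (fun i => w i - v)
  · have h1 := a.1 hh
    have h2 := b.1 (hiff.1 hh)
    exact ⟨⟨fun _ => h1, fun _ => h2⟩, ⟨fun h => absurd h h2.le.not_gt, fun h => absurd h h1.le.not_gt⟩⟩
  · have h1 := a.2 hh
    have h2 := b.2 (fun h => hh (hiff.2 h))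
    exact ⟨⟨fun h => absurd h h2.le.not_gt, fun h => absurd h h1.le.not_gt⟩, ⟨fun _ => h1, fun _ => h2⟩⟩

end
end Stmt11

/-- Part of Theorem 4.1: if `ρ(x) = L x + t` is an invertible affine transformation of
`ℝ³` and `(v; w₀, …, w_{n−1})` is an embedded, immersed simplicial vertex star whose
Gauss image has no self-intersections, then the image `(ρ(v); ρ(w₀), …, ρ(w_{n−1}))` is
again an embedded, immersed simplicial vertex star, its Gauss image has no
self-intersections, and its discrete Gaussian curvature has the same sign as that of
the original star. -/
theorem stmt11 {n : ℕ} [NeZero n] (v : E3) (w : ZMod n → E3)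
    (hstar : IsStar v w) (hG : GaussEmb v w)
    (L : E3 →ₗ[ℝ] E3) (hL : Function.Bijective L) (t : E3) :
    IsStar (L v + t) (fun i => L (w i) + t) ∧
    GaussEmb (L v + t) (fun i => L (w i) + t) ∧
    (0 < curv (L v + t) (fun i => L (w i) + t) ↔ 0 < curv v w) ∧
    (curv (L v + t) (fun i => L (w i) + t) < 0 ↔ curv v w < 0) := by
  exact ⟨Stmt11.isStar_map v w L t hL hstar, Stmt11.gaussEmb_map v w L t hL hstar hG,
    Stmt11.main v w hstar hG L hL t⟩
end
end
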